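/- arXiv:1804.06500 — 4 statements merged into one kernel-verified Lean document; each statement's English description precedes it below -/
import Mathlib

section
/- Suppose Θ is a compact Hausdorff space and the objective, constraint and proxy constraint functions g₀,g₁,…,g_m,g̃₁,…,g̃_m : Θ → ℝ are continuous. Then the proxy-Lagrangian game, in which the θ-player minimizes ℒ_θ and the λ-player maximizes ℒ_λ over λ ∈ Δ^{m+1}, has a mixed Nash equilibrium (μ, λ) where μ is a probability distribution supported on at most m+1 elements of Θ and λ ∈ Δ^{m+1} is non-random; i.e. E_{θ∼μ}[ℒ_θ(θ,λ)] = min_{θ*∈Θ} ℒ_θ(θ*,λ) and E_{θ∼μ}[ℒ_λ(θ,λ)] = max_{λ*∈Δ^{m+1}} E_{θ∼μ}[ℒ_λ(θ,λ*)]. -/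
open MeasureTheory

/-- The determinant of `1 + t • A` is a polynomial in `t` of degree at most the dimension. -/
theorem exists_polynomial_eval_eq_det_one_add_smul {E : Type*} [NormedAddCommGroup E]
    [NormedSpace ℝ E] [FiniteDimensional ℝ E] (A : E →L[ℝ] E) :
    ∃ p : Polynomial ℝ, p.natDegree ≤ Module.finrank ℝ E ∧
      ∀ t : ℝ, p.eval t = (1 + t • A).det := by
  classical
  let b := Module.finBasis ℝ E
  let M := LinearMap.toMatrix b b (A : E →ₗ[ℝ] E)
  refine ⟨((Polynomial.X : Polynomial ℝ) • M.map Polynomial.C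
    + (1 : Matrix _ _ ℝ).map Polynomial.C).det, ?_, fun t => ?_⟩
  · simpa using Polynomial.natDegree_det_X_add_C_le M 1
  · rw [← Polynomial.coe_evalRingHom, RingHom.map_det, ContinuousLinearMap.det,
      ← LinearMap.det_toMatrix b]
    congr 1
    have : LinearMap.toMatrix b b ((1 + t • A : E →L[ℝ] E) : E →ₗ[ℝ] E) = 1 + t • M := by
      have h : ((1 + t • A : E →L[ℝ] E) : E →ₗ[ℝ] E) = LinearMap.id + t • (A : E →ₗ[ℝ] E) := rfl
      rw [h, map_add, map_smul, LinearMap.toMatrix_id]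
    rw [this]
    ext i j
    by_cases hij : i = j <;> simp [hij] <;> ring

/-- A bounded operator of norm less than one perturbs the identity to an operator with positive
determinant. -/
theorem det_one_add_smul_pos {E : Type*} [NormedAddCommGroup E] [NormedSpace ℝ E]
    [FiniteDimensional ℝ E] (A : E →L[ℝ] E) {t : ℝ} (ht : 0 ≤ t) (hA : t * ‖A‖ < 1) :
    0 < (1 + t • A).det := by
  obtain ⟨p, -, hp⟩ := exists_polynomial_eval_eq_det_one_add_smul A
  have hne : ∀ s ∈ Set.Icc 0 t, p.eval s ≠ 0 := by
    intro s hs h0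
    rw [hp] at h0
    obtain ⟨v, hv, hv0⟩ := (LinearMap.bot_lt_ker_of_det_eq_zero h0).ne'
      |> (Submodule.ne_bot_iff _).1
    have h1 : v = -(s • A v) := by
      have : v + s • A v = 0 := by simpa using hv
      exact eq_neg_of_add_eq_zero_left this
    have h2 : ‖v‖ ≤ s * ‖A‖ * ‖v‖ := by
      calc ‖v‖ = s * ‖A v‖ := by
            conv_lhs => rw [h1]
            rw [norm_neg, norm_smul, Real.norm_of_nonneg hs.1]
        _ ≤ s * (‖A‖ * ‖v‖) := by gcongr; exacts [hs.1, A.le_opNorm v]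
        _ = _ := by ring
    have h3 : s * ‖A‖ < 1 := lt_of_le_of_lt (by gcongr; exact hs.2) hA
    have h4 : 0 < ‖v‖ := norm_pos_iff.2 hv0
    nlinarith
  rw [← hp]
  by_contra! h
  have h0 : p.eval 0 = 1 := by simp [hp, ContinuousLinearMap.det]
  obtain ⟨s, hs, hs0⟩ := intermediate_value_Icc' ht p.continuous.continuousOn
    (show (0 : ℝ) ∈ Set.Icc (p.eval t) (p.eval 0) from ⟨h, by rw [h0]; exact zero_le_one⟩)
  exact hne s hs hs0

/-- The identity plus a strict contraction is bijective. -/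
theorem LipschitzWith.bijective_id_add {E : Type*} [NormedAddCommGroup E] [CompleteSpace E]
    {H : E → E} {K : NNReal} (hH : LipschitzWith K H) (hK : K < 1) :
    Function.Bijective fun x => x + H x := by
  constructor
  · intro x y hxy
    have h1 : x - y = H y - H x := by
      rw [sub_eq_sub_iff_add_eq_add]; rw [add_comm (H y)]; exact hxy
    have h2 := hH.dist_le_mul y x
    rw [dist_eq_norm, ← h1, dist_comm, dist_eq_norm] at h2
    have h3 : (K : ℝ) < 1 := hK
    have h4 : ‖x - y‖ = 0 := by nlinarith [norm_nonneg (x - y)]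
    exact sub_eq_zero.1 (norm_eq_zero.1 h4)
  · intro y
    have hc : ContractingWith K fun x => y - H x := by
      refine ⟨hK, LipschitzWith.of_dist_le_mul fun a b => ?_⟩
      rw [dist_sub_left]
      exact hH.dist_le_mul a b
    have := hc.fixedPoint_isFixedPt
    refine ⟨hc.fixedPoint, ?_⟩
    exact (eq_sub_iff_add_eq.1 this.symm)

/-- A Lipschitz function on the unit ball that vanishes on the unit sphere extends by zero to a
Lipschitz function. -/
theorem LipschitzOnWith.indicator_closedBall {E : Type*} [NormedAddCommGroup E] [NormedSpace ℝ E]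
    {h : E → E} {K : NNReal} (hK : LipschitzOnWith K h (Metric.closedBall 0 1))
    (h0 : ∀ x, ‖x‖ = 1 → h x = 0) :
    LipschitzWith K ((Metric.closedBall 0 1).indicator h) := by
  have key : ∀ x ∈ Metric.closedBall (0 : E) 1, ∀ y ∉ Metric.closedBall (0 : E) 1,
      dist (h x) 0 ≤ K * dist x y := by
    intro x hx y hy
    rw [mem_closedBall_zero_iff] at hx hy
    have hcont : ContinuousOn (fun t : ℝ => ‖AffineMap.lineMap x y t‖) (Set.Icc 0 1) :=
      (AffineMap.lineMap_continuous.norm).continuousOn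
    obtain ⟨t, ht, ht1⟩ := intermediate_value_Icc zero_le_one hcont
      (show (1 : ℝ) ∈ _ from ⟨by simpa using hx, by simpa using (not_le.1 hy).le⟩)
    have hz := hK.dist_le_mul x (mem_closedBall_zero_iff.2 hx) (AffineMap.lineMap x y t)
      (mem_closedBall_zero_iff.2 ht1.le)
    rw [h0 _ ht1, dist_left_lineMap, Real.norm_of_nonneg ht.1] at hz
    refine hz.trans ?_
    have : t * dist x y ≤ dist x y := mul_le_of_le_one_left dist_nonneg ht.2
    gcongr
  refine LipschitzWith.of_dist_le_mul fun x y => ?_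
  by_cases hx : x ∈ Metric.closedBall (0 : E) 1 <;> by_cases hy : y ∈ Metric.closedBall (0 : E) 1
  · simpa [Set.indicator_of_mem hx, Set.indicator_of_mem hy] using hK.dist_le_mul x hx y hy
  · simpa only [Set.indicator_of_mem hx, Set.indicator_of_notMem hy] using key x hx y hy
  · rw [Set.indicator_of_notMem hx, Set.indicator_of_mem hy, dist_comm, dist_comm x]
    exact key y hy x hx
  · rw [Set.indicator_of_notMem hx, Set.indicator_of_notMem hy, dist_self]
    positivity

/-- A bijection of the whole space that fixes every point outside a set maps this set onto
itself. -/
theorem Function.Bijective.image_eq_of_eqOn_compl {α : Type*} {f : α → α}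
    (hf : Function.Bijective f) {s : Set α} (hs : Set.EqOn f id sᶜ) : f '' s = s := by
  have h := Set.image_compl_eq (s := sᶜ) hf
  rwa [hs.image_eq, Set.image_id, compl_compl] at h

/-- A differentiable map into the unit sphere has singular derivative. -/
theorem det_fderiv_eq_zero_of_norm_eq_one {E : Type*} [NormedAddCommGroup E]
    [InnerProductSpace ℝ E] [FiniteDimensional ℝ E] {f : E → E} (hf : Differentiable ℝ f)
    (hn : ∀ x, ‖f x‖ = 1) (x : E) : (fderiv ℝ f x).det = 0 := by
  by_contra hdet
  let e := LinearMap.equivOfDetNeZero (fderiv ℝ f x : E →ₗ[ℝ] E) hdet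
  obtain ⟨v, hv⟩ : ∃ v, fderiv ℝ f x v = f x := e.surjective (f x)
  have h1 : (fun y => inner ℝ (f y) (f y)) = fun _ => (1 : ℝ) := by
    ext y; simp [hn]
  have h2 := fderiv_inner_apply ℝ (hf x) (hf x) v
  rw [h1, hv] at h2
  norm_num [hn] at h2

/-- There is no continuously differentiable retraction onto the unit sphere. -/
theorem not_exists_contDiff_retraction_sphere {E : Type*} [NormedAddCommGroup E]
    [InnerProductSpace ℝ E] [FiniteDimensional ℝ E] {f : E → E} (hf : ContDiff ℝ 1 f)
    (hn : ∀ x, ‖f x‖ = 1) (hs : ∀ x, ‖x‖ = 1 → f x = x) : False := by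
  borelize E
  let B : Set E := Metric.closedBall 0 1
  let μ : Measure E := Measure.addHaar
  have hdf : Differentiable ℝ f := hf.differentiable one_ne_zero
  have hcf : Continuous (fderiv ℝ f) := hf.continuous_fderiv one_ne_zero
  let h : E → E := fun x => f x - x
  let h' : E → E →L[ℝ] E := fun x => fderiv ℝ f x - 1
  have hh' : ∀ x, HasFDerivAt h (h' x) x := fun x => (hdf x).hasFDerivAt.sub (hasFDerivAt_id x)
  have hch' : Continuous h' := hcf.sub continuous_const
  have hB : IsCompact B := isCompact_closedBall 0 1
  obtain ⟨C, hC⟩ := hB.exists_bound_of_continuousOn hch'.continuousOn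
  let K : NNReal := Real.toNNReal C + 1
  have hCK : ∀ x ∈ B, ‖h' x‖ ≤ K := fun x hx =>
    (hC x hx).trans ((Real.le_coe_toNNReal C).trans (by simp [K]))
  have hlip : LipschitzOnWith K h B := by
    refine (convex_closedBall 0 1).lipschitzOnWith_of_nnnorm_fderiv_le
      (fun x _ => (hh' x).differentiableAt) fun x hx => ?_
    rw [(hh' x).fderiv]
    exact hCK x hx
  have hK0 : 0 < K := by positivity
  have hvol : ∀ t : NNReal, t * K < 1 → ∫ x in B, (1 + (t : ℝ) • h' x).det ∂μ = μ.real B := by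
    intro t ht
    let H : E → E := B.indicator fun x => (t : ℝ) • h x
    have hH : LipschitzWith (t * K) H := by
      refine LipschitzOnWith.indicator_closedBall ?_ fun x hx => by simp [h, hs x hx]
      refine LipschitzOnWith.of_dist_le_mul fun x hx y hy => ?_
      rw [dist_smul₀, NNReal.coe_mul, mul_assoc, Real.norm_of_nonneg t.coe_nonneg]
      gcongr
      exact hlip.dist_le_mul x hx y hy
    have hbij := hH.bijective_id_add ht
    have himg : (fun x => x + (t : ℝ) • h x) '' B = B := by
      rw [← hbij.image_eq_of_eqOn_compl (s := B) fun x hx => by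
        simp [H, Set.indicator_of_notMem hx]]
      rw [hbij.image_eq_of_eqOn_compl (s := B) fun x hx => by
        simp [H, Set.indicator_of_notMem hx]]
      conv_rhs => rw [← hbij.image_eq_of_eqOn_compl (s := B) fun x hx => by
        simp [H, Set.indicator_of_notMem hx]]
      exact Set.image_congr fun x hx => by simp [H, Set.indicator_of_mem hx]
    have hinj : Set.InjOn (fun x => x + (t : ℝ) • h x) B :=
      hbij.injective.injOn.congr fun x hx => by simp [H, Set.indicator_of_mem hx]
    have hcov := integral_image_eq_integral_abs_det_fderiv_smul μ
      (s := B) (f := fun x => x + (t : ℝ) • h x) (f' := fun x => 1 + (t : ℝ) • h' x)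
      hB.measurableSet
      (fun x _ => ((hasFDerivAt_id x).add ((hh' x).const_smul (t : ℝ))).hasFDerivWithinAt)
      hinj (fun _ => (1 : ℝ))
    rw [himg] at hcov
    have : ∫ x in B, (1 + (t : ℝ) • h' x).det ∂μ
        = ∫ x in B, |(1 + (t : ℝ) • h' x).det| • (1 : ℝ) ∂μ := by
      refine setIntegral_congr_fun hB.measurableSet fun x hx => ?_
      have : 0 < (1 + (t : ℝ) • h' x).det := by
        refine det_one_add_smul_pos _ t.coe_nonneg (lt_of_le_of_lt ?_ (show (t * K : ℝ) < 1 from ht))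
        gcongr
        exact hCK x hx
      simp [abs_of_pos this]
    rw [this, ← hcov]
    simp
  let s := Finset.range (Module.finrank ℝ E + 1)
  let v : ℕ → NNReal := fun j => (K * (j + 2))⁻¹
  have hv : Set.InjOn (fun j => (v j : ℝ)) s := by
    intro i _ j _ hij
    simpa [v, hK0.ne'] using hij
  have hvK : ∀ j, v j * K < 1 := by
    intro j
    have : v j * K = (j + 2 : NNReal)⁻¹ := by
      simp only [v]; field_simp
    rw [this]
    refine inv_lt_one_of_one_lt₀ ?_
    have : (0 : NNReal) ≤ j := zero_le
    calc (1 : NNReal) < 2 := one_lt_two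
      _ ≤ j + 2 := le_add_self
  let L : ℕ → ℝ := fun j => (Lagrange.basis s (fun j => (v j : ℝ)) j).eval 1
  have hL : ∑ j ∈ s, L j = 1 := by
    have := Lagrange.sum_basis hv ⟨0, by simp [s]⟩
    simpa [L, Polynomial.eval_finsetSum] using congrArg (Polynomial.eval 1) this
  have hint : ∀ j, IntegrableOn (fun x => (1 + (v j : ℝ) • h' x).det) B μ := fun j =>
    (ContinuousLinearMap.continuous_det.comp
      (continuous_const.add (hch'.const_smul (v j : ℝ)))).continuousOn.integrableOn_compact hB
  have hpt : ∀ x, ∑ j ∈ s, L j * (1 + (v j : ℝ) • h' x).det = 0 := by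
    intro x
    obtain ⟨p, hpd, hp⟩ := exists_polynomial_eval_eq_det_one_add_smul (h' x)
    have hdeg : p.degree < s.card := by
      refine lt_of_le_of_lt Polynomial.degree_le_natDegree ?_
      simp only [s, Finset.card_range]
      exact_mod_cast Nat.lt_succ_of_le hpd
    have h1 := congrArg (Polynomial.eval 1) (Lagrange.eq_interpolate hv hdeg)
    rw [Lagrange.interpolate_apply, Polynomial.eval_finsetSum, hp] at h1
    have h2 : (1 + (1 : ℝ) • h' x).det = 0 := by
      simpa [h'] using det_fderiv_eq_zero_of_norm_eq_one hdf hn x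
    rw [h2] at h1
    rw [h1]
    refine Finset.sum_congr rfl fun j _ => ?_
    simp [L, hp, mul_comm]
  have hfin : μ.real B = 0 := by
    calc μ.real B = ∑ j ∈ s, L j * μ.real B := by rw [← Finset.sum_mul, hL, one_mul]
      _ = ∑ j ∈ s, ∫ x in B, L j * (1 + (v j : ℝ) • h' x).det ∂μ := by
          refine Finset.sum_congr rfl fun j _ => ?_
          rw [integral_const_mul, hvol _ (hvK j)]
      _ = ∫ x in B, ∑ j ∈ s, L j * (1 + (v j : ℝ) • h' x).det ∂μ :=
          (integral_finsetSum _ fun j _ => (hint j).const_mul _).symm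
      _ = 0 := by simp [hpt]
  have hpos : 0 < μ.real B :=
    ENNReal.toReal_pos (Metric.measure_closedBall_pos μ 0 one_pos).ne' hB.measure_lt_top.ne
  exact hpos.ne' hfin

/-- **Brouwer's fixed point theorem** for continuously differentiable self-maps of a
Euclidean space with bounded range. -/
theorem ContDiff.exists_fixedPoint_of_bounded {E : Type*} [NormedAddCommGroup E]
    [InnerProductSpace ℝ E] [FiniteDimensional ℝ E] {F : E → E} (hF : ContDiff ℝ 1 F)
    {R : ℝ} (hR : ∀ x, ‖F x‖ ≤ R) : ∃ x, F x = x := by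
  by_contra! hne
  let ρ := max R 1
  have hρ : 0 < ρ := lt_of_lt_of_le one_pos (le_max_right _ _)
  let χ : ContDiffBump (0 : E) := ⟨ρ, 2 * ρ, hρ, by linarith⟩
  let G : E → E := fun x => (2 * ρ) • x - χ ((2 * ρ) • x) • F ((2 * ρ) • x)
  have hG : ContDiff ℝ 1 G := by
    have h1 : ContDiff ℝ 1 fun x : E => (2 * ρ) • x := contDiff_id.const_smul _
    exact h1.sub ((χ.contDiff.comp h1).smul (hF.comp h1))
  have hG0 : ∀ x, G x ≠ 0 := by
    intro x hx
    have h1 : (2 * ρ) • x = χ ((2 * ρ) • x) • F ((2 * ρ) • x) := sub_eq_zero.1 hx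
    generalize (2 * ρ) • x = y at h1
    have h2 : ‖y‖ ≤ ρ := by
      rw [h1, norm_smul, Real.norm_of_nonneg χ.nonneg]
      calc _ ≤ 1 * ρ := mul_le_mul χ.le_one ((hR y).trans (le_max_left _ _)) (norm_nonneg _)
            zero_le_one
        _ = ρ := one_mul ρ
    rw [χ.one_of_mem_closedBall (mem_closedBall_zero_iff.2 h2), one_smul] at h1
    exact hne y h1.symm
  refine not_exists_contDiff_retraction_sphere (f := fun x => ‖G x‖⁻¹ • G x)
    (((hG.norm ℝ hG0).inv fun x => norm_ne_zero_iff.2 (hG0 x)).smul hG) (fun x => ?_)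
    fun x hx => ?_
  · rw [norm_smul, norm_inv, norm_norm, inv_mul_cancel₀ (norm_ne_zero_iff.2 (hG0 x))]
  · have h1 : ‖(2 * ρ) • x‖ = 2 * ρ := by
      rw [norm_smul, hx, mul_one, Real.norm_of_nonneg (by positivity)]
    have h2 : G x = (2 * ρ) • x := by
      simp only [G]
      rw [χ.zero_of_le_dist (by rw [dist_zero_right, h1])]
      simp
    simp only [h2, h1]
    rw [smul_smul, inv_mul_cancel₀ (by positivity), one_smul]

/-- The softmax distribution of a payoff vector `u` at inverse temperature `k`. -/
noncomputable def softmax {ι : Type*} [Fintype ι] (k : ℝ) (u : ι → ℝ) (i : ι) : ℝ :=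
  Real.exp (k * u i) / ∑ j, Real.exp (k * u j)

theorem sum_exp_pos {ι : Type*} [Fintype ι] [Nonempty ι] (k : ℝ) (u : ι → ℝ) :
    0 < ∑ j, Real.exp (k * u j) :=
  Finset.sum_pos (fun _ _ => Real.exp_pos _) Finset.univ_nonempty

theorem softmax_mem_stdSimplex {ι : Type*} [Fintype ι] [Nonempty ι] (k : ℝ) (u : ι → ℝ) :
    softmax k u ∈ stdSimplex ℝ ι := by
  refine ⟨fun i => div_nonneg (Real.exp_pos _).le (sum_exp_pos k u).le, ?_⟩
  simp only [softmax]
  rw [← Finset.sum_div, div_self (sum_exp_pos k u).ne']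

/-- The softmax distribution is nearly optimal at low temperature. -/
theorem le_sum_softmax_mul_add {ι : Type*} [Fintype ι] [Nonempty ι] {k : ℝ} (hk : 0 < k)
    (u : ι → ℝ) (j : ι) : u j ≤ ∑ i, softmax k u i * u i + Fintype.card ι / k := by
  have hs := softmax_mem_stdSimplex k u
  have hterm : ∀ i, softmax k u i * (u j - u i) ≤ 1 / k := by
    intro i
    rcases le_or_gt (u j - u i) 0 with hd | hd
    · exact (mul_nonpos_of_nonneg_of_nonpos (hs.1 i) hd).trans (by positivity)
    · have h1 : softmax k u i ≤ Real.exp (k * u i) / Real.exp (k * u j) := by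
        unfold softmax
        gcongr
        exact Finset.single_le_sum (f := fun j => Real.exp (k * u j))
          (fun _ _ => (Real.exp_pos _).le) (Finset.mem_univ j)
      rw [← Real.exp_sub, show k * u i - k * u j = -(k * (u j - u i)) by ring, Real.exp_neg] at h1
      have h2 : k * (u j - u i) ≤ Real.exp (k * (u j - u i)) := by
        linarith [Real.add_one_le_exp (k * (u j - u i))]
      calc softmax k u i * (u j - u i)
          ≤ (Real.exp (k * (u j - u i)))⁻¹ * (u j - u i) := by gcongr
        _ ≤ 1 / k := by
            rw [inv_mul_eq_div, div_le_div_iff₀ (Real.exp_pos _) hk]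
            linarith
  have hsum : u j - ∑ i, softmax k u i * u i = ∑ i, softmax k u i * (u j - u i) := by
    simp only [mul_sub, Finset.sum_sub_distrib]
    rw [← Finset.sum_mul, hs.2, one_mul]
  have : ∑ i, softmax k u i * (u j - u i) ≤ ∑ _i : ι, 1 / k :=
    Finset.sum_le_sum fun i _ => hterm i
  rw [Finset.sum_const, Finset.card_univ, nsmul_eq_mul, mul_one_div] at this
  linarith

theorem ContDiff.softmax {ι E : Type*} [Fintype ι] [Nonempty ι] [NormedAddCommGroup E]
    [NormedSpace ℝ E] {k : ℝ} {u : E → ι → ℝ} (hu : ∀ i, ContDiff ℝ 1 fun x => u x i) (i : ι) :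
    ContDiff ℝ 1 fun x => softmax k (u x) i :=
  ((contDiff_const.mul (hu i)).exp).div
    (ContDiff.sum fun j _ => (contDiff_const.mul (hu j)).exp) fun x => (sum_exp_pos k (u x)).ne'

/-- Every finite bimatrix game has approximate equilibria. -/
theorem exists_approx_equilibrium_bimatrix {I J : Type*} [Fintype I] [Fintype J] [Nonempty I]
    [Nonempty J] (A B : I → J → ℝ) {k : ℝ} (hk : 0 < k) :
    ∃ x ∈ stdSimplex ℝ I, ∃ y ∈ stdSimplex ℝ J,
      (∀ i, ∑ j, y j * A i j ≤ ∑ i', x i' * ∑ j, y j * A i' j + Fintype.card I / k) ∧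
      ∀ j, ∑ i, x i * B i j ≤ ∑ j', y j' * ∑ i, x i * B i j' + Fintype.card J / k := by
  let X : EuclideanSpace ℝ J → I → ℝ := fun y => softmax k fun i => ∑ j, y j * A i j
  let Y : EuclideanSpace ℝ J → J → ℝ := fun y => softmax k fun j => ∑ i, X y i * B i j
  have hX : ∀ i, ContDiff ℝ 1 fun y => X y i := ContDiff.softmax fun i => by fun_prop
  have hY : ∀ j, ContDiff ℝ 1 fun y => Y y j := ContDiff.softmax fun j =>
    ContDiff.sum fun i _ => (hX i).mul contDiff_const
  have hYmem : ∀ y, Y y ∈ stdSimplex ℝ J := fun y => softmax_mem_stdSimplex _ _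
  have hF : ContDiff ℝ 1 fun y => WithLp.toLp 2 (Y y) := contDiff_euclidean.2 hY
  have hbound : ∀ y, ‖WithLp.toLp 2 (Y y)‖ ≤ √(Fintype.card J) := by
    intro y
    rw [EuclideanSpace.norm_eq]
    refine Real.sqrt_le_sqrt ?_
    calc _ ≤ ∑ _j : J, (1 : ℝ) := Finset.sum_le_sum fun j _ => by
          have h0 := (hYmem y).1 j
          have h1 := (mem_Icc_of_mem_stdSimplex (hYmem y) j).2
          simp only [Real.norm_eq_abs, sq_abs]
          exact pow_le_one₀ h0 h1
      _ = _ := by simp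
  obtain ⟨y, hy⟩ := hF.exists_fixedPoint_of_bounded hbound
  have hy' : ∀ j, y j = Y y j := fun j => by
    conv_lhs => rw [← hy]
  refine ⟨X y, softmax_mem_stdSimplex _ _, Y y, hYmem y, fun i => ?_, fun j => ?_⟩
  · have hXy : X y = softmax k fun i => ∑ j, Y y j * A i j := by simp only [X, hy']
    rw [hXy]
    exact le_sum_softmax_mul_add hk (fun i => ∑ j, Y y j * A i j) i
  · exact le_sum_softmax_mul_add hk (fun j => ∑ i, X y i * B i j) j

/-- **Nash's theorem** for finite bimatrix games. -/
theorem exists_equilibrium_bimatrix {I J : Type*} [Fintype I] [Fintype J] [Nonempty I]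
    [Nonempty J] (A B : I → J → ℝ) :
    ∃ x ∈ stdSimplex ℝ I, ∃ y ∈ stdSimplex ℝ J,
      (∀ i, ∑ j, y j * A i j ≤ ∑ i', x i' * ∑ j, y j * A i' j) ∧
      ∀ j, ∑ i, x i * B i j ≤ ∑ j', y j' * ∑ i, x i * B i j' := by
  let T : ℕ → Set ((I → ℝ) × (J → ℝ)) := fun n =>
    (stdSimplex ℝ I ×ˢ stdSimplex ℝ J) ∩
      {p | (∀ i, ∑ j, p.2 j * A i j ≤
          ∑ i', p.1 i' * ∑ j, p.2 j * A i' j + Fintype.card I / ((n : ℝ) + 1)) ∧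
        ∀ j, ∑ i, p.1 i * B i j ≤
          ∑ j', p.2 j' * ∑ i, p.1 i * B i j' + Fintype.card J / ((n : ℝ) + 1)}
  have hclosed : ∀ n, IsClosed {p : (I → ℝ) × (J → ℝ) | (∀ i, ∑ j, p.2 j * A i j ≤
          ∑ i', p.1 i' * ∑ j, p.2 j * A i' j + Fintype.card I / ((n : ℝ) + 1)) ∧
        ∀ j, ∑ i, p.1 i * B i j ≤
          ∑ j', p.2 j' * ∑ i, p.1 i * B i j' + Fintype.card J / ((n : ℝ) + 1)} := by
    intro n
    simp only [Set.ofPred_and, Set.ofPred_forall]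
    exact (isClosed_iInter fun i => isClosed_le (by fun_prop) (by fun_prop)).inter
      (isClosed_iInter fun j => isClosed_le (by fun_prop) (by fun_prop))
  have hcompact : IsCompact (stdSimplex ℝ I ×ˢ stdSimplex ℝ J) :=
    (isCompact_stdSimplex ℝ I).prod (isCompact_stdSimplex ℝ J)
  obtain ⟨p, hp⟩ := IsCompact.nonempty_iInter_of_sequence_nonempty_isCompact_isClosed T
    (fun n p hp => by
      refine ⟨hp.1, fun i => (hp.2.1 i).trans ?_, fun j => (hp.2.2 j).trans ?_⟩ <;>
      · gcongr
        simp)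
    (fun n => by
      obtain ⟨x, hx, y, hy, h1, h2⟩ :=
        exists_approx_equilibrium_bimatrix A B (k := (n : ℝ) + 1) (by positivity)
      exact ⟨(x, y), ⟨hx, hy⟩, h1, h2⟩)
    (hcompact.inter_right (by exact_mod_cast hclosed 0)) fun n => hcompact.isClosed.inter (hclosed n)
  rw [Set.mem_iInter] at hp
  have hlim : ∀ a c : ℝ, Filter.Tendsto (fun n : ℕ => a + c / ((n : ℝ) + 1)) Filter.atTop
      (nhds a) := fun a c => by
    simpa [div_eq_mul_inv] using
      ((tendsto_one_div_add_atTop_nhds_zero_nat (𝕜 := ℝ)).const_mul c).const_add a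
  exact ⟨p.1, (hp 0).1.1, p.2, (hp 0).1.2,
    fun i => ge_of_tendsto' (hlim _ _) fun n => (hp n).2.1 i,
    fun j => ge_of_tendsto' (hlim _ _) fun n => (hp n).2.2 j⟩

/-- **Carathéodory's theorem** for a weighted average of a finite family of vectors in `ℝᵐ`: it is
an average of `m + 1` vectors of the family with nonzero weights. -/
theorem exists_fin_average_eq {I : Type*} [Fintype I] {m : ℕ} {x : I → ℝ}
    (hx : x ∈ stdSimplex ℝ I) (v : I → Fin m → ℝ) :
    ∃ (p : Fin (m + 1) → I) (w : Fin (m + 1) → ℝ), w ∈ stdSimplex ℝ (Fin (m + 1)) ∧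
      (∀ j, x (p j) ≠ 0) ∧ ∑ j, w j • v (p j) = ∑ i, x i • v i := by
  obtain ⟨i₀, hi₀⟩ : ∃ i, x i ≠ 0 := by
    by_contra! h
    simpa [h] using hx.2
  have hmem : ∑ i, x i • v i ∈ convexHull ℝ (v '' {i | x i ≠ 0}) := by
    classical
    rw [← Finset.sum_filter_of_ne (p := fun i => x i ≠ 0) fun i _ h h0 => h (by simp [h0])]
    refine (convex_convexHull ℝ _).sum_mem (fun i _ => hx.1 i) ?_ fun i hi => ?_
    · rw [Finset.sum_filter_ne_zero]; exact hx.2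
    · exact subset_convexHull ℝ _ ⟨i, (Finset.mem_filter.1 hi).2, rfl⟩
  obtain ⟨κ, _, z, w, hz, hind, hw, hw1, hsum⟩ := eq_pos_convex_span_of_mem_convexHull hmem
  have hcard : Fintype.card κ ≤ m + 1 := by
    refine hind.card_le_finrank_succ.trans ?_
    have := Submodule.finrank_le (vectorSpan ℝ (Set.range z))
    rw [Module.finrank_fin_fun] at this
    lia
  choose q hq hqz using fun k => hz (Set.mem_range_self k)
  obtain ⟨e⟩ : Nonempty (κ ↪ Fin (m + 1)) :=
    Function.Embedding.nonempty_of_card_le (by simpa using hcard)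
  refine ⟨Function.extend e q fun _ => i₀, Function.extend e w 0, ⟨fun j => ?_, ?_⟩, fun j => ?_, ?_⟩
  · by_cases hj : ∃ k, e k = j
    · obtain ⟨k, rfl⟩ := hj
      rw [e.injective.extend_apply]
      exact (hw k).le
    · rw [Function.extend_apply' _ _ _ hj]; rfl
  · rw [← hw1]
    refine (Fintype.sum_of_injective e e.injective _ _ (fun j hj => ?_) fun k => ?_).symm
    · rw [Function.extend_apply' _ _ _ hj]; rfl
    · rw [e.injective.extend_apply]
  · by_cases hj : ∃ k, e k = j
    · obtain ⟨k, rfl⟩ := hj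
      rw [e.injective.extend_apply]
      exact hq k
    · rwa [Function.extend_apply' _ _ _ hj]
  · rw [← hsum]
    refine (Fintype.sum_of_injective e e.injective _ _ (fun j hj => ?_) fun k => ?_).symm
    · rw [Function.extend_apply' w _ _ hj]; simp
    · rw [e.injective.extend_apply, e.injective.extend_apply, hqz]

/-- If an average dominates all terms then every term with nonzero weight equals the average. -/
theorem eq_of_forall_le_average {I : Type*} [Fintype I] {x : I → ℝ} (hx : x ∈ stdSimplex ℝ I)
    {u : I → ℝ} (hu : ∀ i, u i ≤ ∑ i', x i' * u i') {i : I} (hi : x i ≠ 0) :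
    u i = ∑ i', x i' * u i' := by
  set a := ∑ i', x i' * u i' with ha
  have h0 : ∑ i', x i' * (a - u i') = 0 := by
    simp only [mul_sub, Finset.sum_sub_distrib]
    rw [← Finset.sum_mul, hx.2, ← ha]; ring
  have h1 := (Finset.sum_eq_zero_iff_of_nonneg fun i' _ =>
    mul_nonneg (hx.1 i') (sub_nonneg.2 (hu i'))).1 h0 i (Finset.mem_univ i)
  exact (sub_eq_zero.1 ((mul_eq_zero.1 h1).resolve_left hi)).symm

/-- A finite bimatrix game in which the second player's payoff is `l ↦ ∑ i, l i.succ * v θ i` has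
an equilibrium in which the first player mixes at most `m + 1` strategies. -/
theorem exists_sparse_equilibrium_of_finite {I : Type*} [Fintype I] [Nonempty I] {m : ℕ}
    (c : I → Fin (m + 1) → ℝ) (v : I → Fin m → ℝ) :
    ∃ (p : Fin (m + 1) → I), ∃ w ∈ stdSimplex ℝ (Fin (m + 1)),
      ∃ l ∈ stdSimplex ℝ (Fin (m + 1)),
      (∀ i, ∑ j, w j * ∑ s, l s * c (p j) s ≤ ∑ s, l s * c i s) ∧
      ∀ l' ∈ stdSimplex ℝ (Fin (m + 1)), ∑ j, w j * ∑ i, l' i.succ * v (p j) i ≤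
        ∑ j, w j * ∑ i, l i.succ * v (p j) i := by
  obtain ⟨x, hx, l, hl, h1, h2⟩ := exists_equilibrium_bimatrix
    (fun i s => -c i s) fun i => (Fin.cons 0 (v i) : Fin (m + 1) → ℝ)
  obtain ⟨p, w, hw, hp, hwv⟩ := exists_fin_average_eq hx v
  refine ⟨p, w, hw, l, hl, fun i => ?_, fun l' hl' => ?_⟩
  · have h3 := fun j => eq_of_forall_le_average hx h1 (hp j)
    have h4 := h1 i
    simp only [mul_neg, Finset.sum_neg_distrib, neg_le_neg_iff, neg_inj] at h3 h4
    simp only [h3]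
    rwa [← Finset.sum_mul, hw.2, one_mul]
  · have hswap : ∀ l : Fin (m + 1) → ℝ, ∑ j, w j * ∑ i, l i.succ * v (p j) i =
        ∑ s, l s * ∑ i, x i * (Fin.cons 0 (v i) : Fin (m + 1) → ℝ) s := by
      intro l
      have hcomp : ∀ i, ∑ j, w j * v (p j) i = ∑ k, x k * v k i := fun i => by
        simpa using congrFun hwv i
      rw [Fin.sum_univ_succ (n := m) fun s => l s * _]
      simp only [Fin.cons_zero, Fin.cons_succ, mul_zero, Finset.sum_const_zero, zero_add,
        ← hcomp, Finset.mul_sum]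
      rw [Finset.sum_comm]
      exact Finset.sum_congr rfl fun i _ => Finset.sum_congr rfl fun j _ => by ring
    rw [hswap, hswap]
    calc _ ≤ ∑ s, l' s * ∑ s', l s' * ∑ i, x i * (Fin.cons 0 (v i) : Fin (m + 1) → ℝ) s' :=
          Finset.sum_le_sum fun s _ => mul_le_mul_of_nonneg_left (h2 s) (hl'.1 s)
      _ = _ := by rw [← Finset.sum_mul, hl'.2, one_mul]

/-- The compact version of `exists_sparse_equilibrium_of_finite`. -/
theorem exists_sparse_equilibrium_of_compact {Θ : Type*} [TopologicalSpace Θ] [CompactSpace Θ]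
    [Nonempty Θ] {m : ℕ} {c : Θ → Fin (m + 1) → ℝ} {v : Θ → Fin m → ℝ}
    (hc : Continuous c) (hv : Continuous v) :
    ∃ (p : Fin (m + 1) → Θ), ∃ w ∈ stdSimplex ℝ (Fin (m + 1)),
      ∃ l ∈ stdSimplex ℝ (Fin (m + 1)),
      (∀ θ, ∑ j, w j * ∑ s, l s * c (p j) s ≤ ∑ s, l s * c θ s) ∧
      ∀ l' ∈ stdSimplex ℝ (Fin (m + 1)), ∑ j, w j * ∑ i, l' i.succ * v (p j) i ≤
        ∑ j, w j * ∑ i, l i.succ * v (p j) i := by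
  have hc' : ∀ s, Continuous fun θ => c θ s := fun s => (continuous_apply s).comp hc
  have hv' : ∀ i, Continuous fun θ => v θ i := fun i => (continuous_apply i).comp hv
  let Δ := stdSimplex ℝ (Fin (m + 1))
  let t : Θ → Set ((Fin (m + 1) → Θ) × (Fin (m + 1) → ℝ) × (Fin (m + 1) → ℝ)) := fun θ =>
    {q | (∑ j, q.2.1 j * ∑ s, q.2.2 s * c (q.1 j) s ≤ ∑ s, q.2.2 s * c θ s) ∧
      ∀ l' ∈ Δ, ∑ j, q.2.1 j * ∑ i, l' i.succ * v (q.1 j) i ≤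
        ∑ j, q.2.1 j * ∑ i, q.2.2 i.succ * v (q.1 j) i}
  obtain ⟨q, ⟨-, hw, hl⟩, hq⟩ := IsCompact.inter_iInter_nonempty
    (s := Set.univ ×ˢ Δ ×ˢ Δ)
    (isCompact_univ.prod ((isCompact_stdSimplex ℝ _).prod (isCompact_stdSimplex ℝ _))) t
    (fun θ => by
      simp only [t, Set.ofPred_and, Set.ofPred_forall]
      exact (isClosed_le (by fun_prop) (by fun_prop)).inter
        (isClosed_iInter fun l' => isClosed_iInter fun _ =>
          isClosed_le (by fun_prop) (by fun_prop)))
    (fun u => by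
      classical
      let u' := insert (Classical.arbitrary Θ) u
      have : Nonempty u' := ⟨⟨_, Finset.mem_insert_self _ _⟩⟩
      obtain ⟨p, w, hw, l, hl, h1, h2⟩ := exists_sparse_equilibrium_of_finite
        (fun θ : u' => c θ) fun θ : u' => v θ
      refine ⟨(fun j => p j, w, l), ⟨trivial, hw, hl⟩, ?_⟩
      simp only [Set.mem_iInter]
      exact fun θ hθ => ⟨h1 ⟨θ, Finset.mem_insert_of_mem hθ⟩, h2⟩)
  rw [Set.mem_iInter] at hq
  exact ⟨q.1, q.2.1, hw, q.2.2, hl, fun θ => (hq θ).1, (hq (Classical.arbitrary Θ)).2⟩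

/-- The probability measure with mass `w j` at the point `p j`. -/
noncomputable def weightedDirac {Θ ι : Type*} [MeasurableSpace Θ] [Fintype ι] (p : ι → Θ)
    (w : ι → ℝ) : Measure Θ :=
  ∑ j, ENNReal.ofReal (w j) • Measure.dirac (p j)

theorem integral_weightedDirac {Θ ι : Type*} [MeasurableSpace Θ] [MeasurableSingletonClass Θ]
    [Fintype ι] (p : ι → Θ) {w : ι → ℝ} (hw : ∀ j, 0 ≤ w j) (f : Θ → ℝ) :
    ∫ θ, f θ ∂weightedDirac p w = ∑ j, w j * f (p j) := by
  rw [weightedDirac, integral_finsetSum_measure fun j _ =>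
    (integrable_dirac (by simp)).smul_measure ENNReal.ofReal_ne_top]
  exact Finset.sum_congr rfl fun j _ => by
    rw [integral_smul_measure, integral_dirac, ENNReal.toReal_ofReal (hw j), smul_eq_mul]

theorem isProbabilityMeasure_weightedDirac {Θ ι : Type*} [MeasurableSpace Θ] [Fintype ι]
    (p : ι → Θ) {w : ι → ℝ} (hw : w ∈ stdSimplex ℝ ι) :
    IsProbabilityMeasure (weightedDirac p w) := by
  constructor
  simp [weightedDirac, ← ENNReal.ofReal_sum_of_nonneg fun j _ => hw.1 j, hw.2]

/-- **Existence of a sparse equilibrium for the proxy-Lagrangian game**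
(Lemma 2).  If `Θ` is a compact Hausdorff space and the objective, constraint
and proxy-constraint functions are continuous, then the proxy-Lagrangian game
(the `θ`-player minimizes `ℒ_θ` and the `λ`-player maximizes `ℒ_λ` over the
`(m+1)`-dimensional simplex) has a mixed Nash equilibrium `(μ, λ)` in which `μ`
is supported on at most `m + 1` elements of `Θ` and `λ ∈ Δ^{m+1}` is
non-random. -/
theorem sparse_proxy_lagrangian_equilibrium
    {Θ : Type*} [TopologicalSpace Θ] [CompactSpace Θ] [T2Space Θ]
    [MeasurableSpace Θ] [BorelSpace Θ] [Nonempty Θ]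
    {m : ℕ}
    (g0 : Θ → ℝ) (g gt : Fin m → Θ → ℝ)
    (hg0 : Continuous g0) (hg : ∀ i, Continuous (g i)) (hgt : ∀ i, Continuous (gt i))
    (Lθ Llam : Θ → (Fin (m + 1) → ℝ) → ℝ)
    (hLθ : ∀ θ l, Lθ θ l = l 0 * g0 θ + ∑ i : Fin m, l i.succ * gt i θ)
    (hLlam : ∀ θ l, Llam θ l = ∑ i : Fin m, l i.succ * g i θ) :
    ∃ (μ : Measure Θ) (_ : IsProbabilityMeasure μ) (S : Finset Θ) (l : Fin (m + 1) → ℝ),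
      S.card ≤ m + 1 ∧ μ ((↑S : Set Θ)ᶜ) = 0 ∧ l ∈ stdSimplex ℝ (Fin (m + 1)) ∧
      (∫ θ, Lθ θ l ∂μ) = sInf (Set.range fun θ' => Lθ θ' l) ∧
      (∫ θ, Llam θ l ∂μ)
        = sSup ((fun l' => ∫ θ, Llam θ l' ∂μ) '' stdSimplex ℝ (Fin (m + 1))) := by
  classical
  obtain ⟨p, w, hw, l, hl, h1, h2⟩ := exists_sparse_equilibrium_of_compact
    (c := fun θ => (Fin.cons (g0 θ) fun i => gt i θ : Fin (m + 1) → ℝ)) (v := fun θ i => g i θ)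
    (continuous_pi fun s => by
      refine Fin.cases ?_ (fun i => ?_) s
      · simpa using hg0
      · simpa using hgt i)
    (continuous_pi hg)
  have hL : ∀ θ, ∑ s, l s * (Fin.cons (g0 θ) fun i => gt i θ : Fin (m + 1) → ℝ) s = Lθ θ l := by
    intro θ
    rw [hLθ, Fin.sum_univ_succ]
    simp
  simp only [hL] at h1
  simp only [← hLlam] at h2
  refine ⟨weightedDirac p w, isProbabilityMeasure_weightedDirac p hw, Finset.univ.image p, l,
    ?_, ?_, hl, ?_, ?_⟩
  · simpa using Finset.card_image_le (s := Finset.univ) (f := p)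
  · simp [weightedDirac]
  · rw [integral_weightedDirac p hw.1]
    refine le_antisymm (le_csInf (Set.range_nonempty _) (Set.forall_mem_range.2 h1)) ?_
    have hbdd : BddBelow (Set.range fun θ' => Lθ θ' l) := ⟨_, Set.forall_mem_range.2 h1⟩
    calc sInf (Set.range fun θ' => Lθ θ' l)
        = ∑ j, w j * sInf (Set.range fun θ' => Lθ θ' l) := by
          rw [← Finset.sum_mul, hw.2, one_mul]
      _ ≤ ∑ j, w j * Lθ (p j) l := Finset.sum_le_sum fun j _ =>
          mul_le_mul_of_nonneg_left (csInf_le hbdd ⟨p j, rfl⟩) (hw.1 j)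
  · simp only [integral_weightedDirac p hw.1]
    symm
    refine IsGreatest.csSup_eq ⟨⟨l, hl, rfl⟩, ?_⟩
    rintro _ ⟨l', hl', rfl⟩
    exact h2 l' hl'
end

section
/- Suppose Θ ⊆ ℝ^n is a compact convex set containing 0, Λ := {λ ∈ ℝ₊^m : ‖λ‖₁ ≤ R}, and g₀,g₁,…,g_m : Θ → ℝ are convex. Let B_Θ ≥ max_{θ∈Θ} ‖θ‖₂, and run T iterations of simultaneous projected stochastic gradient updates starting from θ^(1) = 0, λ^(1) = 0: θ^(t+1) = Π_Θ(θ^(t) − η_θ ǧ^(t)) and λ^(t+1) = Π_Λ(λ^(t) + η_λ Δ^(t)), where ǧ^(t) is a stochastic subgradient of ℒ(·,λ^(t)) at θ^(t) (its conditional expectation given the past lies in ∂_θ ℒ(θ^(t),λ^(t))), Δ^(t) is a stochastic gradient of ℒ(θ^(t),·) at λ^(t), ‖ǧ^(t)‖₂ ≤ B_ǧ and ‖Δ^(t)‖₂ ≤ B_Δ almost surely, η_θ := B_Θ/(B_ǧ√(2T)) and η_λ := R/(B_Δ√(2T)). Then with probability at least 1−δ over the draws of the stochastic (sub)gradients, max_{λ*∈Λ}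 (1/T) Σ_{t=1}^T ℒ(θ^(t),λ*) − inf_{θ*∈Θ} (1/T) Σ_{t=1}^T ℒ(θ*,λ^(t)) ≤ 2(B_Θ B_ǧ + R B_Δ) √((1 + 16 ln(2/δ))/T). -/
open MeasureTheory

/-- The Euclidean norm of a vector in `Fin k → ℝ`. -/
noncomputable def euclNorm {k : ℕ} (x : Fin k → ℝ) : ℝ := Real.sqrt (∑ i, x i ^ 2)

theorem norm_sub_le_of_isNearest {E : Type*} [NormedAddCommGroup E] [InnerProductSpace ℝ E]
    {K : Set E} (hK : Convex ℝ K) {p w : E} (hp : p ∈ K)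
    (hmin : ∀ y ∈ K, ‖p - w‖ ≤ ‖y - w‖) {y : E} (hy : y ∈ K) :
    ‖p - y‖ ≤ ‖w - y‖ := by
  have : Nonempty K := ⟨⟨p, hp⟩⟩
  have hinf : ‖w - p‖ = ⨅ z : K, ‖w - z‖ := by
    apply le_antisymm
    · refine le_ciInf fun z => ?_
      rw [norm_sub_rev w p, norm_sub_rev w z]
      exact hmin z z.2
    · exact ciInf_le (f := fun z : K => ‖w - z‖) ⟨0, by rintro _ ⟨z, rfl⟩; positivity⟩ ⟨p, hp⟩
  have hin := (norm_eq_iInf_iff_real_inner_le_zero hK hp).1 hinf y hy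
  have hexp : ‖w - y‖ ^ 2 = ‖w - p‖ ^ 2 - 2 * inner ℝ (w - p) (y - p) + ‖p - y‖ ^ 2 := by
    rw [norm_sub_rev p y, ← norm_sub_sq_real]
    congr 2
    abel
  refine abs_le_of_sq_le_sq' ?_ (norm_nonneg _) |>.2
  nlinarith [sq_nonneg ‖w - p‖]

/-- Regret bound for deterministic projected subgradient descent. -/
theorem sum_inner_le_of_projected_descent {E : Type*} [NormedAddCommGroup E]
    [InnerProductSpace ℝ E] {K : Set E} (hK : Convex ℝ K) {B G η : ℝ}
    (hB : ∀ y ∈ K, ‖y‖ ≤ B) (hG : 0 ≤ G) {T : ℕ} (hT : 0 < T)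
    (hη : η = B / (G * Real.sqrt (2 * T))) {x g : ℕ → E} (hx0 : x 0 = 0) (h0 : (0 : E) ∈ K)
    (hg : ∀ t < T, ‖g t‖ ≤ G)
    (hx : ∀ t < T, x (t + 1) ∈ K ∧
      ∀ y ∈ K, ‖x (t + 1) - (x t - η • g t)‖ ≤ ‖y - (x t - η • g t)‖)
    {y : E} (hy : y ∈ K) :
    ∑ t ∈ Finset.range T, inner ℝ (g t) (x t - y) ≤ 3 / 2 * (B * G) * Real.sqrt T := by
  have hB0 : 0 ≤ B := (norm_nonneg _).trans (hB 0 h0)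
  have hrhs : 0 ≤ 3 / 2 * (B * G) * Real.sqrt T := by positivity
  have hTr : (0 : ℝ) < T := by exact_mod_cast hT
  rcases hG.eq_or_lt with hG0 | hGpos
  · refine le_trans (le_of_eq (Finset.sum_eq_zero fun t ht => ?_)) hrhs
    have : g t = 0 := norm_le_zero_iff.1 (by simpa [← hG0] using hg t (Finset.mem_range.1 ht))
    simp [this]
  rcases hB0.eq_or_lt with hB1 | hBpos
  · refine le_trans (le_of_eq (Finset.sum_eq_zero fun t ht => ?_)) hrhs
    have hz : ∀ z ∈ K, z = 0 := fun z hz => norm_le_zero_iff.1 (by simpa [← hB1] using hB z hz)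
    have hxt : x t = 0 := by
      cases t with
      | zero => exact hx0
      | succ s => exact hz _ (hx s (by have := Finset.mem_range.1 ht; omega)).1
    simp [hxt, hz y hy]
  have key : ∀ k ≤ T, 2 * η * ∑ t ∈ Finset.range k, inner ℝ (g t) (x t - y)
      ≤ ‖x 0 - y‖ ^ 2 - ‖x k - y‖ ^ 2 + η ^ 2 * (k * G ^ 2) := by
    intro k
    induction k with
    | zero => simp
    | succ k ih =>
      intro hk
      have h1 := norm_sub_le_of_isNearest hK (hx k hk).1 (hx k hk).2 hy
      have h2 : ‖x k - η • g k - y‖ ^ 2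
          = ‖x k - y‖ ^ 2 - 2 * η * inner ℝ (g k) (x k - y) + η ^ 2 * ‖g k‖ ^ 2 := by
        rw [sub_right_comm, norm_sub_sq_real, inner_smul_right, norm_smul, mul_pow,
          real_inner_comm, Real.norm_eq_abs, sq_abs]
        ring
      have h3 : ‖x (k + 1) - y‖ ^ 2 ≤ ‖x k - η • g k - y‖ ^ 2 := by gcongr
      have h4 : η ^ 2 * ‖g k‖ ^ 2 ≤ η ^ 2 * G ^ 2 := by gcongr; exact hg k hk
      have h5 := ih (by omega)
      rw [Finset.sum_range_succ]
      push_cast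
      linarith
  have hfin := key T le_rfl
  have hy2 : ‖x 0 - y‖ ^ 2 ≤ B ^ 2 := by
    rw [hx0, zero_sub, norm_neg]
    gcongr
    exact hB y hy
  set S := ∑ t ∈ Finset.range T, inner ℝ (g t) (x t - y)
  have hr : Real.sqrt (2 * T) = Real.sqrt 2 * Real.sqrt T := Real.sqrt_mul (by norm_num) _
  have hs : 0 < Real.sqrt T := Real.sqrt_pos.2 hTr
  have hs2 : Real.sqrt T ^ 2 = T := Real.sq_sqrt hTr.le
  have h2 : 0 < Real.sqrt 2 := by positivity
  have h22 : Real.sqrt 2 ^ 2 = 2 := Real.sq_sqrt (by norm_num)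
  have hηpos : 0 < η := by rw [hη]; positivity
  have hηG : η * G * (Real.sqrt 2 * Real.sqrt T) = B := by
    rw [hη, hr]; field_simp
  have hprod : 2 * (η * G) ^ 2 * T = B ^ 2 := by
    rw [← hηG, mul_pow _ (_ * _), mul_pow (Real.sqrt 2), h22, hs2]; ring
  have hle : 2 * η * S ≤ 3 / 2 * B ^ 2 := by nlinarith [sq_nonneg ‖x T - y‖]
  have h2le : Real.sqrt 2 ≤ 2 := by nlinarith
  have hBe : B ^ 2 ≤ 2 * η * (B * G * Real.sqrt T) := by
    calc B ^ 2 = B * (η * G * (Real.sqrt 2 * Real.sqrt T)) := by rw [hηG]; ring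
      _ ≤ B * (η * G * (2 * Real.sqrt T)) := by gcongr
      _ = _ := by ring
  have : 2 * η * S ≤ 2 * η * (3 / 2 * (B * G) * Real.sqrt T) := by linarith
  exact le_of_mul_le_mul_left this (by positivity)

/-- The smoothed unit vector `S / √(‖S‖² + a²)`. -/
noncomputable def smoothedDirection {E : Type*} [NormedAddCommGroup E] [InnerProductSpace ℝ E]
    (a : ℝ) (S : E) : E := (Real.sqrt (‖S‖ ^ 2 + a ^ 2))⁻¹ • S

theorem norm_smoothedDirection_le {E : Type*} [NormedAddCommGroup E] [InnerProductSpace ℝ E]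
    (a : ℝ) (S : E) : ‖smoothedDirection a S‖ ≤ 1 := by
  rw [smoothedDirection, norm_smul, norm_inv, Real.norm_eq_abs, abs_of_nonneg (Real.sqrt_nonneg _)]
  refine inv_mul_le_one_of_le₀ (Real.le_sqrt_of_sq_le ?_) (Real.sqrt_nonneg _)
  nlinarith [sq_nonneg a]

theorem norm_sum_le_sum_inner_smoothedDirection {E : Type*} [NormedAddCommGroup E]
    [InnerProductSpace ℝ E] {G : ℝ} (hG : 0 ≤ G) {T : ℕ} (hT : 0 < T) {ξ : ℕ → E}
    (hξ : ∀ t < T, ‖ξ t‖ ≤ 2 * G) :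
    ‖∑ t ∈ Finset.range T, ξ t‖ ≤ 3 * G * Real.sqrt T + ∑ t ∈ Finset.range T,
      inner ℝ (ξ t) (smoothedDirection (2 * G * Real.sqrt T) (∑ j ∈ Finset.range t, ξ j)) := by
  rcases hG.eq_or_lt with hG0 | hGpos
  · have h0 : ∀ t < T, ξ t = 0 := fun t ht => norm_le_zero_iff.1 (by simpa [← hG0] using hξ t ht)
    rw [Finset.sum_eq_zero fun t ht => h0 t (Finset.mem_range.1 ht),
      Finset.sum_eq_zero fun t ht => by rw [h0 t (Finset.mem_range.1 ht), inner_zero_left]]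
    simp [← hG0]
  have hTr : (0 : ℝ) < T := by exact_mod_cast hT
  set a := 2 * G * Real.sqrt T with ha
  have hapos : 0 < a := by positivity
  set N : ℕ → ℝ := fun k => Real.sqrt (‖∑ j ∈ Finset.range k, ξ j‖ ^ 2 + a ^ 2) with hN
  have hNsq : ∀ k, N k ^ 2 = ‖∑ j ∈ Finset.range k, ξ j‖ ^ 2 + a ^ 2 := fun k =>
    Real.sq_sqrt (by positivity)
  have hNa : ∀ k, a ≤ N k := fun k => Real.le_sqrt_of_sq_le
    (by nlinarith [sq_nonneg ‖∑ j ∈ Finset.range k, ξ j‖])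
  have key : ∀ k ≤ T, N k ≤ a + k * ((2 * G) ^ 2 / (2 * a)) + ∑ t ∈ Finset.range k,
      inner ℝ (ξ t) (smoothedDirection a (∑ j ∈ Finset.range t, ξ j)) := by
    intro k
    induction k with
    | zero => simp [hN, Real.sqrt_sq hapos.le]
    | succ k ih =>
      intro hk
      have hNk : 0 < N k := hapos.trans_le (hNa k)
      have hstep : N (k + 1) ^ 2
          = N k ^ 2 + 2 * inner ℝ (ξ k) (∑ j ∈ Finset.range k, ξ j) + ‖ξ k‖ ^ 2 := by
        rw [hNsq, hNsq, Finset.sum_range_succ, norm_add_sq_real, real_inner_comm]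
        ring
      have hin : inner ℝ (ξ k) (smoothedDirection a (∑ j ∈ Finset.range k, ξ j))
          = (N k)⁻¹ * inner ℝ (ξ k) (∑ j ∈ Finset.range k, ξ j) := by
        rw [smoothedDirection, inner_smul_right]
      have h1 : N (k + 1) ≤ (N k ^ 2 + N (k + 1) ^ 2) / (2 * N k) := by
        rw [le_div_iff₀ (by positivity)]
        nlinarith [sq_nonneg (N k - N (k + 1))]
      have h2 : (N k ^ 2 + N (k + 1) ^ 2) / (2 * N k)
          = N k + (N k)⁻¹ * inner ℝ (ξ k) (∑ j ∈ Finset.range k, ξ j)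
            + ‖ξ k‖ ^ 2 / (2 * N k) := by
        rw [hstep]; field_simp; ring
      have h3 : ‖ξ k‖ ^ 2 / (2 * N k) ≤ (2 * G) ^ 2 / (2 * a) := by
        gcongr
        · exact hξ k hk
        · exact hNa k
      have h4 := ih (by omega)
      rw [Finset.sum_range_succ, hin]
      push_cast
      linarith
  have hfin := key T le_rfl
  have hnorm : ‖∑ t ∈ Finset.range T, ξ t‖ ≤ N T :=
    Real.le_sqrt_of_sq_le (by nlinarith [sq_nonneg a])
  have hconst : a + T * ((2 * G) ^ 2 / (2 * a)) = 3 * G * Real.sqrt T := by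
    have hs : 0 < Real.sqrt T := Real.sqrt_pos.2 hTr
    have hs2 : (T : ℝ) = Real.sqrt T ^ 2 := (Real.sq_sqrt hTr.le).symm
    have : T * ((2 * G) ^ 2 / (2 * a)) = G * Real.sqrt T := by
      rw [ha]
      field_simp
      linarith
    rw [this, ha]; ring
  linarith

/-- **Azuma–Hoeffding**: the moment generating function of a martingale with bounded increments. -/
theorem integral_exp_mul_sum_le_cosh_pow {Ω : Type*} {m0 : MeasurableSpace Ω} {P : Measure Ω}
    [IsProbabilityMeasure P] {ℱ : Filtration ℕ m0} {T : ℕ} {D : ℕ → Ω → ℝ} {c : ℝ} (hc : 0 < c)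
    (hD : ∀ t < T, StronglyMeasurable[ℱ (t + 1)] (D t))
    (hbd : ∀ t < T, ∀ᵐ ω ∂P, |D t ω| ≤ c) (hmean : ∀ t < T, P[D t | ℱ t] =ᵐ[P] 0) (s : ℝ) :
    ∀ k ≤ T, Integrable (fun ω => Real.exp (s * ∑ t ∈ Finset.range k, D t ω)) P ∧
      ∫ ω, Real.exp (s * ∑ t ∈ Finset.range k, D t ω) ∂P ≤ Real.cosh (s * c) ^ k := by
  have hmeas : ∀ k ≤ T, StronglyMeasurable[ℱ k]
      (fun ω => Real.exp (s * ∑ t ∈ Finset.range k, D t ω)) := by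
    intro k hk
    refine Real.continuous_exp.comp_stronglyMeasurable (StronglyMeasurable.const_mul ?_ s)
    refine Finset.stronglyMeasurable_fun_sum _ fun t ht => ?_
    have := Finset.mem_range.1 ht
    exact (hD t (by omega)).mono (ℱ.mono (by omega))
  have hexpbd : ∀ k ≤ T, ∀ᵐ ω ∂P,
      ‖Real.exp (s * ∑ t ∈ Finset.range k, D t ω)‖ ≤ Real.exp (|s| * (k * c)) := by
    intro k hk
    have : ∀ᵐ ω ∂P, ∀ t < T, |D t ω| ≤ c := by
      rw [ae_all_iff]; intro t; rw [Filter.eventually_imp_distrib_left]; exact hbd t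
    filter_upwards [this] with ω hω
    rw [Real.norm_eq_abs, Real.abs_exp]
    refine Real.exp_le_exp.2 ((le_abs_self _).trans ?_)
    rw [abs_mul]
    gcongr
    refine (Finset.abs_sum_le_sum_abs _ _).trans ?_
    refine (Finset.sum_le_card_nsmul _ _ c fun t ht => hω t ?_).trans (by simp)
    have := Finset.mem_range.1 ht
    omega
  have hint : ∀ k ≤ T, Integrable (fun ω => Real.exp (s * ∑ t ∈ Finset.range k, D t ω)) P :=
    fun k hk => Integrable.of_bound ((hmeas k hk).mono (ℱ.le k)).aestronglyMeasurable _
      (hexpbd k hk)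
  intro k hk
  refine ⟨hint k hk, ?_⟩
  induction k with
  | zero => simp
  | succ k ih =>
    set W : Ω → ℝ := fun ω => Real.exp (s * ∑ t ∈ Finset.range k, D t ω) with hW
    have hkT : k < T := hk
    have hDint : Integrable (D k) P := Integrable.of_bound
      ((hD k hkT).mono (ℱ.le _)).aestronglyMeasurable c (hbd k hkT)
    have hWD : Integrable (W * D k) P :=
      hDint.bdd_mul ((hmeas k hkT.le).mono (ℱ.le k)).aestronglyMeasurable (hexpbd k hkT.le)
    have hzero : ∫ ω, (W * D k) ω ∂P = 0 := by
      rw [← integral_condExp (ℱ.le k)]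
      have h1 := condExp_stronglyMeasurable_mul_of_bound (ℱ.le k) (hmeas k hkT.le) hDint _
        (hexpbd k hkT.le)
      refine (integral_congr_ae (h1.trans ?_)).trans (integral_zero Ω ℝ)
      filter_upwards [hmean k hkT] with ω hω
      simp [hω]
    calc ∫ ω, Real.exp (s * ∑ t ∈ Finset.range (k + 1), D t ω) ∂P
        ≤ ∫ ω, (Real.cosh (s * c) * W ω + Real.sinh (s * c) / c * (W * D k) ω) ∂P := by
          refine integral_mono_ae (hint _ hk)
            (((hint k hkT.le).const_mul _).add (hWD.const_mul _)) ?_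
          filter_upwards [hbd k hkT] with ω hω
          have h1 : |D k ω / c| ≤ 1 := by
            rw [abs_div, abs_of_pos hc]; exact (div_le_one hc).2 hω
          have h2 := Real.exp_mul_le_cosh_add_mul_sinh h1 (s * c)
          have h3 : D k ω / c * (s * c) = s * D k ω := by field_simp
          rw [h3] at h2
          have h4 : 0 ≤ W ω := (Real.exp_pos _).le
          calc Real.exp (s * ∑ t ∈ Finset.range (k + 1), D t ω)
              = W ω * Real.exp (s * D k ω) := by
                rw [Finset.sum_range_succ, mul_add, Real.exp_add]
            _ ≤ W ω * (Real.cosh (s * c) + D k ω / c * Real.sinh (s * c)) := by gcongr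
            _ = _ := by simp only [Pi.mul_apply]; ring
      _ = Real.cosh (s * c) * ∫ ω, W ω ∂P := by
          rw [integral_add ((hint k hkT.le).const_mul _) (hWD.const_mul _),
            integral_const_mul, integral_const_mul, hzero, mul_zero, add_zero]
      _ ≤ Real.cosh (s * c) * Real.cosh (s * c) ^ k := by
          gcongr
          exact ih hkT.le
      _ = _ := by ring

theorem measure_sum_gt_le_exp_neg {Ω : Type*} {m0 : MeasurableSpace Ω} {P : Measure Ω}
    [IsProbabilityMeasure P] {ℱ : Filtration ℕ m0} {T : ℕ} (hT : 0 < T) {D : ℕ → Ω → ℝ} {c : ℝ}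
    (hc : 0 ≤ c) (hD : ∀ t < T, StronglyMeasurable[ℱ (t + 1)] (D t))
    (hbd : ∀ t < T, ∀ᵐ ω ∂P, |D t ω| ≤ c) (hmean : ∀ t < T, P[D t | ℱ t] =ᵐ[P] 0)
    {y : ℝ} (hy : 0 ≤ y) :
    P {ω | c * Real.sqrt (2 * y) * Real.sqrt T < ∑ t ∈ Finset.range T, D t ω}
      ≤ ENNReal.ofReal (Real.exp (-y)) := by
  rcases hc.eq_or_lt with rfl | hc
  · have : ∀ᵐ ω ∂P, ∀ t < T, |D t ω| ≤ 0 := by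
      rw [ae_all_iff]; intro t; rw [Filter.eventually_imp_distrib_left]; exact hbd t
    refine le_trans (le_of_eq (measure_mono_null ?_ (ae_iff.1 this))) zero_le
    intro ω hω hω'
    have hsum : ∑ t ∈ Finset.range T, D t ω = 0 :=
      Finset.sum_eq_zero fun t ht => abs_nonpos_iff.1 (hω' t (Finset.mem_range.1 ht))
    simp [hsum] at hω
  have hTr : (0 : ℝ) < T := by exact_mod_cast hT
  have hs : 0 < Real.sqrt T := Real.sqrt_pos.2 hTr
  have hs2 : Real.sqrt T ^ 2 = T := Real.sq_sqrt hTr.le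
  have hz2 : Real.sqrt (2 * y) ^ 2 = 2 * y := Real.sq_sqrt (by positivity)
  set r := Real.sqrt T
  set z := Real.sqrt (2 * y)
  have hz : 0 ≤ z := Real.sqrt_nonneg _
  obtain ⟨hint, hle⟩ := integral_exp_mul_sum_le_cosh_pow hc hD hbd hmean (z / (c * r)) T le_rfl
  have hch := ProbabilityTheory.measure_ge_le_exp_mul_mgf (μ := P)
    (X := fun ω => ∑ t ∈ Finset.range T, D t ω) (t := z / (c * r)) (c * z * r) (by positivity) hint
  have hcosh : Real.cosh (z / (c * r) * c) ^ T ≤ Real.exp y := by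
    calc Real.cosh (z / (c * r) * c) ^ T ≤ Real.exp ((z / (c * r) * c) ^ 2 / 2) ^ T :=
          pow_le_pow_left₀ (Real.cosh_pos _).le (Real.cosh_le_exp_half_sq _) _
      _ = Real.exp y := by
          rw [← Real.exp_nat_mul, ← hs2]
          congr 1
          field_simp
          linarith
  have hexp : Real.exp (-(z / (c * r)) * (c * z * r)) = Real.exp (-(2 * y)) := by
    rw [← hz2]; congr 1; field_simp
  rw [hexp] at hch
  have hreal : P.real {ω | c * z * r ≤ ∑ t ∈ Finset.range T, D t ω} ≤ Real.exp (-y) := by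
    calc _ ≤ _ := hch
      _ ≤ Real.exp (-(2 * y)) * Real.exp y := by
          gcongr
          exact hle.trans hcosh
      _ = Real.exp (-y) := by rw [← Real.exp_add]; congr 1; ring
  calc P {ω | c * z * r < ∑ t ∈ Finset.range T, D t ω}
      ≤ P {ω | c * z * r ≤ ∑ t ∈ Finset.range T, D t ω} := measure_mono <|
        Set.ofPred_subset_ofPred.2 fun ω hω => hω.le
    _ = ENNReal.ofReal (P.real _) := (ofReal_measureReal).symm
    _ ≤ _ := ENNReal.ofReal_le_ofReal hreal

/-- High-probability form of the regret of projected stochastic subgradient descent against the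
conditional means of the subgradients: the excess over the deterministic regret is a
martingale with bounded increments that does not depend on the comparator. -/
theorem exists_noise_of_projected_stochastic_descent {Ω : Type*} {m0 : MeasurableSpace Ω}
    {P : Measure Ω} [IsProbabilityMeasure P] {ℱ : Filtration ℕ m0}
    {E : Type*} [NormedAddCommGroup E] [InnerProductSpace ℝ E] [FiniteDimensional ℝ E]
    [MeasurableSpace E] [BorelSpace E]
    {K : Set E} (hK : Convex ℝ K) {B G η : ℝ}
    (hB : ∀ y ∈ K, ‖y‖ ≤ B) {T : ℕ} (hT : 0 < T)
    (hη : η = B / (G * Real.sqrt (2 * T))) {x g : ℕ → Ω → E} (hx0 : ∀ ω, x 0 ω = 0)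
    (h0 : (0 : E) ∈ K)
    (hxm : ∀ t, Measurable[ℱ t] (x t)) (hgm : ∀ t, Measurable[ℱ (t + 1)] (g t))
    (hg : ∀ t < T, ∀ᵐ ω ∂P, ‖g t ω‖ ≤ G)
    (hx : ∀ t < T, ∀ ω, x (t + 1) ω ∈ K ∧
      ∀ y ∈ K, ‖x (t + 1) ω - (x t ω - η • g t ω)‖ ≤ ‖y - (x t ω - η • g t ω)‖) :
    0 ≤ B * G ∧ ∃ D : ℕ → Ω → ℝ, (∀ t < T, StronglyMeasurable[ℱ (t + 1)] (D t)) ∧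
      (∀ t < T, ∀ᵐ ω ∂P, |D t ω| ≤ 4 * (B * G)) ∧ (∀ t < T, P[D t | ℱ t] =ᵐ[P] 0) ∧
      ∀ᵐ ω ∂P, ∀ y ∈ K, ∑ t ∈ Finset.range T, inner ℝ ((P[g t | ℱ t]) ω) (x t ω - y)
        ≤ 9 / 2 * (B * G) * Real.sqrt T + ∑ t ∈ Finset.range T, D t ω := by
  have hB0 : 0 ≤ B := (norm_nonneg _).trans (hB 0 h0)
  have hG : 0 ≤ G := by
    obtain ⟨ω, hω⟩ := (hg 0 hT).exists
    exact (norm_nonneg _).trans hω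
  refine ⟨mul_nonneg hB0 hG, ?_⟩
  set ξ : ℕ → Ω → E := fun t ω => g t ω - (P[g t | ℱ t]) ω with hξ
  set w : ℕ → Ω → E := fun t ω =>
    B • smoothedDirection (2 * G * Real.sqrt T) (∑ j ∈ Finset.range t, ξ j ω) - x t ω with hw
  have hgs : ∀ t, StronglyMeasurable[ℱ (t + 1)] (g t) := fun t => (hgm t).stronglyMeasurable
  have hξm : ∀ t, StronglyMeasurable[ℱ (t + 1)] (ξ t) := fun t =>
    (hgs t).sub (stronglyMeasurable_condExp.mono (ℱ.mono t.le_succ))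
  have hwm : ∀ t, StronglyMeasurable[ℱ t] (w t) := by
    intro t
    have hS : StronglyMeasurable[ℱ t] (fun ω => ∑ j ∈ Finset.range t, ξ j ω) :=
      Finset.stronglyMeasurable_fun_sum _ fun j hj =>
        (hξm j).mono (ℱ.mono (by have := Finset.mem_range.1 hj; omega))
    have hdir : Measurable (smoothedDirection (E := E) (2 * G * Real.sqrt T)) := by
      unfold smoothedDirection; fun_prop
    exact (((hdir.comp hS.measurable).stronglyMeasurable).const_smul B).sub
      (hxm t).stronglyMeasurable
  have hgint : ∀ t < T, Integrable (g t) P := fun t ht => Integrable.of_bound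
    ((hgs t).mono (ℱ.le _)).aestronglyMeasurable G (hg t ht)
  have hxB : ∀ t < T, ∀ ω, ‖x t ω‖ ≤ B := by
    intro t ht ω
    cases t with
    | zero => rw [hx0, norm_zero]; exact hB0
    | succ s => exact hB _ (hx s (by omega) ω).1
  have hwB : ∀ t < T, ∀ ω, ‖w t ω‖ ≤ 2 * B := by
    intro t ht ω
    refine (norm_sub_le _ _).trans ?_
    rw [norm_smul, Real.norm_eq_abs, abs_of_nonneg hB0]
    have h1 := mul_le_mul_of_nonneg_left
      (norm_smoothedDirection_le (2 * G * Real.sqrt T) (∑ j ∈ Finset.range t, ξ j ω)) hB0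
    linarith [hxB t ht ω]
  have hξB : ∀ t < T, ∀ᵐ ω ∂P, ‖ξ t ω‖ ≤ 2 * G := by
    intro t ht
    filter_upwards [hg t ht, ae_bdd_norm_condExp_of_ae_bdd_norm (m := ℱ t) (hg t ht)] with ω h1 h2
    exact (norm_sub_le _ _).trans (by linarith)
  have hξint : ∀ t < T, Integrable (ξ t) P := fun t ht => (hgint t ht).sub integrable_condExp
  have hξmean : ∀ t < T, P[ξ t | ℱ t] =ᵐ[P] 0 := by
    intro t ht
    refine (condExp_sub (hgint t ht) integrable_condExp (ℱ t)).trans ?_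
    rw [condExp_of_stronglyMeasurable (ℱ.le t) stronglyMeasurable_condExp integrable_condExp,
      sub_self]
  refine ⟨fun t ω => inner ℝ (w t ω) (ξ t ω), fun t ht =>
    ((hwm t).mono (ℱ.mono t.le_succ)).inner (hξm t), fun t ht => ?_, fun t ht => ?_, ?_⟩
  · filter_upwards [hξB t ht] with ω hω
    refine (abs_real_inner_le_norm _ _).trans ?_
    calc ‖w t ω‖ * ‖ξ t ω‖ ≤ (2 * B) * (2 * G) :=
          mul_le_mul (hwB t ht ω) hω (norm_nonneg _) (by positivity)
      _ = _ := by ring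
  · refine (condExp_stronglyMeasurable_bilin_of_bound (innerSL ℝ) (ℱ.le t) (hwm t) (hξint t ht)
      (2 * B) (Filter.Eventually.of_forall (hwB t ht))).trans ?_
    filter_upwards [hξmean t ht] with ω hω
    simp [hω]
  · have hg' : ∀ᵐ ω ∂P, ∀ t < T, ‖g t ω‖ ≤ G := by
      rw [ae_all_iff]; intro t; rw [Filter.eventually_imp_distrib_left]; exact hg t
    have hξ' : ∀ᵐ ω ∂P, ∀ t < T, ‖ξ t ω‖ ≤ 2 * G := by
      rw [ae_all_iff]; intro t; rw [Filter.eventually_imp_distrib_left]; exact hξB t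
    filter_upwards [hg', hξ'] with ω hgω hξω y hy
    have h1 := sum_inner_le_of_projected_descent (x := fun t => x t ω) hK hB hG hT hη (hx0 ω) h0 hgω
      (fun t ht => hx t ht ω) hy
    have h2 := norm_sum_le_sum_inner_smoothedDirection hG hT hξω
    set V : ℕ → E := fun t =>
      smoothedDirection (2 * G * Real.sqrt T) (∑ j ∈ Finset.range t, ξ j ω) with hV
    have h3 : inner ℝ (∑ t ∈ Finset.range T, ξ t ω) y
        ≤ B * ‖∑ t ∈ Finset.range T, ξ t ω‖ := by
      refine (real_inner_le_norm _ _).trans ?_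
      rw [mul_comm]
      gcongr
      exact hB y hy
    have h4 : ∑ t ∈ Finset.range T, inner ℝ ((P[g t | ℱ t]) ω) (x t ω - y)
        = ∑ t ∈ Finset.range T, inner ℝ (g t ω) (x t ω - y)
          + inner ℝ (∑ t ∈ Finset.range T, ξ t ω) y
          - ∑ t ∈ Finset.range T, inner ℝ (ξ t ω) (x t ω) := by
      rw [sum_inner, ← Finset.sum_add_distrib, ← Finset.sum_sub_distrib]
      refine Finset.sum_congr rfl fun t _ => ?_
      simp only [hξ, inner_sub_left, inner_sub_right]
      ring
    have h5 : ∑ t ∈ Finset.range T, inner ℝ (w t ω) (ξ t ω)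
        = B * ∑ t ∈ Finset.range T, inner ℝ (ξ t ω) (V t)
          - ∑ t ∈ Finset.range T, inner ℝ (ξ t ω) (x t ω) := by
      rw [Finset.mul_sum, ← Finset.sum_sub_distrib]
      refine Finset.sum_congr rfl fun t _ => ?_
      rw [real_inner_comm]
      simp only [hw, inner_sub_right, inner_smul_right, hV]
    have h6 := mul_le_mul_of_nonneg_left h2 hB0
    rw [h4, h5]
    linarith

theorem euclNorm_eq_norm_toLp {k : ℕ} (x : Fin k → ℝ) : euclNorm x = ‖WithLp.toLp 2 x‖ := by
  simp [euclNorm, EuclideanSpace.norm_eq]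

theorem euclNorm_le_sum {k : ℕ} {x : Fin k → ℝ} (hx : ∀ i, 0 ≤ x i) : euclNorm x ≤ ∑ i, x i :=
  Real.sqrt_le_iff.2 ⟨Finset.sum_nonneg fun i _ => hx i,
    Finset.sum_sq_le_sq_sum_of_nonneg fun i _ => hx i⟩

theorem condExp_toLp_apply {Ω : Type*} {m m0 : MeasurableSpace Ω} {P : Measure Ω} {k : ℕ}
    {f : Ω → Fin k → ℝ} (hf : Integrable (fun ω => WithLp.toLp 2 (f ω)) P) :
    ∀ᵐ ω ∂P, ∀ i, (P[fun ω' => WithLp.toLp 2 (f ω') | m]) ω i = (P[fun ω' => f ω' i | m]) ω :=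
  ae_all_iff.2 fun i =>
    ContinuousLinearMap.comp_condExp_comm hf (EuclideanSpace.proj (𝕜 := ℝ) i)

theorem stochastic_rate_const_le {δ : ℝ} (hδ : 0 < δ) (hδ1 : δ < 1) :
    9 / 2 + 4 * Real.sqrt (2 * Real.log (1 / δ)) ≤ 2 * Real.sqrt (1 + 16 * Real.log (2 / δ)) := by
  have hy : 0 ≤ Real.log (1 / δ) := Real.log_nonneg (by rw [le_div_iff₀ hδ]; linarith)
  have hlog : Real.log (2 / δ) = Real.log 2 + Real.log (1 / δ) := by
    rw [← Real.log_mul (by norm_num) (by positivity)]; congr 1; ring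
  have h2 := Real.log_two_gt_d9
  have hz2 : Real.sqrt (2 * Real.log (1 / δ)) ^ 2 = 2 * Real.log (1 / δ) :=
    Real.sq_sqrt (by positivity)
  have hz := Real.sqrt_nonneg (2 * Real.log (1 / δ))
  set z := Real.sqrt (2 * Real.log (1 / δ))
  have : (9 / 2 + 4 * z) / 2 ≤ Real.sqrt (1 + 16 * Real.log (2 / δ)) := by
    refine Real.le_sqrt_of_sq_le ?_
    rw [hlog]
    nlinarith [sq_nonneg (4 * z - 9 / 2)]
  linarith

/-- **Convergence of stochastic gradient descent/ascent on the Lagrangian**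
(Lemma C.3 / Algorithm 3).  Both players perform projected stochastic
(sub)gradient steps on the Lagrangian `L(θ,λ) = g₀(θ) + ∑ᵢ λᵢ gᵢ(θ)`, the
`θ`-player over the compact convex set `Θ ∋ 0` and the `λ`-player over
`Λ = {λ ∈ ℝ₊^m : ‖λ‖₁ ≤ R}`, with the stated step sizes.  Then with
probability at least `1 − δ` over the draws of the stochastic (sub)gradients,
`max_{λ*∈Λ} (1/T) ∑ₜ L(θ^(t),λ*) − inf_{θ*∈Θ} (1/T) ∑ₜ L(θ*,λ^(t))
  ≤ 2 (B_Θ B_ǧ + R B_Δ) √((1 + 16 ln(2/δ)) / T)`. -/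
theorem stochastic_lagrangian_convergence
    {n m : ℕ}
    {Ω : Type*} {m0 : MeasurableSpace Ω} (P : Measure Ω) [IsProbabilityMeasure P]
    (ℱ : Filtration ℕ m0)
    (Θ : Set (Fin n → ℝ)) (hΘconv : Convex ℝ Θ) (hΘcomp : IsCompact Θ)
    (hΘ0 : (0 : Fin n → ℝ) ∈ Θ)
    (g0 : (Fin n → ℝ) → ℝ) (g : Fin m → (Fin n → ℝ) → ℝ)
    (hg0conv : ConvexOn ℝ Θ g0) (hgconv : ∀ i, ConvexOn ℝ Θ (g i))
    (L : (Fin n → ℝ) → (Fin m → ℝ) → ℝ)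
    (hL : ∀ θ l, L θ l = g0 θ + ∑ i, l i * g i θ)
    (R BΘ Bg BΔ δ : ℝ) (hδ : 0 < δ)
    (Λ : Set (Fin m → ℝ))
    (hΛ : Λ = {l | (∀ i, 0 ≤ l i) ∧ ∑ i, l i ≤ R})
    (hBΘ : ∀ θ ∈ Θ, euclNorm θ ≤ BΘ)
    (T : ℕ) (hT : 0 < T)
    (ηθ ηlam : ℝ)
    (hηθ : ηθ = BΘ / (Bg * Real.sqrt (2 * T)))
    (hηlam : ηlam = R / (BΔ * Real.sqrt (2 * T)))
    (θs : ℕ → Ω → Fin n → ℝ) (ls : ℕ → Ω → Fin m → ℝ)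
    (gs : ℕ → Ω → Fin n → ℝ)      -- stochastic subgradients ǧ^(t)
    (Δs : ℕ → Ω → Fin m → ℝ)      -- stochastic gradients Δ^(t)
    (hθinit : ∀ ω, θs 0 ω = 0) (hlaminit : ∀ ω, ls 0 ω = 0)
    -- adaptedness
    (hθmeas : ∀ t, Measurable[ℱ t] (θs t))
    (hlammeas : ∀ t, Measurable[ℱ t] (ls t))
    (hgmeas : ∀ t, Measurable[ℱ (t + 1)] (gs t))
    (hΔmeas : ∀ t, Measurable[ℱ (t + 1)] (Δs t))
    -- the conditional expectation of `ǧ^(t)` is a subgradient of `L(·, λ^(t))`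
    -- at `θ^(t)`
    (hsub : ∀ t < T, ∀ᵐ ω ∂P, ∀ y ∈ Θ,
      L (θs t ω) (ls t ω)
          + ∑ i, (P[fun ω' => gs t ω' i|ℱ t]) ω * (y i - θs t ω i)
        ≤ L y (ls t ω))
    -- the conditional expectation of `Δ^(t)` is the gradient of `L(θ^(t), ·)`
    (hgrad : ∀ t < T, ∀ i, ∀ᵐ ω ∂P, (P[fun ω' => Δs t ω' i|ℱ t]) ω = g i (θs t ω))
    -- almost-sure norm bounds
    (hBg : ∀ t < T, ∀ᵐ ω ∂P, euclNorm (gs t ω) ≤ Bg)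
    (hBΔ : ∀ t < T, ∀ᵐ ω ∂P, euclNorm (Δs t ω) ≤ BΔ)
    -- projected stochastic gradient updates
    (hθupdate : ∀ t < T, ∀ ω, θs (t + 1) ω ∈ Θ ∧
      ∀ y ∈ Θ, euclNorm (θs (t + 1) ω - (θs t ω - ηθ • gs t ω))
        ≤ euclNorm (y - (θs t ω - ηθ • gs t ω)))
    (hlamupdate : ∀ t < T, ∀ ω, ls (t + 1) ω ∈ Λ ∧
      ∀ y ∈ Λ, euclNorm (ls (t + 1) ω - (ls t ω + ηlam • Δs t ω))
        ≤ euclNorm (y - (ls t ω + ηlam • Δs t ω))) :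
    ENNReal.ofReal (1 - δ) ≤ P {ω | ∀ l' ∈ Λ, ∀ θ' ∈ Θ,
      (1 / (T : ℝ)) * ∑ t ∈ Finset.range T, L (θs t ω) l'
        - (1 / (T : ℝ)) * ∑ t ∈ Finset.range T, L θ' (ls t ω)
      ≤ 2 * (BΘ * Bg + R * BΔ) * Real.sqrt ((1 + 16 * Real.log (2 / δ)) / T)} := by
  rcases le_or_gt 1 δ with hδ1 | hδ1
  · rw [ENNReal.ofReal_of_nonpos (by linarith)]
    exact zero_le
  have hTr : (0 : ℝ) < T := by exact_mod_cast hT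
  have hΛne : ∀ l ∈ Λ, 0 ≤ R := fun l hl => by
    rw [hΛ] at hl
    exact (Finset.sum_nonneg fun i _ => hl.1 i).trans hl.2
  have hΛ0 : (0 : Fin m → ℝ) ∈ Λ := by
    obtain ⟨ω, -⟩ := (hBg 0 hT).exists
    have := hΛne _ (hlamupdate 0 hT ω).1
    rw [hΛ]
    exact ⟨fun i => le_rfl, by simpa using this⟩
  have hΛconv : Convex ℝ Λ := by
    rw [hΛ]
    rintro a ⟨ha, ha'⟩ b ⟨hb, hb'⟩ p q hp hq hpq
    refine ⟨fun i => add_nonneg (mul_nonneg hp (ha i)) (mul_nonneg hq (hb i)), ?_⟩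
    simp only [Pi.add_apply, Pi.smul_apply, smul_eq_mul, Finset.sum_add_distrib, ← Finset.mul_sum]
    calc p * ∑ i, a i + q * ∑ i, b i ≤ p * R + q * R := by gcongr
      _ = R := by rw [← add_mul, hpq, one_mul]
  have hBΛ : ∀ l ∈ Λ, euclNorm l ≤ R := by
    intro l hl
    rw [hΛ] at hl
    exact (euclNorm_le_sum hl.1).trans hl.2
  have hgs : ∀ t, Measurable[ℱ (t + 1)] (fun ω => WithLp.toLp 2 (gs t ω)) := fun t =>
    (WithLp.measurable_toLp 2 _).comp (hgmeas t)
  have hΔs : ∀ t, Measurable[ℱ (t + 1)] (fun ω => WithLp.toLp 2 (-Δs t ω)) := fun t =>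
    (WithLp.measurable_toLp 2 _).comp (hΔmeas t).neg
  have hgbd : ∀ t < T, ∀ᵐ ω ∂P, ‖WithLp.toLp 2 (gs t ω)‖ ≤ Bg := fun t ht => by
    simpa only [euclNorm_eq_norm_toLp] using hBg t ht
  have hΔbd : ∀ t < T, ∀ᵐ ω ∂P, ‖WithLp.toLp 2 (-Δs t ω)‖ ≤ BΔ := fun t ht => by
    simpa only [euclNorm_eq_norm_toLp, WithLp.toLp_neg, norm_neg] using hBΔ t ht
  obtain ⟨hC₁, D₁, hD₁, hD₁bd, hD₁mean, hD₁le⟩ :=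
    exists_noise_of_projected_stochastic_descent (P := P) (ℱ := ℱ)
      (E := EuclideanSpace ℝ (Fin n)) (K := WithLp.ofLp ⁻¹' Θ)
      (hΘconv.linear_preimage (WithLp.linearEquiv 2 ℝ (Fin n → ℝ)).toLinearMap)
      (fun y hy => by simpa only [euclNorm_eq_norm_toLp, WithLp.toLp_ofLp] using hBΘ _ hy)
      hT hηθ (x := fun t ω => WithLp.toLp 2 (θs t ω)) (fun ω => by simp [hθinit ω]) (by simpa)
      (fun t => (WithLp.measurable_toLp 2 _).comp (hθmeas t)) hgs hgbd
      (fun t ht ω => ⟨(hθupdate t ht ω).1, fun y hy => by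
        simpa only [euclNorm_eq_norm_toLp, WithLp.toLp_sub, WithLp.toLp_smul, WithLp.toLp_ofLp]
          using (hθupdate t ht ω).2 _ hy⟩)
  obtain ⟨hC₂, D₂, hD₂, hD₂bd, hD₂mean, hD₂le⟩ :=
    exists_noise_of_projected_stochastic_descent (P := P) (ℱ := ℱ)
      (E := EuclideanSpace ℝ (Fin m)) (K := WithLp.ofLp ⁻¹' Λ)
      (hΛconv.linear_preimage (WithLp.linearEquiv 2 ℝ (Fin m → ℝ)).toLinearMap)
      (fun y hy => by simpa only [euclNorm_eq_norm_toLp, WithLp.toLp_ofLp] using hBΛ _ hy)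
      hT hηlam (x := fun t ω => WithLp.toLp 2 (ls t ω)) (fun ω => by simp [hlaminit ω]) (by simpa)
      (fun t => (WithLp.measurable_toLp 2 _).comp (hlammeas t)) hΔs hΔbd
      (fun t ht ω => ⟨(hlamupdate t ht ω).1, fun y hy => by
        simpa only [euclNorm_eq_norm_toLp, WithLp.toLp_sub, WithLp.toLp_add, WithLp.toLp_neg,
          WithLp.toLp_smul, WithLp.toLp_ofLp, smul_neg, sub_neg_eq_add]
          using (hlamupdate t ht ω).2 _ hy⟩)
  set C := BΘ * Bg + R * BΔ with hC
  have hC0 : 0 ≤ C := add_nonneg hC₁ hC₂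
  have hDint : ∀ {D : ℕ → Ω → ℝ} {c : ℝ}, (∀ t < T, StronglyMeasurable[ℱ (t + 1)] (D t)) →
      (∀ t < T, ∀ᵐ ω ∂P, |D t ω| ≤ c) → ∀ t < T, Integrable (D t) P := fun hD hbd t ht =>
    Integrable.of_bound ((hD t ht).mono (ℱ.le _)).aestronglyMeasurable _ (hbd t ht)
  set y := Real.log (1 / δ) with hy
  have hy0 : 0 ≤ y := Real.log_nonneg (by rw [le_div_iff₀ hδ]; linarith)
  have htail := measure_sum_gt_le_exp_neg (P := P) (ℱ := ℱ) hT
    (D := fun t => D₁ t + D₂ t) (c := 4 * C) (by positivity)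
    (fun t ht => (hD₁ t ht).add (hD₂ t ht))
    (fun t ht => by
      filter_upwards [hD₁bd t ht, hD₂bd t ht] with ω h1 h2
      exact (abs_add_le _ _).trans (by rw [hC]; linarith))
    (fun t ht => by
      refine (condExp_add (hDint hD₁ hD₁bd t ht) (hDint hD₂ hD₂bd t ht) (ℱ t)).trans ?_
      filter_upwards [hD₁mean t ht, hD₂mean t ht] with ω h1 h2
      simp [h1, h2]) hy0
  have hexp : Real.exp (-y) = δ := by
    rw [hy, one_div, Real.log_inv, neg_neg, Real.exp_log hδ]
  rw [hexp] at htail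
  have hsub' : ∀ᵐ ω ∂P, ∀ t < T, ∀ y ∈ Θ, L (θs t ω) (ls t ω)
      + inner ℝ ((P[fun ω' => WithLp.toLp 2 (gs t ω') | ℱ t]) ω) (WithLp.toLp 2 (y - θs t ω))
        ≤ L y (ls t ω) := by
    rw [ae_all_iff]; intro t; rw [Filter.eventually_imp_distrib_left]; intro ht
    have hint : Integrable (fun ω => WithLp.toLp 2 (gs t ω)) P := Integrable.of_bound
      ((hgs t).stronglyMeasurable.mono (ℱ.le _)).aestronglyMeasurable Bg (hgbd t ht)
    filter_upwards [hsub t ht, condExp_toLp_apply (m := ℱ t) hint] with ω h1 h2 y hy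
    refine le_trans (le_of_eq ?_) (h1 y hy)
    simp [PiLp.inner_apply, h2, mul_comm]
  have hgrad' : ∀ᵐ ω ∂P, ∀ t < T, ∀ i,
      (P[fun ω' => WithLp.toLp 2 (-Δs t ω') | ℱ t]) ω i = -g i (θs t ω) := by
    rw [ae_all_iff]; intro t; rw [Filter.eventually_imp_distrib_left]; intro ht
    have hint : Integrable (fun ω => WithLp.toLp 2 (-Δs t ω)) P := Integrable.of_bound
      ((hΔs t).stronglyMeasurable.mono (ℱ.le _)).aestronglyMeasurable BΔ (hΔbd t ht)
    have hneg : ∀ᵐ ω ∂P, ∀ i,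
        (P[fun ω' => (-Δs t ω') i | ℱ t]) ω = -(P[fun ω' => Δs t ω' i | ℱ t]) ω :=
      ae_all_iff.2 fun i => condExp_neg (fun ω' => Δs t ω' i) (ℱ t)
    filter_upwards [ae_all_iff.2 (hgrad t ht), condExp_toLp_apply (m := ℱ t) hint, hneg]
      with ω h1 h2 h3 i
    rw [h2, h3, h1]
  set bad := {ω | 4 * C * Real.sqrt (2 * y) * Real.sqrt T
    < ∑ t ∈ Finset.range T, (D₁ t + D₂ t) ω}
  have hgood : ∀ᵐ ω ∂P, ω ∈ badᶜ → ω ∈ {ω | ∀ l' ∈ Λ, ∀ θ' ∈ Θ,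
      (1 / (T : ℝ)) * ∑ t ∈ Finset.range T, L (θs t ω) l'
        - (1 / (T : ℝ)) * ∑ t ∈ Finset.range T, L θ' (ls t ω)
      ≤ 2 * C * Real.sqrt ((1 + 16 * Real.log (2 / δ)) / T)} := by
    filter_upwards [hD₁le, hD₂le, hsub', hgrad'] with ω h1 h2 h3 h4 hω l' hl' θ' hθ'
    have hω' : ∑ t ∈ Finset.range T, (D₁ t + D₂ t) ω
        ≤ 4 * C * Real.sqrt (2 * y) * Real.sqrt T := not_lt.1 hω
    simp only [Pi.add_apply, Finset.sum_add_distrib] at hω'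
    have h5 := h1 (WithLp.toLp 2 θ') hθ'
    have h6 := h2 (WithLp.toLp 2 l') hl'
    have hgap : ∑ t ∈ Finset.range T, L (θs t ω) l' - ∑ t ∈ Finset.range T, L θ' (ls t ω)
        ≤ ∑ t ∈ Finset.range T, inner ℝ ((P[fun ω' => WithLp.toLp 2 (gs t ω') | ℱ t]) ω)
            (WithLp.toLp 2 (θs t ω) - WithLp.toLp 2 θ')
          + ∑ t ∈ Finset.range T, inner ℝ ((P[fun ω' => WithLp.toLp 2 (-Δs t ω') | ℱ t]) ω)
            (WithLp.toLp 2 (ls t ω) - WithLp.toLp 2 l') := by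
      rw [← Finset.sum_add_distrib, ← Finset.sum_sub_distrib]
      refine Finset.sum_le_sum fun t ht => ?_
      have ht' := Finset.mem_range.1 ht
      have h7 := h3 t ht' θ' hθ'
      rw [WithLp.toLp_sub, ← neg_sub, inner_neg_right] at h7
      have h8 : inner ℝ ((P[fun ω' => WithLp.toLp 2 (-Δs t ω') | ℱ t]) ω)
          (WithLp.toLp 2 (ls t ω) - WithLp.toLp 2 l') = L (θs t ω) l' - L (θs t ω) (ls t ω) := by
        rw [hL, hL, add_sub_add_left_eq_sub, ← Finset.sum_sub_distrib, PiLp.inner_apply]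
        refine Finset.sum_congr rfl fun i _ => ?_
        simp only [h4 t ht' i, PiLp.sub_apply, RCLike.inner_apply, conj_trivial]
        ring
      rw [h8]
      linarith
    have hs : 0 < Real.sqrt T := Real.sqrt_pos.2 hTr
    have hrate := mul_le_mul_of_nonneg_left (stochastic_rate_const_le hδ hδ1)
      (mul_nonneg hC0 hs.le)
    rw [← mul_sub, one_div, inv_mul_le_iff₀ hTr, Real.sqrt_div' _ hTr.le]
    calc _ ≤ C * Real.sqrt T * (9 / 2 + 4 * Real.sqrt (2 * y)) := by
          rw [hC] at hω' ⊢
          linarith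
      _ ≤ _ := hrate
      _ = _ := by
          rw [show ∀ z, (T : ℝ) * (2 * C * (z / Real.sqrt T)) = 2 * C * z * (T / Real.sqrt T) from
            fun z => by ring, Real.div_sqrt]
          ring
  calc ENNReal.ofReal (1 - δ) = 1 - ENNReal.ofReal δ := by
        rw [ENNReal.ofReal_sub _ hδ.le, ENNReal.ofReal_one]
    _ ≤ 1 - P bad := tsub_le_tsub_left htail 1
    _ ≤ P badᶜ := by
        rw [tsub_le_iff_left, ← measure_univ (μ := P), ← Set.union_compl_self bad]
        exact measure_union_le _ _
    _ ≤ _ := measure_mono_ae hgood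
end

section
/- Suppose Θ ⊆ ℝ^n is a compact convex set containing 0, and the objective and proxy constraint functions g₀, g̃₁,…,g̃_m : Θ → ℝ are convex (the original constraints g₁,…,g_m need not be). Run T iterations starting from θ^(1) = 0 and the (m+1)×(m+1) matrix M^(1) with all entries 1/(m+1): at each t, λ^(t) is a stationary distribution of M^(t); θ^(t+1) = Π_Θ(θ^(t) − η_θ ǧ^(t)) where ǧ^(t) is a stochastic subgradient of ℒ_θ(·,λ^(t)) at θ^(t) with ‖ǧ^(t)‖₂ ≤ B_ǧ a.s.; M̃^(t+1) = M^(t) ⊙ exp(η_λ Δ^(t) (λ^(t))ᵀ) with columns then normalized to sum to 1, where Δ^(t) is a stochastic gradient of ℒ_λ(θ^(t),·) at λ^(t) with ‖Δ^(t)‖_∞ ≤ B_Δ a.s.; step sizes η_θ := B_Θ/(B_ǧ√(2T)) (with B_Θ ≥ max_{θ∈Θ}‖θ‖₂) and η_λ := √((m+1) ln(m+1)/(T B_Δ²)). Then with probability at least 1−δ over the draws of the stochastic (sub)gradients: (1/T)Σ_t ℒ_θ(θ^(t),λ^(t)) − inf_{θ*∈Θ}(1/T)Σ_t ℒ_θ(θ*,λ^(t))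 ≤ 2 B_Θ B_ǧ √((1 + 16 ln(2/δ))/T), and max_{M*∈ℳ}(1/T)Σ_t ℒ_λ(θ^(t),M*λ^(t)) − (1/T)Σ_t ℒ_λ(θ^(t),λ^(t)) ≤ 2 B_Δ √(2(m+1) ln(m+1)(1 + 16 ln(2/δ))/T). -/
open MeasureTheory

/-- **Hoeffding's lemma** for a finitely supported distribution on `[-B, B]`. -/
theorem sum_mul_exp_le_of_abs_le {κ : Type*} [Fintype κ] {w x : κ → ℝ} {B : ℝ}
    (hw : w ∈ stdSimplex ℝ κ) (hx : ∀ k, |x k| ≤ B) :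
    ∑ k, w k * Real.exp (x k) ≤ Real.exp (∑ k, w k * x k + B ^ 2 / 2) := by
  classical
  let _ : MeasurableSpace κ := ⊤
  let μ : Measure κ := ∑ k, ENNReal.ofReal (w k) • Measure.dirac k
  have hint : ∀ f : κ → ℝ, ∫ k, f k ∂μ = ∑ k, w k * f k := fun f => by
    rw [integral_finsetSum_measure fun k _ =>
      (integrable_dirac (by simp)).smul_measure ENNReal.ofReal_ne_top]
    simp [ENNReal.toReal_ofReal (hw.1 _)]
  have : IsProbabilityMeasure μ := ⟨by
    simp [μ, ← ENNReal.ofReal_sum_of_nonneg fun k _ => hw.1 k, hw.2]⟩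
  have hsub := ProbabilityTheory.hasSubgaussianMGF_of_mem_Icc (μ := μ) (X := x)
    (measurable_from_top).aemeasurable
    (Filter.Eventually.of_forall fun k => abs_le.1 (hx k))
  have hle := hsub.mgf_le 1
  rw [ProbabilityTheory.mgf, hint, hint] at hle
  have hB : (((‖B - -B‖₊ / 2) ^ 2 : NNReal) : ℝ) * 1 ^ 2 / 2 = B ^ 2 / 2 := by
    push_cast
    rw [Real.norm_eq_abs, div_pow, sq_abs]
    ring
  rw [hB] at hle
  calc ∑ k, w k * Real.exp (x k)
      = Real.exp (∑ k, w k * x k) * ∑ k, w k * Real.exp (1 * (x k - ∑ k, w k * x k)) := by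
        rw [Finset.mul_sum]
        refine Finset.sum_congr rfl fun k _ => ?_
        rw [mul_left_comm, ← Real.exp_add]
        ring_nf
    _ ≤ _ := by
        rw [Real.exp_add]
        gcongr

/-- The bound on the moment generating function of a two-point distribution on `{-c, c}`
underlying the conditional Hoeffding lemma. -/
theorem exp_mul_cosh_sub_sinh_le {a c r : ℝ} (hr : |r| ≤ 1) (hc : a = c * r) :
    Real.exp a * (Real.cosh c - r * Real.sinh c) ≤ Real.exp (c ^ 2 / 2) := by
  obtain ⟨h1, h2⟩ := abs_le.1 hr
  have := sum_mul_exp_le_of_abs_le (κ := Fin 2) (w := ![(1 - r) / 2, (1 + r) / 2])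
    (x := ![c, -c]) (B := |c|) ⟨fun k => by fin_cases k <;> simp <;> linarith,
      by simp [Fin.sum_univ_two]; ring⟩ (fun k => by fin_cases k <;> simp)
  simp only [Fin.sum_univ_two, Matrix.cons_val_zero, Matrix.cons_val_one, sq_abs] at this
  have h : (1 - r) / 2 * Real.exp c + (1 + r) / 2 * Real.exp (-c)
      = Real.cosh c - r * Real.sinh c := by
    rw [Real.cosh_eq, Real.sinh_eq]; ring
  rw [h] at this
  calc _ ≤ _ := mul_le_mul_of_nonneg_left this (Real.exp_pos a).le
    _ = _ := by
      rw [← Real.exp_add, hc]; ring_nf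

theorem exp_mul_le_cosh_add_sinh {s c x : ℝ} (hc : 0 < c) (hx : |x| ≤ c) :
    Real.exp (s * x) ≤ Real.cosh (s * c) + x / c * Real.sinh (s * c) := by
  obtain ⟨h1, h2⟩ := abs_le.1 hx
  have hl : 0 ≤ (1 + x / c) / 2 := by
    have : -1 ≤ x / c := by rw [le_div_iff₀ hc]; linarith
    linarith
  have hr : 0 ≤ (1 - x / c) / 2 := by
    have : x / c ≤ 1 := by rw [div_le_iff₀ hc]; linarith
    linarith
  have h := convexOn_exp.2 (Set.mem_univ (s * c)) (Set.mem_univ (-(s * c))) hl hr (by ring)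
  simp only [smul_eq_mul] at h
  calc Real.exp (s * x) = _ := by congr 1; field_simp; ring
    _ ≤ _ := h
    _ = _ := by rw [Real.cosh_eq, Real.sinh_eq]; ring

/-- **Azuma–Hoeffding inequality**: the exponential moments of the sum of the compensated
variables `𝔼[X t | ℱ t] - X t`, where `|X t| ≤ c` almost surely. -/
theorem integral_exp_sum_condExp_sub_le
    {Ω : Type*} {m0 : MeasurableSpace Ω} {P : Measure Ω} [IsProbabilityMeasure P]
    {ℱ : Filtration ℕ m0} {X : ℕ → Ω → ℝ} {T : ℕ} {c : ℝ} (s : ℝ) (hc : 0 < c)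
    (hX : ∀ t < T, StronglyMeasurable[ℱ (t + 1)] (X t))
    (hb : ∀ t < T, ∀ᵐ ω ∂P, |X t ω| ≤ c) :
    Integrable (fun ω => Real.exp (s * ∑ t ∈ Finset.range T, ((P[X t|ℱ t]) ω - X t ω))) P ∧
    ∫ ω, Real.exp (s * ∑ t ∈ Finset.range T, ((P[X t|ℱ t]) ω - X t ω)) ∂P
      ≤ Real.exp (T * ((s * c) ^ 2 / 2)) := by
  have key : ∀ n ≤ T,
      StronglyMeasurable[ℱ n] (fun ω => ∑ t ∈ Finset.range n, ((P[X t|ℱ t]) ω - X t ω)) ∧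
      (∀ᵐ ω ∂P, |∑ t ∈ Finset.range n, ((P[X t|ℱ t]) ω - X t ω)| ≤ n * (2 * c)) ∧
      ∫ ω, Real.exp (s * ∑ t ∈ Finset.range n, ((P[X t|ℱ t]) ω - X t ω)) ∂P
        ≤ Real.exp (n * ((s * c) ^ 2 / 2)) := by
    intro n
    induction n with
    | zero => intro _; simp [stronglyMeasurable_const]
    | succ n ih =>
      intro hn
      obtain ⟨ihm, ihb, ihI⟩ := ih (by omega)
      have hXm := hX n (by omega)
      have hXb := hb n (by omega)
      have hXint : Integrable (X n) P :=
        Integrable.of_bound (hXm.mono (ℱ.le _)).aestronglyMeasurable c hXb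
      have hEb : ∀ᵐ ω ∂P, |(P[X n|ℱ n]) ω| ≤ c :=
        ae_bdd_abs_condExp_of_ae_bdd_abs hXb
      have hEm : StronglyMeasurable[ℱ n] (P[X n|ℱ n]) := stronglyMeasurable_condExp
      set S : Ω → ℝ := fun ω => ∑ t ∈ Finset.range n, ((P[X t|ℱ t]) ω - X t ω) with hS
      simp only [Finset.sum_range_succ]
      refine ⟨?_, ?_, ?_⟩
      · exact (ihm.mono (ℱ.mono n.le_succ)).add ((hEm.mono (ℱ.mono n.le_succ)).sub hXm)
      · filter_upwards [ihb, hXb, hEb] with ω h1 h2 h3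
        push_cast
        rw [abs_le] at *
        constructor <;> linarith
      · let h : Ω → ℝ := fun ω => Real.exp (s * S ω + s * (P[X n|ℱ n]) ω)
        have hhm : StronglyMeasurable[ℱ n] h :=
          Real.continuous_exp.comp_stronglyMeasurable
            ((ihm.const_mul s).add (hEm.const_mul s))
        have hhb : ∀ᵐ ω ∂P, ‖h ω‖ ≤ Real.exp (|s| * (n * (2 * c)) + |s| * c) := by
          filter_upwards [ihb, hEb] with ω h1 h2
          rw [Real.norm_eq_abs, abs_of_pos (Real.exp_pos _)]
          refine Real.exp_le_exp.2 (add_le_add ?_ ?_) <;>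
          · refine (le_abs_self _).trans ?_
            rw [abs_mul]
            gcongr
        have hhI : Integrable h P :=
          Integrable.of_bound (hhm.mono (ℱ.le _)).aestronglyMeasurable _ hhb
        have hpull : ∫ ω, h ω * X n ω ∂P = ∫ ω, h ω * (P[X n|ℱ n]) ω ∂P := by
          have := condExp_stronglyMeasurable_mul_of_bound (ℱ.le n) hhm hXint _ hhb
          rw [← integral_condExp (ℱ.le n)]
          exact integral_congr_ae this
        have hhXI : Integrable (fun ω => h ω * X n ω) P :=
          hXint.bdd_mul (hhm.mono (ℱ.le _)).aestronglyMeasurable hhb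
        have hhEI : Integrable (fun ω => h ω * (P[X n|ℱ n]) ω) P :=
          integrable_condExp.bdd_mul (hhm.mono (ℱ.le _)).aestronglyMeasurable hhb
        have hSI : Integrable (fun ω => Real.exp (s * S ω)) P := by
          refine Integrable.of_bound (C := Real.exp (|s| * (n * (2 * c))))
            (Real.continuous_exp.comp_stronglyMeasurable
              ((ihm.mono (ℱ.le n)).const_mul s)).aestronglyMeasurable ?_
          filter_upwards [ihb] with ω h1
          rw [Real.norm_eq_abs, abs_of_pos (Real.exp_pos _)]
          refine Real.exp_le_exp.2 ((le_abs_self _).trans ?_)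
          rw [abs_mul]
          gcongr
        calc ∫ ω, Real.exp (s * (S ω + ((P[X n|ℱ n]) ω - X n ω))) ∂P
            ≤ ∫ ω, (Real.cosh (s * c) * h ω
                - Real.sinh (s * c) / c * (h ω * X n ω)) ∂P := by
              refine integral_mono_of_nonneg (Filter.Eventually.of_forall fun ω =>
                (Real.exp_pos _).le) ((hhI.const_mul _).sub (hhXI.const_mul _)) ?_
              filter_upwards [hXb] with ω hω
              have hX' := exp_mul_le_cosh_add_sinh (s := s) hc ((abs_neg (X n ω)).trans_le hω)
              calc Real.exp (s * (S ω + ((P[X n|ℱ n]) ω - X n ω)))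
                  = h ω * Real.exp (s * (-X n ω)) := by
                    rw [← Real.exp_add]; ring_nf
                _ ≤ h ω * _ := mul_le_mul_of_nonneg_left hX' (Real.exp_pos _).le
                _ = _ := by ring
          _ = ∫ ω, (Real.cosh (s * c) * h ω
                - Real.sinh (s * c) / c * (h ω * (P[X n|ℱ n]) ω)) ∂P := by
              rw [integral_sub (hhI.const_mul _) (hhXI.const_mul _),
                integral_sub (hhI.const_mul _) (hhEI.const_mul _),
                integral_const_mul _ (fun ω => h ω * X n ω), hpull,
                integral_const_mul _ (fun ω => h ω * (P[X n|ℱ n]) ω)]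
          _ ≤ ∫ ω, Real.exp (s * S ω) * Real.exp ((s * c) ^ 2 / 2) ∂P := by
              refine integral_mono_ae ((hhI.const_mul _).sub (hhEI.const_mul _))
                (hSI.mul_const _) ?_
              filter_upwards [hEb] with ω hω
              have hE := exp_mul_cosh_sub_sinh_le (a := s * (P[X n|ℱ n]) ω) (c := s * c)
                (r := (P[X n|ℱ n]) ω / c)
                (by rw [abs_div, abs_of_pos hc]; exact (div_le_one hc).2 hω)
                (by field_simp)
              calc Real.cosh (s * c) * h ω - Real.sinh (s * c) / c * (h ω * (P[X n|ℱ n]) ω)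
                  = Real.exp (s * S ω) * (Real.exp (s * (P[X n|ℱ n]) ω) *
                    (Real.cosh (s * c) - (P[X n|ℱ n]) ω / c * Real.sinh (s * c))) := by
                    simp only [h, Real.exp_add]; ring
                _ ≤ _ := by gcongr
          _ ≤ _ := by
              rw [integral_mul_const]
              refine (mul_le_mul_of_nonneg_right ihI (Real.exp_pos _).le).trans_eq ?_
              rw [← Real.exp_add]
              push_cast
              ring_nf
  obtain ⟨h1, h2, h3⟩ := key T le_rfl
  refine ⟨?_, h3⟩
  refine Integrable.of_bound (C := Real.exp (|s| * (T * (2 * c))))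
    (Real.continuous_exp.comp_stronglyMeasurable
      ((h1.mono (ℱ.le T)).const_mul s)).aestronglyMeasurable ?_
  filter_upwards [h2] with ω h
  rw [Real.norm_eq_abs, abs_of_pos (Real.exp_pos _)]
  refine Real.exp_le_exp.2 ((le_abs_self _).trans ?_)
  rw [abs_mul]
  gcongr

theorem measure_lt_sum_condExp_sub_le
    {Ω : Type*} {m0 : MeasurableSpace Ω} {P : Measure Ω} [IsProbabilityMeasure P]
    {ℱ : Filtration ℕ m0} {X : ℕ → Ω → ℝ} {T : ℕ} {c L : ℝ} (hT : 0 < T) (hc : 0 < c)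
    (hL : 0 ≤ L)
    (hX : ∀ t < T, StronglyMeasurable[ℱ (t + 1)] (X t))
    (hb : ∀ t < T, ∀ᵐ ω ∂P, |X t ω| ≤ c) :
    P {ω | c * Real.sqrt (2 * T * L) < ∑ t ∈ Finset.range T, ((P[X t|ℱ t]) ω - X t ω)}
      ≤ ENNReal.ofReal (Real.exp (-L)) := by
  have hT' : (0 : ℝ) < T := by exact_mod_cast hT
  set ε := c * Real.sqrt (2 * T * L) with hε
  have hε2 : ε ^ 2 = c ^ 2 * (2 * T * L) := by
    rw [hε, mul_pow, Real.sq_sqrt (by positivity)]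
  have hε0 : 0 ≤ ε := by positivity
  obtain ⟨hI, hle⟩ := integral_exp_sum_condExp_sub_le (P := P) (ℱ := ℱ) (T := T)
    (ε / (T * c ^ 2)) hc hX hb
  have hch := ProbabilityTheory.measure_ge_le_exp_mul_mgf (μ := P) ε
    (div_nonneg hε0 (by positivity : 0 ≤ T * c ^ 2)) hI
  rw [← ENNReal.ofReal_toReal (measure_ne_top P _)]
  refine ENNReal.ofReal_le_ofReal ?_
  have hmono : P.real {ω | ε < ∑ t ∈ Finset.range T, ((P[X t|ℱ t]) ω - X t ω)} ≤
      P.real {ω | ε ≤ ∑ t ∈ Finset.range T, ((P[X t|ℱ t]) ω - X t ω)} :=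
    measureReal_mono (Set.ofPred_subset_ofPred.2 fun _ hω => hω.le)
  refine hmono.trans (hch.trans ?_)
  refine (mul_le_mul_of_nonneg_left hle (Real.exp_pos _).le).trans_eq ?_
  rw [← Real.exp_add]
  congr 1
  have : -(ε / (T * c ^ 2)) * ε + T * ((ε / (T * c ^ 2) * c) ^ 2 / 2)
      = - ε ^ 2 / (2 * T * c ^ 2) := by field_simp; ring
  rw [this, hε2]
  field_simp

/-- A distance-minimizing point of a convex set is at least as close to every point of the set
as the point being projected. -/
theorem norm_sub_le_of_forall_norm_sub_le {E : Type*} [NormedAddCommGroup E]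
    [InnerProductSpace ℝ E] {K : Set E} (hK : Convex ℝ K) {p x y : E} (hp : p ∈ K)
    (hmin : ∀ z ∈ K, ‖p - x‖ ≤ ‖z - x‖) (hy : y ∈ K) : ‖p - y‖ ≤ ‖x - y‖ := by
  have hinf : ‖x - p‖ = ⨅ w : K, ‖x - w‖ := by
    have : Nonempty K := ⟨⟨p, hp⟩⟩
    refine le_antisymm (le_ciInf fun w => ?_)
      (ciInf_le (f := fun w : K => ‖x - w‖)
        ⟨0, by rintro _ ⟨w, rfl⟩; exact norm_nonneg _⟩ ⟨p, hp⟩)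
    rw [norm_sub_rev x p, norm_sub_rev x w]
    exact hmin w w.2
  have hin := (norm_eq_iInf_iff_real_inner_le_zero hK hp).1 hinf y hy
  have h := norm_add_sq_real (x - p) (p - y)
  rw [sub_add_sub_cancel, ← neg_sub y p, inner_neg_right, norm_neg, norm_sub_rev y p] at h
  refine le_of_sq_le_sq ?_ (norm_nonneg _)
  nlinarith [sq_nonneg ‖x - p‖]

/-- The retraction of a real normed space onto the closed ball of radius `R`, rescaling the
points outside of the ball. -/
noncomputable def ballRetraction {E : Type*} [NormedAddCommGroup E] [NormedSpace ℝ E]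
    (R : ℝ) (x : E) : E := (R / max R ‖x‖) • x

theorem continuous_ballRetraction {E : Type*} [NormedAddCommGroup E] [NormedSpace ℝ E]
    {R : ℝ} (hR : 0 < R) : Continuous (ballRetraction R : E → E) := by
  unfold ballRetraction
  have : ∀ x : E, max R ‖x‖ ≠ 0 := fun x => (lt_max_of_lt_left hR).ne'
  fun_prop (disch := assumption)

theorem norm_ballRetraction_le {E : Type*} [NormedAddCommGroup E] [NormedSpace ℝ E]
    {R : ℝ} (hR : 0 < R) (x : E) : ‖ballRetraction R x‖ ≤ R := by
  have h : 0 < max R ‖x‖ := lt_max_of_lt_left hR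
  rw [ballRetraction, norm_smul, Real.norm_eq_abs, abs_of_pos (by positivity),
    div_mul_eq_mul_div, div_le_iff₀ h]
  gcongr
  exact le_max_right _ _

theorem norm_ballRetraction_sub_le {E : Type*} [NormedAddCommGroup E] [InnerProductSpace ℝ E]
    {R : ℝ} (hR : 0 < R) (x : E) {y : E} (hy : ‖y‖ ≤ R) :
    ‖ballRetraction R x - y‖ ≤ ‖x - y‖ := by
  rcases le_total ‖x‖ R with hx | hx
  · simp [ballRetraction, max_eq_left hx, hR.ne']
  · have hx0 : 0 < ‖x‖ := hR.trans_le hx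
    refine le_of_sq_le_sq ?_ (norm_nonneg _)
    rw [ballRetraction, max_eq_right hx, norm_sub_sq_real, norm_sub_sq_real, norm_smul,
      Real.norm_eq_abs, abs_of_pos (by positivity), div_mul_cancel₀ _ hx0.ne', real_inner_smul_left]
    have hin : inner ℝ x y ≤ ‖x‖ * R :=
      (real_inner_le_norm x y).trans (by gcongr)
    have h1 : 0 ≤ 1 - R / ‖x‖ := sub_nonneg.2 ((div_le_one hx0).2 hx)
    have h2 := mul_le_mul_of_nonneg_left hin h1
    have h3 : (1 - R / ‖x‖) * (‖x‖ * R) = ‖x‖ * R - R ^ 2 := by field_simp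
    nlinarith [sq_nonneg (‖x‖ - R)]

/-- The regret bound of projected online gradient descent. -/
theorem sum_inner_sub_le {E : Type*} [NormedAddCommGroup E] [InnerProductSpace ℝ E]
    {x g : ℕ → E} {y : E} {η G : ℝ} {T : ℕ} (hη : 0 < η) (hx0 : x 0 = 0)
    (hstep : ∀ t < T, ‖x (t + 1) - y‖ ≤ ‖x t - η • g t - y‖) (hg : ∀ t < T, ‖g t‖ ≤ G) :
    ∑ t ∈ Finset.range T, inner ℝ (g t) (x t - y) ≤ ‖y‖ ^ 2 / (2 * η) + η * T * G ^ 2 / 2 := by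
  have key : ∀ n ≤ T, ∑ t ∈ Finset.range n, inner ℝ (g t) (x t - y)
      ≤ (‖y‖ ^ 2 - ‖x n - y‖ ^ 2) / (2 * η) + η * n * G ^ 2 / 2 := by
    intro n
    induction n with
    | zero => simp [hx0]
    | succ n ih =>
      intro hn
      rw [Finset.sum_range_succ]
      have h1 := pow_le_pow_left₀ (norm_nonneg _) (hstep n (by omega)) 2
      rw [sub_right_comm, norm_sub_sq_real (x n - y), norm_smul, real_inner_smul_right, Real.norm_eq_abs,
        abs_of_pos hη, real_inner_comm, mul_pow] at h1
      have h2 := pow_le_pow_left₀ (norm_nonneg _) (hg n (by omega)) 2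
      have h3 : inner ℝ (g n) (x n - y)
          ≤ (‖x n - y‖ ^ 2 - ‖x (n + 1) - y‖ ^ 2) / (2 * η) + η * G ^ 2 / 2 := by
        rw [div_add_div _ _ (by positivity) two_ne_zero, le_div_iff₀ (by positivity)]
        nlinarith [mul_le_mul_of_nonneg_left h2 (sq_nonneg η)]
      calc _ ≤ _ := add_le_add (ih (by omega)) h3
        _ = _ := by push_cast; ring
  refine (key T le_rfl).trans ?_
  gcongr
  nlinarith [sq_nonneg ‖x T - y‖]

/-- The regret bound of the multiplicative weights algorithm. -/
theorem sum_sub_sum_mul_le_log_card {κ : Type*} [Fintype κ] [Nonempty κ] {w a : ℕ → κ → ℝ}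
    {b : ℕ → ℝ} {T : ℕ} (hw0 : ∀ i, w 0 i = 1 / Fintype.card κ)
    (hw : ∀ t < T, ∀ i, w (t + 1) i
      = w t i * Real.exp (a t i) / ∑ k, w t k * Real.exp (a t k))
    (ha : ∀ t < T, ∀ k, |a t k| ≤ b t) (i : κ) :
    ∑ t ∈ Finset.range T, (a t i - ∑ k, w t k * a t k)
      ≤ Real.log (Fintype.card κ) + ∑ t ∈ Finset.range T, b t ^ 2 / 2 := by
  have hcard : (0 : ℝ) < Fintype.card κ := by exact_mod_cast Fintype.card_pos
  have key : ∀ n ≤ T, ((∀ k, 0 < w n k) ∧ ∑ k, w n k = 1) ∧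
      ∑ t ∈ Finset.range n, (a t i - ∑ k, w t k * a t k)
        ≤ Real.log (Fintype.card κ) + Real.log (w n i) + ∑ t ∈ Finset.range n, b t ^ 2 / 2 := by
    intro n
    induction n with
    | zero =>
      intro _
      refine ⟨⟨fun k => by rw [hw0]; positivity, ?_⟩, ?_⟩
      · simp [hw0, hcard.ne']
      · simp [hw0]
    | succ n ih =>
      intro hn
      obtain ⟨⟨hpos, hsum⟩, hreg⟩ := ih (by omega)
      have hZ : 0 < ∑ k, w n k * Real.exp (a n k) :=
        Finset.sum_pos (fun k _ => mul_pos (hpos k) (Real.exp_pos _)) Finset.univ_nonempty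
      refine ⟨⟨fun k => ?_, ?_⟩, ?_⟩
      · rw [hw n (by omega)]
        exact div_pos (mul_pos (hpos k) (Real.exp_pos _)) hZ
      · simp_rw [hw n (by omega : n < T)]
        rw [← Finset.sum_div, div_self hZ.ne']
      · have hlog : Real.log (∑ k, w n k * Real.exp (a n k))
            ≤ ∑ k, w n k * a n k + b n ^ 2 / 2 := by
          rw [Real.log_le_iff_le_exp hZ]
          exact sum_mul_exp_le_of_abs_le ⟨fun k => (hpos k).le, hsum⟩ (ha n (by omega))
        rw [Finset.sum_range_succ, Finset.sum_range_succ, hw n (by omega),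
          Real.log_div (mul_pos (hpos i) (Real.exp_pos _)).ne' hZ.ne',
          Real.log_mul (hpos i).ne' (Real.exp_pos _).ne', Real.log_exp]
        linarith
  obtain ⟨⟨hpos, hsum⟩, hreg⟩ := key T le_rfl
  have hle : w T i ≤ 1 := hsum ▸ Finset.single_le_sum (fun k _ => (hpos k).le) (Finset.mem_univ i)
  linarith [Real.log_nonpos (hpos i).le hle]

/-- The swap-regret bound of the matrix multiplicative weights algorithm that plays a stationary
distribution `l t` of the left-stochastic matrix `M t`. -/
theorem sum_swap_sub_le {κ : Type*} [Fintype κ] [Nonempty κ] {M : ℕ → κ → κ → ℝ}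
    {l D : ℕ → κ → ℝ} {η B : ℝ} {T : ℕ} (hη : 0 < η)
    (hM0 : ∀ i j, M 0 i j = 1 / Fintype.card κ)
    (hM : ∀ t < T, ∀ i j, M (t + 1) i j = M t i j * Real.exp (η * (D t i * l t j))
      / ∑ k, M t k j * Real.exp (η * (D t k * l t j)))
    (hl : ∀ t < T, l t ∈ stdSimplex ℝ κ ∧ ∀ i, ∑ j, M t i j * l t j = l t i)
    (hD : ∀ t < T, ∀ i, |D t i| ≤ B) (φ : κ → κ) :
    ∑ t ∈ Finset.range T, ∑ j, (D t (φ j) - D t j) * l t j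
      ≤ Fintype.card κ * Real.log (Fintype.card κ) / η + η * T * B ^ 2 / 2 := by
  have hcol : ∀ j, ∑ t ∈ Finset.range T,
      (η * (D t (φ j) * l t j) - ∑ k, M t k j * (η * (D t k * l t j)))
      ≤ Real.log (Fintype.card κ) + ∑ t ∈ Finset.range T, (η * B * l t j) ^ 2 / 2 := fun j =>
    sum_sub_sum_mul_le_log_card (w := fun t i => M t i j)
      (a := fun t i => η * (D t i * l t j)) (b := fun t => η * B * l t j)
      (fun i => hM0 i j) (fun t ht i => hM t ht i j) (fun t ht k => by
        have := (hl t ht).1.1 j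
        rw [abs_mul, abs_mul, abs_of_pos hη, abs_of_nonneg this, mul_assoc]
        gcongr
        exact hD t ht k) (φ j)
  have hsum := Finset.sum_le_sum fun j (_ : j ∈ Finset.univ) => hcol j
  rw [Finset.sum_comm, Finset.sum_add_distrib, Finset.sum_comm (s := Finset.univ)] at hsum
  have hlhs : ∑ t ∈ Finset.range T, ∑ j,
      (η * (D t (φ j) * l t j) - ∑ k, M t k j * (η * (D t k * l t j)))
      = η * ∑ t ∈ Finset.range T, ∑ j, (D t (φ j) - D t j) * l t j := by
    rw [Finset.mul_sum]
    refine Finset.sum_congr rfl fun t ht => ?_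
    have hst : ∑ j, ∑ k, M t k j * (η * (D t k * l t j)) = ∑ j, η * (D t j * l t j) := by
      rw [Finset.sum_comm]
      refine Finset.sum_congr rfl fun k _ => ?_
      rw [← (hl t (Finset.mem_range.1 ht)).2 k, Finset.mul_sum, Finset.mul_sum]
      exact Finset.sum_congr rfl fun j _ => by ring
    rw [Finset.sum_sub_distrib, hst, ← Finset.sum_sub_distrib, Finset.mul_sum]
    exact Finset.sum_congr rfl fun j _ => by ring
  have hrhs : ∑ t ∈ Finset.range T, ∑ j, (η * B * l t j) ^ 2 / 2
      ≤ ∑ t ∈ Finset.range T, (η * B) ^ 2 / 2 := by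
    refine Finset.sum_le_sum fun t ht => ?_
    obtain ⟨hl0, hl1⟩ := (hl t (Finset.mem_range.1 ht)).1
    calc ∑ j, (η * B * l t j) ^ 2 / 2 ≤ ∑ j, (η * B) ^ 2 / 2 * l t j := by
          refine Finset.sum_le_sum fun j _ => ?_
          have : l t j ≤ 1 :=
            hl1 ▸ Finset.single_le_sum (fun k _ => hl0 k) (Finset.mem_univ j)
          have h2 : l t j ^ 2 ≤ l t j := by nlinarith [hl0 j]
          calc _ = (η * B) ^ 2 / 2 * l t j ^ 2 := by ring
            _ ≤ _ := by gcongr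
      _ = _ := by rw [← Finset.mul_sum, hl1, mul_one]
  rw [hlhs] at hsum
  simp only [Finset.sum_const, Finset.card_univ, Finset.card_range, nsmul_eq_mul] at hsum hrhs
  rw [div_add' _ _ _ hη.ne', le_div_iff₀ hη]
  calc _ = _ := mul_comm _ _
    _ ≤ _ := hsum.trans (add_le_add_right hrhs _)
    _ = _ := by ring

/-- Uniform concentration of the compensated gradients `𝔼[G t | ℱ t] - G t` along the directions
`x t - y`, over all points `y` of a ball. -/
theorem measure_exists_lt_sum_inner_condExp_sub_le
    {Ω : Type*} {m0 : MeasurableSpace Ω} {P : Measure Ω} [IsProbabilityMeasure P]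
    {ℱ : Filtration ℕ m0} {E : Type*} [NormedAddCommGroup E] [InnerProductSpace ℝ E]
    [CompleteSpace E] {G x : ℕ → Ω → E} {T : ℕ} {R B η L : ℝ}
    (hT : 0 < T) (hR : 0 < R) (hB : 0 < B) (hη : 0 < η) (hL : 0 ≤ L)
    (hG : ∀ t, StronglyMeasurable[ℱ (t + 1)] (G t))
    (hGB : ∀ t < T, ∀ᵐ ω ∂P, ‖G t ω‖ ≤ B)
    (hx : ∀ t, StronglyMeasurable[ℱ t] (x t))
    (hxR : ∀ t < T, ∀ ω, ‖x t ω‖ ≤ R) :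
    P {ω | ∃ y : E, ‖y‖ ≤ R ∧
        R ^ 2 / (2 * η) + η * T * (2 * B) ^ 2 / 2 + 2 * R * B * Real.sqrt (2 * T * L)
          < ∑ t ∈ Finset.range T, inner ℝ ((P[G t|ℱ t]) ω - G t ω) (x t ω - y)}
      ≤ ENNReal.ofReal (Real.exp (-L)) := by
  let w : ℕ → Ω → E := fun t ω => Nat.rec 0
    (fun t z => ballRetraction R (z - η • ((P[G t|ℱ t]) ω - G t ω))) t
  have hw0 : ∀ ω, w 0 ω = 0 := fun ω => rfl
  have hwS : ∀ t ω, w (t + 1) ω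
      = ballRetraction R (w t ω - η • ((P[G t|ℱ t]) ω - G t ω)) := fun t ω => rfl
  have hwm : ∀ t, StronglyMeasurable[ℱ t] (w t) := by
    intro t
    induction t with
    | zero => exact stronglyMeasurable_const
    | succ t ih =>
      refine (continuous_ballRetraction hR).comp_stronglyMeasurable ?_
      exact (ih.mono (ℱ.mono t.le_succ)).sub
        (((stronglyMeasurable_condExp.mono (ℱ.mono t.le_succ)).sub (hG t)).const_smul η)
  have hwR : ∀ t ω, ‖w t ω‖ ≤ R := by
    intro t ω
    cases t with
    | zero => simpa [hw0] using hR.le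
    | succ t => exact norm_ballRetraction_le hR _
  have hxw : ∀ t < T, ∀ ω, ‖x t ω - w t ω‖ ≤ 2 * R := fun t ht ω => by
    linarith [norm_sub_le (x t ω) (w t ω), hxR t ht ω, hwR t ω]
  have hXm : ∀ t < T,
      StronglyMeasurable[ℱ (t + 1)] (fun ω => inner ℝ (x t ω - w t ω) (G t ω)) := fun t _ =>
    (((hx t).sub (hwm t)).mono (ℱ.mono t.le_succ)).inner (hG t)
  have hXb : ∀ t < T, ∀ᵐ ω ∂P, |inner ℝ (x t ω - w t ω) (G t ω)| ≤ 2 * R * B := fun t ht => by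
    filter_upwards [hGB t ht] with ω hω
    exact (abs_real_inner_le_norm _ _).trans
      (mul_le_mul (hxw t ht ω) hω (norm_nonneg _) (by positivity))
  have hpull : ∀ t < T, (P[fun ω => inner ℝ (x t ω - w t ω) (G t ω)|ℱ t])
      =ᵐ[P] fun ω => inner ℝ (x t ω - w t ω) ((P[G t|ℱ t]) ω) := fun t ht =>
    condExp_stronglyMeasurable_bilin_of_bound (innerSL ℝ) (ℱ.le t) ((hx t).sub (hwm t))
      (Integrable.of_bound ((hG t).mono (ℱ.le _)).aestronglyMeasurable B (hGB t ht)) (2 * R)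
      (Filter.Eventually.of_forall (hxw t ht))
  refine le_trans (measure_mono_ae ?_)
    (measure_lt_sum_condExp_sub_le hT (by positivity : 0 < 2 * R * B) hL hXm hXb)
  have hall : ∀ᵐ ω ∂P, ∀ t < T, ‖G t ω‖ ≤ B ∧ ‖(P[G t|ℱ t]) ω‖ ≤ B ∧
      (P[fun ω => inner ℝ (x t ω - w t ω) (G t ω)|ℱ t]) ω
        = inner ℝ (x t ω - w t ω) ((P[G t|ℱ t]) ω) := by
    refine ae_all_iff.2 fun t => ?_
    by_cases ht : t < T
    · filter_upwards [hGB t ht, ae_bdd_norm_condExp_of_ae_bdd_norm (m := ℱ t) (hGB t ht),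
        hpull t ht] with ω h1 h2 h3 _
      exact ⟨h1, h2, h3⟩
    · exact Filter.Eventually.of_forall fun ω h => absurd h ht
  filter_upwards [hall] with ω hω
  rintro ⟨y, hy, hlt⟩
  have hreg := sum_inner_sub_le (x := fun t => w t ω)
    (g := fun t => (P[G t|ℱ t]) ω - G t ω) (y := y) (G := 2 * B) (T := T) hη (hw0 ω)
    (fun t _ => by
      simp only [hwS]
      exact norm_ballRetraction_sub_le hR _ hy)
    (fun t ht => by
      linarith [norm_sub_le ((P[G t|ℱ t]) ω) (G t ω), (hω t ht).1, (hω t ht).2.1])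
  have hy2 : ‖y‖ ^ 2 / (2 * η) ≤ R ^ 2 / (2 * η) := by gcongr
  have hsplit : ∑ t ∈ Finset.range T, inner ℝ ((P[G t|ℱ t]) ω - G t ω) (x t ω - y)
      = ∑ t ∈ Finset.range T, inner ℝ ((P[G t|ℱ t]) ω - G t ω) (w t ω - y)
        + ∑ t ∈ Finset.range T, ((P[fun ω => inner ℝ (x t ω - w t ω) (G t ω)|ℱ t]) ω
          - inner ℝ (x t ω - w t ω) (G t ω)) := by
    rw [← Finset.sum_add_distrib]
    refine Finset.sum_congr rfl fun t ht => ?_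
    rw [(hω t (Finset.mem_range.1 ht)).2.2, ← inner_sub_right,
      real_inner_comm _ (x t ω - w t ω), ← inner_add_right, add_comm, sub_add_sub_cancel]
  rw [hsplit] at hlt
  show _ < _
  linarith

/-- High-probability regret bound for projected stochastic subgradient descent on a sequence of
functions `f t`. -/
theorem measure_exists_lt_sum_sub_le_of_projected_subgradient
    {Ω : Type*} {m0 : MeasurableSpace Ω} {P : Measure Ω} [IsProbabilityMeasure P]
    {ℱ : Filtration ℕ m0} {E : Type*} [NormedAddCommGroup E] [InnerProductSpace ℝ E]
    [CompleteSpace E] {K : Set E} {G x : ℕ → Ω → E} {f : ℕ → Ω → E → ℝ} {T : ℕ} {R B η L : ℝ}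
    (hK : Convex ℝ K) (hK0 : 0 ∈ K) (hKR : ∀ y ∈ K, ‖y‖ ≤ R)
    (hT : 0 < T) (hη : η = R / (B * Real.sqrt (2 * T))) (hL : 0 ≤ L)
    (hG : ∀ t, StronglyMeasurable[ℱ (t + 1)] (G t))
    (hGB : ∀ t < T, ∀ᵐ ω ∂P, ‖G t ω‖ ≤ B)
    (hx : ∀ t, StronglyMeasurable[ℱ t] (x t)) (hx0 : ∀ ω, x 0 ω = 0)
    (hstep : ∀ t < T, ∀ ω, x (t + 1) ω ∈ K ∧
      ∀ y ∈ K, ‖x (t + 1) ω - (x t ω - η • G t ω)‖ ≤ ‖y - (x t ω - η • G t ω)‖)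
    (hf : ∀ t < T, ∀ᵐ ω ∂P, ∀ y ∈ K,
      f t ω (x t ω) + inner ℝ ((P[G t|ℱ t]) ω) (y - x t ω) ≤ f t ω y) :
    P {ω | ∃ y ∈ K, R * B * (9 / 4 * Real.sqrt (2 * T) + 2 * Real.sqrt (2 * T * L))
          < ∑ t ∈ Finset.range T, (f t ω (x t ω) - f t ω y)}
      ≤ ENNReal.ofReal (Real.exp (-L)) := by
  have hR0 : 0 ≤ R := (norm_nonneg _).trans (hKR 0 hK0)
  have hB0 : 0 ≤ B := by
    obtain ⟨ω, hω⟩ := (hGB 0 hT).exists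
    exact (norm_nonneg _).trans hω
  have hxK : ∀ t < T, ∀ ω, x t ω ∈ K := by
    intro t ht ω
    cases t with
    | zero => rw [hx0]; exact hK0
    | succ t => exact (hstep t (by omega) ω).1
  have hall : ∀ᵐ ω ∂P, ∀ t < T, ‖G t ω‖ ≤ B ∧ ‖(P[G t|ℱ t]) ω‖ ≤ B ∧
      ∀ y ∈ K, f t ω (x t ω) + inner ℝ ((P[G t|ℱ t]) ω) (y - x t ω) ≤ f t ω y := by
    refine ae_all_iff.2 fun t => ?_
    by_cases ht : t < T
    · filter_upwards [hGB t ht, ae_bdd_norm_condExp_of_ae_bdd_norm (m := ℱ t) (hGB t ht),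
        hf t ht] with ω h1 h2 h3 _
      exact ⟨h1, h2, h3⟩
    · exact Filter.Eventually.of_forall fun ω h => absurd h ht
  rcases (mul_nonneg hR0 hB0).eq_or_lt with hRB | hRB
  · refine le_of_eq_of_le (measure_eq_zero_iff_ae_notMem.2 ?_) zero_le
    filter_upwards [hall] with ω hω
    rintro ⟨y, hy, hlt⟩
    rw [← hRB, zero_mul] at hlt
    refine absurd hlt (not_lt.2 (Finset.sum_nonpos fun t ht => ?_))
    have ht' := Finset.mem_range.1 ht
    obtain ⟨-, h2, h3⟩ := hω t ht'
    have h4 : ‖y - x t ω‖ ≤ 2 * R := by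
      linarith [norm_sub_le y (x t ω), hKR y hy, hKR _ (hxK t ht' ω)]
    have h5 := neg_le_of_abs_le ((abs_real_inner_le_norm ((P[G t|ℱ t]) ω) (y - x t ω)).trans
      (mul_le_mul h2 h4 (norm_nonneg _) hB0))
    nlinarith [h3 y hy]
  · have hR : 0 < R := pos_of_mul_pos_left hRB hB0
    have hB : 0 < B := pos_of_mul_pos_right hRB hR0
    have hT' : (0 : ℝ) < T := by exact_mod_cast hT
    have hη0 : 0 < η := by rw [hη]; positivity
    refine le_trans (measure_mono_ae ?_) (measure_exists_lt_sum_inner_condExp_sub_le hT hR hB hη0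
      hL hG hGB hx fun t ht ω => hKR _ (hxK t ht ω))
    filter_upwards [hall] with ω hω
    rintro ⟨y, hy, hlt⟩
    refine ⟨y, hKR y hy, ?_⟩
    have hreg := sum_inner_sub_le (x := fun t => x t ω) (g := fun t => G t ω) (y := y) (G := B)
      (T := T) hη0 (hx0 ω)
      (fun t ht => norm_sub_le_of_forall_norm_sub_le hK (hstep t ht ω).1 (hstep t ht ω).2 hy)
      (fun t ht => (hω t ht).1)
    have hy2 : ‖y‖ ^ 2 / (2 * η) ≤ R ^ 2 / (2 * η) := by
      gcongr
      exact hKR y hy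
    have hsum : ∑ t ∈ Finset.range T, (f t ω (x t ω) - f t ω y)
        ≤ ∑ t ∈ Finset.range T, inner ℝ (G t ω) (x t ω - y)
          + ∑ t ∈ Finset.range T, inner ℝ ((P[G t|ℱ t]) ω - G t ω) (x t ω - y) := by
      rw [← Finset.sum_add_distrib]
      refine Finset.sum_le_sum fun t ht => ?_
      rw [← inner_add_left, add_sub_cancel, ← neg_sub y, inner_neg_right]
      linarith [(hω t (Finset.mem_range.1 ht)).2.2 y hy]
    have hrT : Real.sqrt (2 * T) ^ 2 = 2 * T := Real.sq_sqrt (by positivity)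
    have hr : 0 < Real.sqrt (2 * T) := by positivity
    have h1 : R ^ 2 / (2 * η) = R * B * (Real.sqrt (2 * T) / 2) := by
      rw [hη]; field_simp
    have h2 : η * T = R / B * (Real.sqrt (2 * T) / 2) := by
      rw [hη]; field_simp; linarith
    have h3 : η * T * B ^ 2 / 2 = R * B * (Real.sqrt (2 * T) / 4) := by
      rw [h2]; field_simp; ring
    have h4 : η * T * (2 * B) ^ 2 / 2 = R * B * Real.sqrt (2 * T) := by
      rw [h2]; field_simp
    rw [h4, h1]
    rw [h1] at hy2
    rw [h3] at hreg
    linarith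

/-- High-probability swap-regret bound for the stochastic matrix multiplicative weights
algorithm. -/
theorem measure_exists_lt_sum_swap_condExp_sub_le
    {Ω : Type*} {m0 : MeasurableSpace Ω} {P : Measure Ω} [IsProbabilityMeasure P]
    {ℱ : Filtration ℕ m0} {κ : Type*} [Fintype κ] [Nonempty κ]
    {M : ℕ → Ω → κ → κ → ℝ} {l D : ℕ → Ω → κ → ℝ} {T : ℕ} {η B L : ℝ}
    (hT : 0 < T) (hL : 0 ≤ L)
    (hη : η = Real.sqrt (Fintype.card κ * Real.log (Fintype.card κ) / (T * B ^ 2)))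
    (hlm : ∀ t, Measurable[ℱ t] (l t)) (hDm : ∀ t, Measurable[ℱ (t + 1)] (D t))
    (hM0 : ∀ ω i j, M 0 ω i j = 1 / Fintype.card κ)
    (hM : ∀ t < T, ∀ ω i j, M (t + 1) ω i j = M t ω i j * Real.exp (η * (D t ω i * l t ω j))
      / ∑ k, M t ω k j * Real.exp (η * (D t ω k * l t ω j)))
    (hl : ∀ t < T, ∀ ω, l t ω ∈ stdSimplex ℝ κ ∧ ∀ i, ∑ j, M t ω i j * l t ω j = l t ω i)
    (hD : ∀ t < T, ∀ᵐ ω ∂P, ∀ i, |D t ω i| ≤ B) :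
    P {ω | ∃ φ : κ → κ,
        B * (3 / 2 * Real.sqrt (Fintype.card κ * Real.log (Fintype.card κ) * T)
          + 2 * Real.sqrt (2 * T * (L + Fintype.card κ * Real.log (Fintype.card κ))))
        < ∑ t ∈ Finset.range T, ∑ j, ((P[fun ω' => D t ω' (φ j)|ℱ t]) ω
            - (P[fun ω' => D t ω' j|ℱ t]) ω) * l t ω j}
      ≤ ENNReal.ofReal (Real.exp (-L)) := by
  classical
  set a : ℝ := Fintype.card κ * Real.log (Fintype.card κ) with ha
  have hT' : (0 : ℝ) < T := by exact_mod_cast hT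
  have hB0 : 0 ≤ B := by
    obtain ⟨ω, hω⟩ := (hD 0 hT).exists
    exact (abs_nonneg _).trans (hω (Classical.arbitrary κ))
  have hDi : ∀ t i, StronglyMeasurable[ℱ (t + 1)] (fun ω => D t ω i) := fun t i =>
    ((measurable_pi_apply i).comp (hDm t)).stronglyMeasurable
  have hlj : ∀ t j, StronglyMeasurable[ℱ t] (fun ω => l t ω j) := fun t j =>
    ((measurable_pi_apply j).comp (hlm t)).stronglyMeasurable
  have hDint : ∀ t < T, ∀ i, Integrable (fun ω => D t ω i) P := fun t ht i =>
    Integrable.of_bound ((hDi t i).mono (ℱ.le _)).aestronglyMeasurable B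
      ((hD t ht).mono fun ω hω => hω i)
  have hEb : ∀ t < T, ∀ᵐ ω ∂P, ∀ i, |(P[fun ω' => D t ω' i|ℱ t]) ω| ≤ B := fun t ht =>
    ae_all_iff.2 fun i => ae_bdd_abs_condExp_of_ae_bdd_abs ((hD t ht).mono fun ω hω => hω i)
  have hall : ∀ᵐ ω ∂P, ∀ t < T, (∀ i, |D t ω i| ≤ B) ∧
      ∀ i, |(P[fun ω' => D t ω' i|ℱ t]) ω| ≤ B := by
    refine ae_all_iff.2 fun t => ?_
    by_cases ht : t < T
    · filter_upwards [hD t ht, hEb t ht] with ω h1 h2 _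
      exact ⟨h1, h2⟩
    · exact Filter.Eventually.of_forall fun ω h => absurd h ht
  have hcard : (1 : ℝ) ≤ Fintype.card κ := by exact_mod_cast Fintype.card_pos
  have ha0 : 0 ≤ a := mul_nonneg (by positivity) (Real.log_nonneg hcard)
  by_cases hdeg : B = 0 ∨ Subsingleton κ
  · refine le_of_eq_of_le (measure_eq_zero_iff_ae_notMem.2 ?_) zero_le
    filter_upwards [hall] with ω hω
    rintro ⟨φ, hlt⟩
    refine absurd hlt (not_lt.2 (le_trans (Finset.sum_nonpos fun t ht => ?_) (by positivity)))
    refine (Finset.sum_eq_zero fun j _ => ?_).le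
    rcases hdeg with h | h
    · have h2 := fun i => abs_nonpos_iff.1 (((hω t (Finset.mem_range.1 ht)).2 i).trans_eq h)
      rw [h2, h2, sub_zero, zero_mul]
    · rw [Subsingleton.elim (φ j) j, sub_self, zero_mul]
  · rw [not_or, not_subsingleton_iff_nontrivial] at hdeg
    have hB : 0 < B := lt_of_le_of_ne hB0 (Ne.symm hdeg.1)
    have := hdeg.2
    have hcard' : (1 : ℝ) < Fintype.card κ := by exact_mod_cast Fintype.one_lt_card
    have ha1 : 0 < a := mul_pos (by positivity) (Real.log_pos hcard')
    have hη0 : 0 < η := by rw [hη]; positivity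
    let X : (κ → κ) → ℕ → Ω → ℝ := fun φ t ω => ∑ j, l t ω j * (D t ω (φ j) - D t ω j)
    have hXm : ∀ φ, ∀ t < T, StronglyMeasurable[ℱ (t + 1)] (X φ t) := fun φ t _ =>
      Finset.stronglyMeasurable_fun_sum _ fun j _ =>
        ((hlj t j).mono (ℱ.mono t.le_succ)).mul ((hDi t (φ j)).sub (hDi t j))
    have hXb : ∀ φ, ∀ t < T, ∀ᵐ ω ∂P, |X φ t ω| ≤ 2 * B := fun φ t ht => by
      filter_upwards [hD t ht] with ω hω
      obtain ⟨hl0, hl1⟩ := (hl t ht ω).1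
      calc |X φ t ω| ≤ ∑ j, |l t ω j * (D t ω (φ j) - D t ω j)| :=
            Finset.abs_sum_le_sum_abs _ _
        _ ≤ ∑ j, l t ω j * (2 * B) := by
            refine Finset.sum_le_sum fun j _ => ?_
            rw [abs_mul, abs_of_nonneg (hl0 j)]
            refine mul_le_mul_of_nonneg_left ?_ (hl0 j)
            linarith [abs_sub (D t ω (φ j)) (D t ω j), hω (φ j), hω j]
        _ = 2 * B := by rw [← Finset.sum_mul, hl1, one_mul]
    have hpull : ∀ φ, ∀ t < T, (P[X φ t|ℱ t]) =ᵐ[P] fun ω => ∑ j, l t ω j *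
        ((P[fun ω' => D t ω' (φ j)|ℱ t]) ω - (P[fun ω' => D t ω' j|ℱ t]) ω) := fun φ t ht => by
      have hint : ∀ j, Integrable (fun ω => D t ω (φ j) - D t ω j) P := fun j =>
        (hDint t ht (φ j)).sub (hDint t ht j)
      have hlb : ∀ j, ∀ᵐ ω ∂P, ‖l t ω j‖ ≤ 1 := fun j => Filter.Eventually.of_forall fun ω => by
        obtain ⟨hl0, hl1⟩ := (hl t ht ω).1
        rw [Real.norm_eq_abs, abs_of_nonneg (hl0 j)]
        exact hl1 ▸ Finset.single_le_sum (fun k _ => hl0 k) (Finset.mem_univ j)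
      have hterm : ∀ᵐ ω ∂P, ∀ j, (P[fun ω' => l t ω' j * (D t ω' (φ j) - D t ω' j)|ℱ t]) ω
          = l t ω j * ((P[fun ω' => D t ω' (φ j)|ℱ t]) ω - (P[fun ω' => D t ω' j|ℱ t]) ω) :=
        ae_all_iff.2 fun j => by
          filter_upwards [condExp_stronglyMeasurable_mul_of_bound (ℱ.le t) (hlj t j) (hint j) 1
            (hlb j), condExp_sub (hDint t ht (φ j)) (hDint t ht j) (ℱ t)] with ω h1 h2
          exact h1.trans (congrArg (l t ω j * ·) h2)
      have hsum := condExp_finsetSum (μ := P) (s := Finset.univ)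
        (f := fun j ω => l t ω j * (D t ω (φ j) - D t ω j))
        (fun j _ => (hint j).bdd_mul ((hlj t j).mono (ℱ.le t)).aestronglyMeasurable (hlb j))
        (ℱ t)
      have hXeq : X φ t = ∑ j, fun ω => l t ω j * (D t ω (φ j) - D t ω j) := by
        ext ω; simp [X]
      rw [hXeq]
      filter_upwards [hsum, hterm] with ω h1 h2
      rw [h1, Finset.sum_apply]
      exact Finset.sum_congr rfl fun j _ => h2 j
    have hpull' : ∀ᵐ ω ∂P, ∀ φ, ∀ t < T, (P[X φ t|ℱ t]) ω = ∑ j, l t ω j *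
        ((P[fun ω' => D t ω' (φ j)|ℱ t]) ω - (P[fun ω' => D t ω' j|ℱ t]) ω) := by
      refine ae_all_iff.2 fun φ => ae_all_iff.2 fun t => ?_
      by_cases ht : t < T
      · exact (hpull φ t ht).mono fun ω h _ => h
      · exact Filter.Eventually.of_forall fun ω h => absurd h ht
    have hsub : {ω | ∃ φ : κ → κ, B * (3 / 2 * Real.sqrt (a * T)
          + 2 * Real.sqrt (2 * T * (L + a)))
        < ∑ t ∈ Finset.range T, ∑ j, ((P[fun ω' => D t ω' (φ j)|ℱ t]) ω
            - (P[fun ω' => D t ω' j|ℱ t]) ω) * l t ω j}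
        ≤ᵐ[P] ⋃ φ : κ → κ, {ω | 2 * B * Real.sqrt (2 * T * (L + a))
          < ∑ t ∈ Finset.range T, ((P[X φ t|ℱ t]) ω - X φ t ω)} := by
      filter_upwards [hall, hpull'] with ω hω hp
      rintro ⟨φ, hlt⟩
      refine Set.mem_iUnion.2 ⟨φ, ?_⟩
      have hreg := sum_swap_sub_le (M := fun t => M t ω) (l := fun t => l t ω)
        (D := fun t => D t ω) (B := B) (T := T) hη0 (hM0 ω) (fun t ht => hM t ht ω)
        (fun t ht => hl t ht ω) (fun t ht => (hω t ht).1) φ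
      have heq : ∑ t ∈ Finset.range T, ((P[X φ t|ℱ t]) ω - X φ t ω)
          = ∑ t ∈ Finset.range T, ∑ j, ((P[fun ω' => D t ω' (φ j)|ℱ t]) ω
            - (P[fun ω' => D t ω' j|ℱ t]) ω) * l t ω j
          - ∑ t ∈ Finset.range T, ∑ j, (D t ω (φ j) - D t ω j) * l t ω j := by
        rw [← Finset.sum_sub_distrib]
        refine Finset.sum_congr rfl fun t ht => ?_
        rw [hp φ t (Finset.mem_range.1 ht)]
        simp only [X, mul_comm (l t ω _)]
      have hηe : η = Real.sqrt (a * T) / (T * B) := by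
        rw [hη, eq_div_iff (by positivity), ← Real.sqrt_sq (by positivity : 0 ≤ T * B),
          ← Real.sqrt_mul (by positivity)]
        congr 1
        field_simp
      have hs : 0 < Real.sqrt (a * T) := by positivity
      have hs2 : Real.sqrt (a * T) ^ 2 = a * T := Real.sq_sqrt (by positivity)
      have h1 : a / η = B * Real.sqrt (a * T) := by
        rw [hηe]; field_simp; rw [hs2]
      have h2 : η * T * B ^ 2 / 2 = B * Real.sqrt (a * T) / 2 := by
        rw [hηe]; field_simp
      rw [← ha, h1, h2] at hreg
      rw [Set.mem_ofPred_eq, heq]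
      linarith
    refine (measure_mono_ae hsub).trans ((measure_iUnion_fintype_le _ _).trans ?_)
    refine (Finset.sum_le_sum fun φ _ => measure_lt_sum_condExp_sub_le hT
      (by positivity : 0 < 2 * B) (by positivity : 0 ≤ L + a) (hXm φ) (hXb φ)).trans ?_
    have hexp : Real.exp (-L)
        = (Fintype.card (κ → κ) : ℝ) * Real.exp (-(L + a)) := by
      rw [neg_add, Real.exp_add, Fintype.card_fun]
      push_cast
      rw [← Real.exp_log (by positivity : (0 : ℝ) < (Fintype.card κ : ℝ) ^ Fintype.card κ),
        Real.log_pow, ← ha, mul_left_comm, ← Real.exp_add, add_neg_cancel, Real.exp_zero, mul_one]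
    rw [Finset.sum_const, Finset.card_univ, nsmul_eq_mul, hexp,
      ENNReal.ofReal_mul (by positivity), ENNReal.ofReal_natCast]

/-- A left-stochastic matrix is dominated by one of its vertices: the gain of `M'` against linear
payoffs is at most that of a deterministic swap. -/
theorem exists_swap_sum_le {κ : Type*} [Fintype κ] [Nonempty κ] {T : ℕ} (u l : ℕ → κ → ℝ)
    {M' : κ → κ → ℝ} (hM' : ∀ j, (fun i => M' i j) ∈ stdSimplex ℝ κ) :
    ∃ φ : κ → κ, ∑ t ∈ Finset.range T,
        (∑ i, u t i * ∑ j, M' i j * l t j - ∑ i, u t i * l t i)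
      ≤ ∑ t ∈ Finset.range T, ∑ j, (u t (φ j) - u t j) * l t j := by
  choose φ hφ using fun j => Finite.exists_max fun i => ∑ t ∈ Finset.range T, u t i * l t j
  refine ⟨φ, ?_⟩
  simp only [sub_mul, Finset.sum_sub_distrib]
  refine sub_le_sub_right ?_ _
  calc ∑ t ∈ Finset.range T, ∑ i, u t i * ∑ j, M' i j * l t j
      = ∑ j, ∑ i, M' i j * ∑ t ∈ Finset.range T, u t i * l t j := by
        simp only [Finset.mul_sum]
        rw [Finset.sum_comm, Finset.sum_comm (s := Finset.univ) (t := Finset.univ)]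
        refine Finset.sum_congr rfl fun i _ => ?_
        rw [Finset.sum_comm]
        exact Finset.sum_congr rfl fun j _ => Finset.sum_congr rfl fun t _ => by ring
    _ ≤ ∑ j, ∑ i, M' i j * ∑ t ∈ Finset.range T, u t (φ j) * l t j :=
        Finset.sum_le_sum fun j _ => Finset.sum_le_sum fun i _ =>
          mul_le_mul_of_nonneg_left (hφ j i) ((hM' j).1 i)
    _ = ∑ j, ∑ t ∈ Finset.range T, u t (φ j) * l t j := by
        refine Finset.sum_congr rfl fun j _ => ?_
        rw [← Finset.sum_mul, (hM' j).2, one_mul]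
    _ = _ := Finset.sum_comm

theorem sqrt_add_sqrt_le_mul_sqrt_one_add {T L : ℝ} (hT : 0 < T) (hL : Real.log 2 ≤ L) :
    9 / 4 * Real.sqrt (2 * T) + 2 * Real.sqrt (2 * T * L)
      ≤ T * (2 * Real.sqrt ((1 + 16 * L) / T)) := by
  have hL' : 0.69 < L := by linarith [Real.log_two_gt_d9]
  have h1 : Real.sqrt (2 * T) ^ 2 = 2 * T := Real.sq_sqrt (by positivity)
  have h2 : Real.sqrt (2 * T * L) ^ 2 = 2 * T * L := Real.sq_sqrt (by positivity)
  have h3 : Real.sqrt ((1 + 16 * L) / T) ^ 2 = (1 + 16 * L) / T := Real.sq_sqrt (by positivity)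
  refine le_of_sq_le_sq ?_ (by positivity)
  rw [mul_pow, mul_pow, h3]
  have h4 : T ^ 2 * (2 ^ 2 * ((1 + 16 * L) / T)) = 4 * T + 64 * (T * L) := by
    field_simp; ring
  rw [h4]
  nlinarith [sq_nonneg (9 / 4 * Real.sqrt (2 * T) - 2 * Real.sqrt (2 * T * L)),
    mul_lt_mul_of_pos_left hL' hT]

theorem sqrt_add_sqrt_le_mul_sqrt_mul_one_add {a T L : ℝ} (hT : 0 < T) (ha : 1 ≤ a)
    (hL : Real.log 2 ≤ L) :
    3 / 2 * Real.sqrt (a * T) + 2 * Real.sqrt (2 * T * (L + a))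
      ≤ T * (2 * Real.sqrt (2 * a * (1 + 16 * L) / T)) := by
  have hL' : 0.69 < L := by linarith [Real.log_two_gt_d9]
  have h1 : Real.sqrt (a * T) ^ 2 = a * T := Real.sq_sqrt (by positivity)
  have h2 : Real.sqrt (2 * T * (L + a)) ^ 2 = 2 * T * (L + a) := Real.sq_sqrt (by positivity)
  have h3 : Real.sqrt (2 * a * (1 + 16 * L) / T) ^ 2 = 2 * a * (1 + 16 * L) / T :=
    Real.sq_sqrt (by positivity)
  refine le_of_sq_le_sq ?_ (by positivity)
  rw [mul_pow, mul_pow, h3]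
  have h4 : T ^ 2 * (2 ^ 2 * (2 * a * (1 + 16 * L) / T))
      = 8 * (a * T) + 128 * (a * T * L) := by
    field_simp; ring
  rw [h4]
  have h5 : a * T * 0.69 < a * T * L := by gcongr
  have h6 : 1 * T * L ≤ a * T * L := by gcongr
  nlinarith [sq_nonneg (3 / 2 * Real.sqrt (a * T) - 2 * Real.sqrt (2 * T * (L + a)))]

/-- **Convergence of the stochastic proxy-Lagrangian algorithm** (Lemma 5 /
Algorithm 2).  The `θ`-player performs projected stochastic subgradient
descent on `ℒ_θ(·, λ^(t))` over the compact convex set `Θ ∋ 0` (the objective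
`g₀` and proxy constraints `g̃ᵢ` being convex), while the `λ`-player runs
stochastic swap-regret-minimizing matrix multiplicative updates, playing a
stationary distribution `λ^(t)` of `M^(t)`.  With probability at least `1 − δ`
over the draws of the stochastic (sub)gradients, the `θ`-player's average
external regret is at most `2 B_Θ B_ǧ √((1 + 16 ln(2/δ))/T)` and the
`λ`-player's average swap regret is at most
`2 B_Δ √(2 (m+1) ln(m+1) (1 + 16 ln(2/δ)) / T)`. -/
theorem stochastic_proxy_lagrangian_convergence
    {n m : ℕ}
    {Ω : Type*} {m0 : MeasurableSpace Ω} (P : Measure Ω) [IsProbabilityMeasure P]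
    (ℱ : Filtration ℕ m0)
    (Θ : Set (Fin n → ℝ)) (hΘconv : Convex ℝ Θ) (hΘcomp : IsCompact Θ)
    (hΘ0 : (0 : Fin n → ℝ) ∈ Θ)
    (g0 : (Fin n → ℝ) → ℝ) (g gt : Fin m → (Fin n → ℝ) → ℝ)
    (hg0conv : ConvexOn ℝ Θ g0) (hgtconv : ∀ i, ConvexOn ℝ Θ (gt i))
    (Lθ Llam : (Fin n → ℝ) → (Fin (m + 1) → ℝ) → ℝ)
    (hLθ : ∀ θ l, Lθ θ l = l 0 * g0 θ + ∑ i : Fin m, l i.succ * gt i θ)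
    (hLlam : ∀ θ l, Llam θ l = ∑ i : Fin m, l i.succ * g i θ)
    (T : ℕ) (hT : 0 < T) (BΘ Bg BΔ δ : ℝ) (hδ : 0 < δ)
    (hBΘ : ∀ θ ∈ Θ, euclNorm θ ≤ BΘ)
    (ηθ ηlam : ℝ)
    (hηθ : ηθ = BΘ / (Bg * Real.sqrt (2 * T)))
    (hηlam : ηlam = Real.sqrt (((m : ℝ) + 1) * Real.log ((m : ℝ) + 1) / (T * BΔ ^ 2)))
    (θs : ℕ → Ω → Fin n → ℝ)
    (lams : ℕ → Ω → Fin (m + 1) → ℝ)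
    (Ms : ℕ → Ω → Fin (m + 1) → Fin (m + 1) → ℝ)
    (gs : ℕ → Ω → Fin n → ℝ)       -- stochastic subgradients ǧ^(t)
    (Δs : ℕ → Ω → Fin (m + 1) → ℝ) -- stochastic gradients Δ^(t)
    (hθinit : ∀ ω, θs 0 ω = 0)
    (hMinit : ∀ ω i j, Ms 0 ω i j = 1 / ((m : ℝ) + 1))
    -- adaptedness
    (hθmeas : ∀ t, Measurable[ℱ t] (θs t))
    (hlammeas : ∀ t, Measurable[ℱ t] (lams t))
    (hMmeas : ∀ t, Measurable[ℱ t] (Ms t))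
    (hgmeas : ∀ t, Measurable[ℱ (t + 1)] (gs t))
    (hΔmeas : ∀ t, Measurable[ℱ (t + 1)] (Δs t))
    -- `λ^(t)` is a stationary distribution of `M^(t)`
    (hstat : ∀ t < T, ∀ ω, lams t ω ∈ stdSimplex ℝ (Fin (m + 1)) ∧
      ∀ i, ∑ j, Ms t ω i j * lams t ω j = lams t ω i)
    -- the conditional expectation of `ǧ^(t)` is a subgradient of
    -- `ℒ_θ(·, λ^(t))` at `θ^(t)`
    (hsub : ∀ t < T, ∀ᵐ ω ∂P, ∀ y ∈ Θ,
      Lθ (θs t ω) (lams t ω)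
          + ∑ i, (P[fun ω' => gs t ω' i|ℱ t]) ω * (y i - θs t ω i)
        ≤ Lθ y (lams t ω))
    -- the conditional expectation of `Δ^(t)` is the gradient
    -- `(0, g₁(θ^(t)), …, g_m(θ^(t)))` of `ℒ_λ(θ^(t), ·)`
    (hgrad : ∀ t < T, ∀ i, ∀ᵐ ω ∂P,
      (P[fun ω' => Δs t ω' i|ℱ t]) ω
        = Matrix.vecCons (0 : ℝ) (fun k : Fin m => g k (θs t ω)) i)
    -- almost-sure norm bounds
    (hBg : ∀ t < T, ∀ᵐ ω ∂P, euclNorm (gs t ω) ≤ Bg)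
    (hBΔ : ∀ t < T, ∀ᵐ ω ∂P, ∀ i, |Δs t ω i| ≤ BΔ)
    -- projected stochastic subgradient update for `θ`
    (hθupdate : ∀ t < T, ∀ ω, θs (t + 1) ω ∈ Θ ∧
      ∀ y ∈ Θ, euclNorm (θs (t + 1) ω - (θs t ω - ηθ • gs t ω))
        ≤ euclNorm (y - (θs t ω - ηθ • gs t ω)))
    -- multiplicative update, followed by column normalization, for `M`
    (hMupdate : ∀ t < T, ∀ ω, ∀ i j,
      Ms (t + 1) ω i j = (Ms t ω i j * Real.exp (ηlam * (Δs t ω i * lams t ω j)))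
        / ∑ k, Ms t ω k j * Real.exp (ηlam * (Δs t ω k * lams t ω j))) :
    ENNReal.ofReal (1 - δ) ≤ P {ω |
      (∀ θ' ∈ Θ,
        (1 / (T : ℝ)) * ∑ t ∈ Finset.range T, Lθ (θs t ω) (lams t ω)
          - (1 / (T : ℝ)) * ∑ t ∈ Finset.range T, Lθ θ' (lams t ω)
        ≤ 2 * BΘ * Bg * Real.sqrt ((1 + 16 * Real.log (2 / δ)) / T)) ∧
      (∀ M' : Fin (m + 1) → Fin (m + 1) → ℝ,
        (∀ j, (fun i => M' i j) ∈ stdSimplex ℝ (Fin (m + 1))) →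
        (1 / (T : ℝ)) * ∑ t ∈ Finset.range T,
            Llam (θs t ω) (fun i => ∑ j, M' i j * lams t ω j)
          - (1 / (T : ℝ)) * ∑ t ∈ Finset.range T, Llam (θs t ω) (lams t ω)
        ≤ 2 * BΔ * Real.sqrt (2 * ((m : ℝ) + 1) * Real.log ((m : ℝ) + 1)
            * (1 + 16 * Real.log (2 / δ)) / T))} := by
  rcases le_or_gt 1 δ with hδ1 | hδ1
  · rw [ENNReal.ofReal_eq_zero.2 (by linarith)]
    exact zero_le
  set L := Real.log (2 / δ) with hLdef
  have hT' : (0 : ℝ) < T := by exact_mod_cast hT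
  have hL2 : Real.log 2 ≤ L :=
    Real.log_le_log two_pos (by rw [le_div_iff₀ hδ]; linarith)
  have hL0 : 0 ≤ L := (Real.log_nonneg one_le_two).trans hL2
  have hexp : Real.exp (-L) = δ / 2 := by
    rw [Real.exp_neg, hLdef, Real.exp_log (by positivity), inv_div]
  have hBΘ0 : 0 ≤ BΘ := (Real.sqrt_nonneg _).trans (hBΘ 0 hΘ0)
  have hBg0 : 0 ≤ Bg := by
    obtain ⟨ω, hω⟩ := (hBg 0 hT).exists
    exact (Real.sqrt_nonneg _).trans hω
  have hBΔ0 : 0 ≤ BΔ := by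
    obtain ⟨ω, hω⟩ := (hBΔ 0 hT).exists
    exact (abs_nonneg _).trans (hω 0)
  have htoLp : Continuous (WithLp.toLp 2 : (Fin n → ℝ) → EuclideanSpace ℝ (Fin n)) :=
    PiLp.continuous_toLp 2 _
  have hGm : ∀ t, StronglyMeasurable[ℱ (t + 1)] (fun ω => WithLp.toLp 2 (gs t ω)) := fun t =>
    htoLp.comp_stronglyMeasurable (hgmeas t).stronglyMeasurable
  have hGB : ∀ t < T, ∀ᵐ ω ∂P, ‖WithLp.toLp 2 (gs t ω)‖ ≤ Bg := fun t ht =>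
    (hBg t ht).mono fun ω hω => (euclNorm_eq_norm_toLp _).symm.trans_le hω
  have hcoord : ∀ t < T, ∀ᵐ ω ∂P, ∀ i, (P[fun ω' => gs t ω' i|ℱ t]) ω
      = (P[fun ω' => WithLp.toLp 2 (gs t ω')|ℱ t]) ω i := fun t ht => ae_all_iff.2 fun i =>
    ((EuclideanSpace.proj (𝕜 := ℝ) i).comp_condExp_comm (m := ℱ t)
      (Integrable.of_bound ((hGm t).mono (ℱ.le _)).aestronglyMeasurable Bg (hGB t ht))).symm
  have hθtail := measure_exists_lt_sum_sub_le_of_projected_subgradient (P := P) (ℱ := ℱ)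
    (K := (WithLp.ofLp : EuclideanSpace ℝ (Fin n) → _) ⁻¹' Θ)
    (G := fun t ω => WithLp.toLp 2 (gs t ω)) (x := fun t ω => WithLp.toLp 2 (θs t ω))
    (f := fun t ω y => Lθ (WithLp.ofLp y) (lams t ω)) (R := BΘ) (B := Bg) (L := L)
    (hΘconv.linear_preimage (WithLp.linearEquiv 2 ℝ (Fin n → ℝ)).toLinearMap)
    hΘ0 (fun y hy => (euclNorm_eq_norm_toLp _).symm.trans_le (hBΘ _ hy)) hT hηθ hL0 hGm hGB
    (fun t => htoLp.comp_stronglyMeasurable (hθmeas t).stronglyMeasurable)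
    (fun ω => by simp [hθinit])
    (fun t ht ω => ⟨(hθupdate t ht ω).1, fun y hy => by
      have := (hθupdate t ht ω).2 _ hy
      rwa [euclNorm_eq_norm_toLp, euclNorm_eq_norm_toLp] at this⟩)
    (fun t ht => by
      filter_upwards [hsub t ht, hcoord t ht] with ω h1 h2 y hy
      refine le_of_eq_of_le ?_ (h1 _ hy)
      simp [PiLp.inner_apply, h2, mul_comm])
  have hN : (Fintype.card (Fin (m + 1)) : ℝ) = (m : ℝ) + 1 := by simp
  have hlamtail := measure_exists_lt_sum_swap_condExp_sub_le (P := P) (ℱ := ℱ) (M := Ms)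
    (l := lams) (D := Δs) (η := ηlam) (B := BΔ) (L := L) hT hL0 (by rw [hN, hηlam]) hlammeas
    hΔmeas (fun ω i j => by rw [hN, hMinit]) hMupdate hstat hBΔ
  rw [hN] at hlamtail
  rw [hexp] at hθtail hlamtail
  set badθ := {ω | ∃ y ∈ (WithLp.ofLp : EuclideanSpace ℝ (Fin n) → _) ⁻¹' Θ,
    BΘ * Bg * (9 / 4 * Real.sqrt (2 * T) + 2 * Real.sqrt (2 * T * L))
      < ∑ t ∈ Finset.range T, (Lθ (WithLp.ofLp (WithLp.toLp 2 (θs t ω))) (lams t ω)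
          - Lθ (WithLp.ofLp y) (lams t ω))} with hbadθ
  set badlam := {ω | ∃ φ : Fin (m + 1) → Fin (m + 1),
    BΔ * (3 / 2 * Real.sqrt (((m : ℝ) + 1) * Real.log ((m : ℝ) + 1) * T)
      + 2 * Real.sqrt (2 * T * (L + ((m : ℝ) + 1) * Real.log ((m : ℝ) + 1))))
    < ∑ t ∈ Finset.range T, ∑ j, ((P[fun ω' => Δs t ω' (φ j)|ℱ t]) ω
        - (P[fun ω' => Δs t ω' j|ℱ t]) ω) * lams t ω j} with hbadlam
  have hgrad' : ∀ᵐ ω ∂P, ∀ t < T, ∀ i, (P[fun ω' => Δs t ω' i|ℱ t]) ω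
      = Matrix.vecCons (0 : ℝ) (fun k : Fin m => g k (θs t ω)) i := by
    refine ae_all_iff.2 fun t => ?_
    by_cases ht : t < T
    · exact (ae_all_iff.2 (hgrad t ht)).mono fun ω h _ => h
    · exact Filter.Eventually.of_forall fun ω h => absurd h ht
  have hbad : P (badθ ∪ badlam) ≤ ENNReal.ofReal δ := by
    refine (measure_union_le _ _).trans ((add_le_add hθtail hlamtail).trans_eq ?_)
    rw [← ENNReal.ofReal_add (by positivity) (by positivity), add_halves]
  suffices hcover : ∀ good : Set Ω, (∀ᵐ ω ∂P, ω ∈ badθᶜ ∩ badlamᶜ → ω ∈ good) →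
      ENNReal.ofReal (1 - δ) ≤ P good by
    refine hcover _ ?_
    filter_upwards [hgrad'] with ω hω
    rintro ⟨h1, h2⟩
    simp only [hbadθ, hbadlam, Set.mem_compl_iff, Set.mem_ofPred_eq, not_exists, not_and,
      not_lt] at h1 h2
    refine ⟨fun θ' hθ' => ?_, fun M' hM' => ?_⟩
    · rw [← mul_sub, ← Finset.sum_sub_distrib, one_div, inv_mul_le_iff₀ hT']
      refine (h1 (WithLp.toLp 2 θ') hθ').trans ?_
      refine (mul_le_mul_of_nonneg_left (sqrt_add_sqrt_le_mul_sqrt_one_add hT' hL2)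
        (mul_nonneg hBΘ0 hBg0)).trans_eq ?_
      ring
    · rw [← mul_sub, ← Finset.sum_sub_distrib, one_div, inv_mul_le_iff₀ hT']
      obtain rfl | hm := Nat.eq_zero_or_pos m
      · simp [hLlam]
      obtain ⟨φ, hφ⟩ := exists_swap_sum_le (T := T)
        (fun t => Matrix.vecCons (0 : ℝ) (fun k : Fin m => g k (θs t ω)))
        (fun t => lams t ω) hM'
      have hLl : ∀ t l, Llam (θs t ω) l
          = ∑ i, Matrix.vecCons (0 : ℝ) (fun k : Fin m => g k (θs t ω)) i * l i := fun t l => by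
        rw [hLlam, Fin.sum_univ_succ]
        simp [mul_comm]
      simp only [hLl]
      refine hφ.trans (le_of_eq_of_le (Finset.sum_congr rfl fun t ht => ?_) ((h2 φ).trans ?_))
      · exact Finset.sum_congr rfl fun j _ => by
          rw [hω t (Finset.mem_range.1 ht), hω t (Finset.mem_range.1 ht)]
      · have hm2 : (2 : ℝ) ≤ (m : ℝ) + 1 := by
          have : (1 : ℝ) ≤ m := by exact_mod_cast hm
          linarith
        have ha : 1 ≤ ((m : ℝ) + 1) * Real.log ((m : ℝ) + 1) := by
          have := Real.log_le_log two_pos hm2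
          nlinarith [Real.log_two_gt_d9]
        refine (mul_le_mul_of_nonneg_left
          (sqrt_add_sqrt_le_mul_sqrt_mul_one_add hT' ha hL2) hBΔ0).trans_eq ?_
        rw [← mul_assoc (2 : ℝ) ((m : ℝ) + 1)]
        ring
  intro good hcover
  have huniv : (1 : ENNReal) ≤ P good + ENNReal.ofReal δ := by
    calc (1 : ENNReal) = P Set.univ := measure_univ.symm
      _ ≤ P (badθᶜ ∩ badlamᶜ ∪ (badθ ∪ badlam)) := by
          rw [← Set.compl_union, Set.compl_union_self]
      _ ≤ P (badθᶜ ∩ badlamᶜ) + P (badθ ∪ badlam) := measure_union_le _ _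
      _ ≤ _ := add_le_add (measure_mono_ae hcover) hbad
  rw [ENNReal.ofReal_sub _ hδ.le, ENNReal.ofReal_one]
  exact tsub_le_iff_right.2 huniv
end

section
/- (Stochastic matrix multiplicative updates.) Let ℳ be the set of left-stochastic m̃×m̃ matrices and f₁,…,f_T : ℳ → ℝ concave. Starting from M^(1) with all entries 1/m̃ and with step size η := √(m̃ ln m̃/(T B_ĝ²)), perform T iterations: M̃^(t+1) = M^(t) ⊙ exp(η ĝ^(t)) element-wise, then normalize each column of M̃^(t+1) to sum to 1 to obtain M^(t+1), where ĝ^(t) is an adapted random matrix whose conditional expectation given the past is a supergradient of f_t at M^(t), with ‖ĝ^(t)‖_{∞,2} ≤ B_ĝ almost surely, where ‖A‖_{∞,2} := √(Σ_{i=1}^{m̃} ‖A_{:,i}‖_∞²). Then for every M* ∈ ℳ, with probability at least 1−δ: (1/T) Σ_{t=1}^T f_t(M*) − (1/T) Σ_{t=1}^T f_t(M^(t)) ≤ 2 B_ĝ √(2 (m̃ ln m̃)(1 + 16 ln(1/δ)) / T). -/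
open MeasureTheory

/-- Hoeffding's lemma for a `±1`-valued random variable with mean `p`. -/
lemma cosh_add_mul_sinh_le_exp {p : ℝ} (hp : |p| ≤ 1) (y : ℝ) :
    Real.cosh y + p * Real.sinh y ≤ Real.exp (p * y + y ^ 2 / 2) := by
  obtain ⟨hp1, hp2⟩ := abs_le.1 hp
  let μ : Measure ℝ := ENNReal.ofReal ((1 + p) / 2) • Measure.dirac 1
    + ENNReal.ofReal ((1 - p) / 2) • Measure.dirac (-1)
  have hprob : IsProbabilityMeasure μ := by
    constructor
    simp only [μ, Measure.add_apply, Measure.smul_apply, measure_univ, smul_eq_mul, mul_one]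
    rw [← ENNReal.ofReal_add (by linarith) (by linarith)]
    norm_num [← add_div]
  have hint (F : ℝ → ℝ) : ∫ x, F x ∂μ = (1 + p) / 2 * F 1 + (1 - p) / 2 * F (-1) := by
    have hi (c : ℝ) (x : ℝ) : Integrable F (ENNReal.ofReal c • Measure.dirac x) :=
      (integrable_dirac (by simp)).smul_measure (by simp)
    rw [integral_add_measure (hi _ _) (hi _ _), integral_smul_measure, integral_smul_measure,
      integral_dirac, integral_dirac, ENNReal.toReal_ofReal (by linarith),
      ENNReal.toReal_ofReal (by linarith), smul_eq_mul, smul_eq_mul]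
  have hmem : ∀ᵐ x ∂μ, id x ∈ Set.Icc (-1 : ℝ) 1 := by
    simp only [μ, ae_add_measure_iff]
    constructor <;>
    · refine Measure.ae_smul_measure ?_ _
      rw [ae_dirac_eq]
      simp
  have h := (ProbabilityTheory.hasSubgaussianMGF_of_mem_Icc aemeasurable_id hmem).mgf_le y
  rw [ProbabilityTheory.mgf, hint, hint] at h
  have hmean : (1 + p) / 2 * id (1 : ℝ) + (1 - p) / 2 * id (-1 : ℝ) = p := by
    simp only [id]; ring
  have hc : (((‖(1 : ℝ) - -1‖₊ / 2) ^ 2 : NNReal) : ℝ) = 1 := by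
    simp only [NNReal.coe_pow, NNReal.coe_div, coe_nnnorm]; norm_num
  rw [hmean, hc] at h
  have h1 : Real.exp (p * y) * Real.exp (y * (id (1 : ℝ) - p)) = Real.exp y := by
    rw [← Real.exp_add]; congr 1; simp only [id]; ring
  have h2 : Real.exp (p * y) * Real.exp (y * (id (-1 : ℝ) - p)) = Real.exp (-y) := by
    rw [← Real.exp_add]; congr 1; simp only [id]; ring
  calc Real.cosh y + p * Real.sinh y
      = (1 + p) / 2 * Real.exp y + (1 - p) / 2 * Real.exp (-y) := by
        rw [Real.cosh_eq, Real.sinh_eq]; ring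
    _ = Real.exp (p * y) * ((1 + p) / 2 * Real.exp (y * (id (1 : ℝ) - p))
          + (1 - p) / 2 * Real.exp (y * (id (-1 : ℝ) - p))) := by
        rw [← h1, ← h2]; ring
    _ ≤ Real.exp (p * y) * Real.exp (1 * y ^ 2 / 2) := by gcongr
    _ = Real.exp (p * y + y ^ 2 / 2) := by rw [← Real.exp_add, one_mul]

lemma exp_mul_le_cosh_add_mul_sinh {p : ℝ} (hp : |p| ≤ 1) (y : ℝ) :
    Real.exp (p * y) ≤ Real.cosh y + p * Real.sinh y := by
  obtain ⟨hp1, hp2⟩ := abs_le.1 hp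
  have h := convexOn_exp.2 (Set.mem_univ y) (Set.mem_univ (-y))
    (by linarith : 0 ≤ (1 + p) / 2) (by linarith : 0 ≤ (1 - p) / 2) (by ring)
  simp only [smul_eq_mul] at h
  calc Real.exp (p * y) = Real.exp ((1 + p) / 2 * y + (1 - p) / 2 * -y) := by congr 1; ring
    _ ≤ _ := h
    _ = Real.cosh y + p * Real.sinh y := by rw [Real.cosh_eq, Real.sinh_eq]; ring

/-- Hoeffding's lemma for a finitely supported distribution. -/
lemma sum_mul_exp_le_exp {ι : Type*} [Fintype ι] {w g : ι → ℝ} {a : ℝ}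
    (hw : w ∈ stdSimplex ℝ ι) (hg : ∀ i, |g i| ≤ a) (η : ℝ) :
    ∑ i, w i * Real.exp (η * g i)
      ≤ Real.exp (η * (∑ i, w i * g i) + η ^ 2 * a ^ 2 / 2) := by
  obtain ⟨i₀, -⟩ : (Finset.univ : Finset ι).Nonempty := by
    by_contra h
    have := hw.2
    simp_all [Finset.not_nonempty_iff_eq_empty]
  have ha : 0 ≤ a := (abs_nonneg _).trans (hg i₀)
  have hq (i : ι) : |g i / a| ≤ 1 := by
    rw [abs_div, abs_of_nonneg ha]; exact div_le_one_of_le₀ (hg i) ha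
  have hqa (i : ι) : g i / a * a = g i := by
    rcases ha.eq_or_lt with h | h
    · have := hg i
      rw [← h] at this ⊢
      simp [abs_nonpos_iff.1 this]
    · field_simp
  have hp : |∑ i, w i * (g i / a)| ≤ 1 := by
    calc |∑ i, w i * (g i / a)| ≤ ∑ i, |w i * (g i / a)| := Finset.abs_sum_le_sum_abs _ _
      _ ≤ ∑ i, w i := by
        refine Finset.sum_le_sum fun i _ => ?_
        rw [abs_mul, abs_of_nonneg (hw.1 i)]
        exact mul_le_of_le_one_right (hw.1 i) (hq i)
      _ = 1 := hw.2
  calc ∑ i, w i * Real.exp (η * g i)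
      ≤ ∑ i, w i * (Real.cosh (η * a) + g i / a * Real.sinh (η * a)) := by
        refine Finset.sum_le_sum fun i _ => mul_le_mul_of_nonneg_left ?_ (hw.1 i)
        have h := exp_mul_le_cosh_add_mul_sinh (hq i) (η * a)
        rwa [mul_left_comm, hqa] at h
    _ = Real.cosh (η * a) + (∑ i, w i * (g i / a)) * Real.sinh (η * a) := by
        simp only [mul_add, Finset.sum_add_distrib, ← Finset.sum_mul, hw.2, one_mul, ← mul_assoc]
    _ ≤ Real.exp ((∑ i, w i * (g i / a)) * (η * a) + (η * a) ^ 2 / 2) :=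
        cosh_add_mul_sinh_le_exp hp _
    _ = _ := by
        have : (∑ i, w i * (g i / a)) * a = ∑ i, w i * g i := by
          simp only [Finset.sum_mul, mul_assoc, hqa]
        rw [← this]; congr 1; ring

/-- The multiplicative weights update of a distribution `w`. -/
lemma multiplicative_update_mem_stdSimplex {ι : Type*} [Fintype ι] {w w' x : ι → ℝ}
    (hw : w ∈ stdSimplex ℝ ι) (hpos : ∀ i, 0 < w i)
    (hw' : ∀ i, w' i = w i * Real.exp (x i) / ∑ k, w k * Real.exp (x k)) :
    w' ∈ stdSimplex ℝ ι ∧ ∀ i, 0 < w' i := by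
  have hne : (Finset.univ : Finset ι).Nonempty := by
    by_contra h
    have := hw.2
    simp_all [Finset.not_nonempty_iff_eq_empty]
  have hZ : 0 < ∑ k, w k * Real.exp (x k) :=
    Finset.sum_pos (fun k _ => mul_pos (hpos k) (Real.exp_pos _)) hne
  have hp (i : ι) : 0 < w' i := by
    rw [hw']; exact div_pos (mul_pos (hpos i) (Real.exp_pos _)) hZ
  refine ⟨⟨fun i => (hp i).le, ?_⟩, hp⟩
  simp only [hw', ← Finset.sum_div]
  exact div_self hZ.ne'

/-- Regret bound for multiplicative weights against a fixed distribution `u`. -/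
lemma multiplicative_weights_regret {ι : Type*} [Fintype ι] {η : ℝ} {w g : ℕ → ι → ℝ}
    {a : ℕ → ℝ} {u : ι → ℝ} (hu : u ∈ stdSimplex ℝ ι) {n : ℕ}
    (hw : ∀ t ≤ n, w t ∈ stdSimplex ℝ ι) (hpos : ∀ t ≤ n, ∀ i, 0 < w t i)
    (hw0 : ∀ i, w 0 i = 1 / (Fintype.card ι : ℝ))
    (hg : ∀ t < n, ∀ i, |g t i| ≤ a t)
    (hup : ∀ t < n, ∀ i, w (t + 1) i
      = w t i * Real.exp (η * g t i) / ∑ k, w t k * Real.exp (η * g t k)) :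
    η * ∑ t ∈ Finset.range n, ∑ i, g t i * (u i - w t i)
      ≤ Real.log (Fintype.card ι) + η ^ 2 / 2 * ∑ t ∈ Finset.range n, a t ^ 2 := by
  have key : ∀ m ≤ n, η * ∑ t ∈ Finset.range m, ∑ i, g t i * (u i - w t i)
      ≤ (∑ i, u i * Real.log (w m i)) + Real.log (Fintype.card ι)
        + η ^ 2 / 2 * ∑ t ∈ Finset.range m, a t ^ 2 := by
    intro m
    induction m with
    | zero => simp [hw0, ← Finset.sum_mul, hu.2]
    | succ m ih =>
      intro hm
      have ih := ih (by omega)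
      have hwm := hw m (by omega)
      have hpm := hpos m (by omega)
      have hne : (Finset.univ : Finset ι).Nonempty := by
        by_contra h
        have := hu.2
        simp_all [Finset.not_nonempty_iff_eq_empty]
      have hZ : 0 < ∑ k, w m k * Real.exp (η * g m k) :=
        Finset.sum_pos (fun k _ => mul_pos (hpm k) (Real.exp_pos _)) hne
      have hlogZ := (Real.log_le_iff_le_exp hZ).2 (sum_mul_exp_le_exp hwm (hg m (by omega)) η)
      have hlog : ∑ i, u i * Real.log (w (m + 1) i) = (∑ i, u i * Real.log (w m i))
          + η * (∑ i, u i * g m i) - Real.log (∑ k, w m k * Real.exp (η * g m k)) := by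
        have (i : ι) : Real.log (w (m + 1) i) = Real.log (w m i) + η * g m i
            - Real.log (∑ k, w m k * Real.exp (η * g m k)) := by
          rw [hup m (by omega), Real.log_div (mul_pos (hpm i) (Real.exp_pos _)).ne' hZ.ne',
            Real.log_mul (hpm i).ne' (Real.exp_pos _).ne', Real.log_exp]
        simp only [this, mul_sub, mul_add, Finset.sum_sub_distrib, Finset.sum_add_distrib,
          ← Finset.sum_mul, hu.2, one_mul, Finset.mul_sum, mul_left_comm]
      have hsub : ∑ i, g m i * (u i - w m i) = (∑ i, u i * g m i) - ∑ i, w m i * g m i := by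
        rw [← Finset.sum_sub_distrib]
        exact Finset.sum_congr rfl fun i _ => by ring
      rw [Finset.sum_range_succ, Finset.sum_range_succ, hlog, hsub]
      linarith
  have hneg : ∑ i, u i * Real.log (w n i) ≤ 0 := by
    refine Finset.sum_nonpos fun i _ => mul_nonpos_of_nonneg_of_nonpos (hu.1 i) ?_
    refine Real.log_nonpos (hpos n le_rfl i).le ?_
    rw [← (hw n le_rfl).2]
    exact Finset.single_le_sum (fun k _ => (hw n le_rfl).1 k) (Finset.mem_univ i)
  linarith [key n le_rfl]

/-- Exponential moment bound for sums of bounded centred adapted increments. -/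
lemma integrable_exp_sum_condExp_sub {Ω : Type*} {m0 : MeasurableSpace Ω} {P : Measure Ω}
    [IsProbabilityMeasure P] {ℱ : Filtration ℕ m0} {X : ℕ → Ω → ℝ} {c : ℝ} (hc : 0 < c)
    {n : ℕ} (hX : ∀ t < n, StronglyMeasurable[ℱ (t + 1)] (X t))
    (hb : ∀ t < n, ∀ᵐ ω ∂P, |X t ω| ≤ c) (l : ℝ) :
    Integrable (fun ω => Real.exp (l * ∑ t ∈ Finset.range n, ((P[X t|ℱ t]) ω - X t ω))) P ∧
    ∫ ω, Real.exp (l * ∑ t ∈ Finset.range n, ((P[X t|ℱ t]) ω - X t ω)) ∂P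
      ≤ Real.exp (n * (l ^ 2 * c ^ 2 / 2)) := by
  have hce : ∀ t < n, ∀ᵐ ω ∂P, |(P[X t|ℱ t]) ω| ≤ c := fun t ht =>
    ae_bdd_abs_condExp_of_ae_bdd_abs (hb t ht)
  have hmeas : ∀ m ≤ n, StronglyMeasurable[ℱ m]
      (fun ω => ∑ t ∈ Finset.range m, ((P[X t|ℱ t]) ω - X t ω)) := by
    intro m hm
    refine Finset.stronglyMeasurable_fun_sum _ fun t ht => ?_
    have ht := Finset.mem_range.1 ht
    exact (stronglyMeasurable_condExp.mono (ℱ.mono ht.le)).sub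
      ((hX t (by omega)).mono (ℱ.mono ht))
  have hbdd : ∀ m ≤ n, ∀ᵐ ω ∂P,
      |∑ t ∈ Finset.range m, ((P[X t|ℱ t]) ω - X t ω)| ≤ m * (2 * c) := by
    intro m hm
    have h1 : ∀ᵐ ω ∂P, ∀ t ∈ Finset.range m, |(P[X t|ℱ t]) ω - X t ω| ≤ 2 * c := by
      rw [Finset.eventually_all]
      intro t ht
      have ht := Finset.mem_range.1 ht
      filter_upwards [hb t (by omega), hce t (by omega)] with ω h1 h2
      exact (abs_sub _ _).trans (by linarith)
    filter_upwards [h1] with ω h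
    refine (Finset.abs_sum_le_sum_abs _ _).trans ?_
    simpa using Finset.sum_le_sum h
  have hexp {Y : Ω → ℝ} (hY : StronglyMeasurable Y) {K : ℝ} (hK : ∀ᵐ ω ∂P, |Y ω| ≤ K) :
      ∀ᵐ ω ∂P, ‖Real.exp (l * Y ω)‖ ≤ Real.exp (|l| * K) := by
    filter_upwards [hK] with ω h
    rw [Real.norm_eq_abs, Real.abs_exp, Real.exp_le_exp]
    refine (le_abs_self _).trans ?_
    rw [abs_mul]; gcongr
  have hsm {m' : MeasurableSpace Ω} {Y : Ω → ℝ} (hY : StronglyMeasurable[m'] Y) :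
      StronglyMeasurable[m'] (fun ω => Real.exp (l * Y ω)) :=
    Real.continuous_exp.comp_stronglyMeasurable (hY.const_mul l)
  have hint : ∀ m ≤ n, Integrable
      (fun ω => Real.exp (l * ∑ t ∈ Finset.range m, ((P[X t|ℱ t]) ω - X t ω))) P := by
    intro m hm
    have h := (hmeas m hm).mono (ℱ.le m)
    exact Integrable.of_bound (hsm h).aestronglyMeasurable _ (hexp h (hbdd m hm))
  refine ⟨hint n le_rfl, ?_⟩
  have key : ∀ m ≤ n, ∫ ω, Real.exp (l * ∑ t ∈ Finset.range m, ((P[X t|ℱ t]) ω - X t ω)) ∂P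
      ≤ Real.exp (m * (l ^ 2 * c ^ 2 / 2)) := by
    intro m
    induction m with
    | zero => simp
    | succ m ih =>
      intro hm
      have ih := ih (by omega)
      have hmn : m < n := hm
      set S : Ω → ℝ := fun ω => ∑ t ∈ Finset.range m, ((P[X t|ℱ t]) ω - X t ω) with hS
      set U : Ω → ℝ := P[X m|ℱ m] with hU
      set Z : Ω → ℝ := fun ω => Real.exp (l * (S ω + U ω)) with hZ
      have hSU : StronglyMeasurable[ℱ m] (fun ω => S ω + U ω) :=
        (hmeas m hmn.le).add stronglyMeasurable_condExp
      have hZm : StronglyMeasurable[ℱ m] Z := hsm hSU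
      have hZm' : AEStronglyMeasurable Z P := (hZm.mono (ℱ.le m)).aestronglyMeasurable
      have hZb : ∀ᵐ ω ∂P, ‖Z ω‖ ≤ Real.exp (|l| * (m * (2 * c) + c)) := by
        refine hexp (hSU.mono (ℱ.le m)) ?_
        filter_upwards [hbdd m hmn.le, hce m hmn] with ω h1 h2
        exact (abs_add_le _ _).trans (add_le_add h1 h2)
      have hZi : Integrable Z P := Integrable.of_bound hZm' _ hZb
      have hXi : Integrable (X m) P :=
        Integrable.of_bound ((hX m hmn).mono (ℱ.le _)).aestronglyMeasurable c (hb m hmn)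
      have hZX : Integrable (fun ω => Z ω * X m ω) P := hXi.bdd_mul hZm' hZb
      have hZU : Integrable (fun ω => Z ω * U ω) P := integrable_condExp.bdd_mul hZm' hZb
      have hpull : ∫ ω, Z ω * X m ω ∂P = ∫ ω, Z ω * U ω ∂P := by
        rw [← integral_condExp (ℱ.le m)]
        exact integral_congr_ae (condExp_mul_of_stronglyMeasurable_left hZm hZX hXi)
      set C := Real.cosh (l * c)
      set D := Real.sinh (l * c) / c with hD
      have hq {x : ℝ} (hx : |x| ≤ c) : |-(x / c)| ≤ 1 := by
        rw [abs_neg, abs_div, abs_of_pos hc]; exact div_le_one_of_le₀ hx hc.le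
      calc ∫ ω, Real.exp (l * ∑ t ∈ Finset.range (m + 1), ((P[X t|ℱ t]) ω - X t ω)) ∂P
          ≤ ∫ ω, (C * Z ω - D * (Z ω * X m ω)) ∂P := by
            refine integral_mono_ae (hint (m + 1) hm)
              ((hZi.const_mul C).sub (hZX.const_mul D)) ?_
            filter_upwards [hb m hmn] with ω h
            have h1 := exp_mul_le_cosh_add_mul_sinh (hq h) (l * c)
            have h2 : -(X m ω / c) * (l * c) = -(l * X m ω) := by field_simp
            rw [h2] at h1
            calc Real.exp (l * ∑ t ∈ Finset.range (m + 1), ((P[X t|ℱ t]) ω - X t ω))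
                = Z ω * Real.exp (-(l * X m ω)) := by
                  rw [hZ, ← Real.exp_add, Finset.sum_range_succ]; congr 1; simp only [hS]; ring
              _ ≤ Z ω * (C + -(X m ω / c) * Real.sinh (l * c)) :=
                  mul_le_mul_of_nonneg_left h1 (Real.exp_pos _).le
              _ = C * Z ω - D * (Z ω * X m ω) := by rw [hD]; ring
        _ = ∫ ω, (C * Z ω - D * (Z ω * U ω)) ∂P := by
            rw [integral_sub (hZi.const_mul C) (hZX.const_mul D),
              integral_sub (hZi.const_mul C) (hZU.const_mul D), integral_const_mul D,
              integral_const_mul D, hpull]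
        _ ≤ ∫ ω, Real.exp (l ^ 2 * c ^ 2 / 2) * Real.exp (l * S ω) ∂P := by
            refine integral_mono_ae ((hZi.const_mul C).sub (hZU.const_mul D))
              ((hint m hmn.le).const_mul _) ?_
            filter_upwards [hce m hmn] with ω h
            have h1 := cosh_add_mul_sinh_le_exp (hq h) (l * c)
            calc C * Z ω - D * (Z ω * U ω) = Z ω * (C + -(U ω / c) * Real.sinh (l * c)) := by
                  rw [hD]; ring
              _ ≤ Z ω * Real.exp (-(U ω / c) * (l * c) + (l * c) ^ 2 / 2) :=
                  mul_le_mul_of_nonneg_left h1 (Real.exp_pos _).le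
              _ = Real.exp (l ^ 2 * c ^ 2 / 2) * Real.exp (l * S ω) := by
                  rw [hZ, ← Real.exp_add, ← Real.exp_add]; congr 1; field_simp; ring
        _ = Real.exp (l ^ 2 * c ^ 2 / 2) * ∫ ω, Real.exp (l * S ω) ∂P := integral_const_mul _ _
        _ ≤ Real.exp (l ^ 2 * c ^ 2 / 2) * Real.exp (m * (l ^ 2 * c ^ 2 / 2)) := by gcongr
        _ = Real.exp ((m + 1 : ℕ) * (l ^ 2 * c ^ 2 / 2)) := by
            rw [← Real.exp_add]; congr 1; push_cast; ring
  exact key n le_rfl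

/-- Azuma–Hoeffding inequality for the compensated sums of a bounded adapted process. -/
lemma measureReal_le_sum_condExp_sub {Ω : Type*} {m0 : MeasurableSpace Ω} {P : Measure Ω}
    [IsProbabilityMeasure P] {ℱ : Filtration ℕ m0} {X : ℕ → Ω → ℝ} {c : ℝ} (hc : 0 < c)
    {n : ℕ} (hn : 0 < n) (hX : ∀ t < n, StronglyMeasurable[ℱ (t + 1)] (X t))
    (hb : ∀ t < n, ∀ᵐ ω ∂P, |X t ω| ≤ c) {ε : ℝ} (hε : 0 ≤ ε) :
    P.real {ω | ε ≤ ∑ t ∈ Finset.range n, ((P[X t|ℱ t]) ω - X t ω)}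
      ≤ Real.exp (-ε ^ 2 / (2 * n * c ^ 2)) := by
  have hn' : (0 : ℝ) < n := by exact_mod_cast hn
  obtain ⟨h1, h2⟩ := integrable_exp_sum_condExp_sub hc hX hb (ε / (n * c ^ 2))
  refine (ProbabilityTheory.measure_ge_le_exp_mul_mgf ε (by positivity) h1).trans ?_
  refine (mul_le_mul_of_nonneg_left h2 (Real.exp_pos _).le).trans_eq ?_
  rw [← Real.exp_add]
  congr 1
  field_simp
  ring

lemma abs_le_iSup_abs {ι κ : Type*} [Finite ι] (g : ι → κ → ℝ) (i : ι) (j : κ) :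
    |g i j| ≤ ⨆ k, |g k j| :=
  le_ciSup (f := fun k => |g k j|) (Set.finite_range _).bddAbove i

/-- Hölder's inequality between the `L_{∞,2}` norm and differences of left-stochastic matrices. -/
lemma abs_sum_mul_sub_le {ι κ : Type*} [Fintype ι] [Fintype κ] {g u w : ι → κ → ℝ} {B : ℝ}
    (hu : ∀ j, (fun i => u i j) ∈ stdSimplex ℝ ι) (hw : ∀ j, (fun i => w i j) ∈ stdSimplex ℝ ι)
    (hg : √(∑ j, (⨆ i, |g i j|) ^ 2) ≤ B) :
    |∑ i, ∑ j, g i j * (u i j - w i j)| ≤ 2 * √(Fintype.card κ) * B := by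
  have hcol (j : κ) : |∑ i, g i j * (u i j - w i j)| ≤ 2 * ⨆ i, |g i j| := by
    calc |∑ i, g i j * (u i j - w i j)| ≤ ∑ i, |g i j * (u i j - w i j)| :=
          Finset.abs_sum_le_sum_abs _ _
      _ ≤ ∑ i, (⨆ i, |g i j|) * (u i j + w i j) := by
          refine Finset.sum_le_sum fun i _ => ?_
          have h1 := (hu j).1 i
          have h2 := (hw j).1 i
          have h3 := (abs_nonneg _).trans (abs_le_iSup_abs g i j)
          rw [abs_mul]
          gcongr
          · exact abs_le_iSup_abs g i j
          · exact abs_le.2 ⟨by linarith, by linarith⟩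
      _ = 2 * ⨆ i, |g i j| := by
          have h1 := (hu j).2
          have h2 := (hw j).2
          rw [← Finset.mul_sum, Finset.sum_add_distrib, h1, h2]; ring
  have hcs : ∑ j, (⨆ i, |g i j|) ≤ √(Fintype.card κ) * √(∑ j, (⨆ i, |g i j|) ^ 2) := by
    rw [← Real.sqrt_mul (Nat.cast_nonneg _)]
    exact Real.le_sqrt_of_sq_le sq_sum_le_card_mul_sum_sq
  rw [Finset.sum_comm]
  calc |∑ j, ∑ i, g i j * (u i j - w i j)| ≤ ∑ j, |∑ i, g i j * (u i j - w i j)| :=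
        Finset.abs_sum_le_sum_abs _ _
    _ ≤ ∑ j, 2 * ⨆ i, |g i j| := Finset.sum_le_sum fun j _ => hcol j
    _ ≤ 2 * (√(Fintype.card κ) * √(∑ j, (⨆ i, |g i j|) ^ 2)) := by
        rw [← Finset.mul_sum]; gcongr
    _ ≤ 2 * √(Fintype.card κ) * B := by rw [mul_assoc]; gcongr

/-- Regret bound for column-wise multiplicative weights against a fixed left-stochastic matrix. -/
lemma matrix_multiplicative_weights_regret {ι κ : Type*} [Fintype ι] [Fintype κ] {η B : ℝ}
    {w g : ℕ → ι → κ → ℝ} {u : ι → κ → ℝ} (hu : ∀ j, (fun i => u i j) ∈ stdSimplex ℝ ι) {n : ℕ}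
    (hw : ∀ t ≤ n, ∀ j, (fun i => w t i j) ∈ stdSimplex ℝ ι ∧ ∀ i, 0 < w t i j)
    (hw0 : ∀ i j, w 0 i j = 1 / (Fintype.card ι : ℝ))
    (hg : ∀ t < n, √(∑ j, (⨆ i, |g t i j|) ^ 2) ≤ B)
    (hup : ∀ t < n, ∀ i j, w (t + 1) i j
      = w t i j * Real.exp (η * g t i j) / ∑ k, w t k j * Real.exp (η * g t k j)) :
    η * ∑ t ∈ Finset.range n, ∑ i, ∑ j, g t i j * (u i j - w t i j)
      ≤ Fintype.card κ * Real.log (Fintype.card ι) + η ^ 2 / 2 * (n * B ^ 2) := by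
  have hcol (j : κ) := multiplicative_weights_regret (η := η) (w := fun t i => w t i j)
    (g := fun t i => g t i j) (a := fun t => ⨆ i, |g t i j|) (hu j)
    (fun t ht => (hw t ht j).1) (fun t ht => (hw t ht j).2) (fun i => hw0 i j)
    (fun t _ i => abs_le_iSup_abs (g t) i j) (fun t ht i => hup t ht i j)
  have hsum := Finset.sum_le_sum fun j (_ : j ∈ Finset.univ) => hcol j
  have hB : ∑ j, ∑ t ∈ Finset.range n, (⨆ i, |g t i j|) ^ 2 ≤ n * B ^ 2 := by
    rw [Finset.sum_comm]
    calc _ ≤ ∑ t ∈ Finset.range n, B ^ 2 :=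
          Finset.sum_le_sum fun t ht => (Real.sqrt_le_iff.1 (hg t (Finset.mem_range.1 ht))).2
      _ = n * B ^ 2 := by simp
  rw [Finset.sum_add_distrib, ← Finset.mul_sum, ← Finset.mul_sum, Finset.sum_const,
    Finset.card_univ, nsmul_eq_mul, Finset.sum_comm] at hsum
  calc η * ∑ t ∈ Finset.range n, ∑ i, ∑ j, g t i j * (u i j - w t i j)
      = η * ∑ t ∈ Finset.range n, ∑ j, ∑ i, g t i j * (u i j - w t i j) := by
        congr 1
        exact Finset.sum_congr rfl fun t _ => Finset.sum_comm
    _ ≤ _ := hsum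
    _ ≤ _ := by gcongr

lemma condExp_sum_mul {Ω ι κ : Type*} [Fintype ι] [Fintype κ] {m m0 : MeasurableSpace Ω}
    {P : Measure Ω} {G V : Ω → ι → κ → ℝ}
    (hG : ∀ i j, Integrable (fun ω => G ω i j) P)
    (hGV : ∀ i j, Integrable (fun ω => G ω i j * V ω i j) P)
    (hV : ∀ i j, StronglyMeasurable[m] (fun ω => V ω i j)) :
    P[fun ω => ∑ i, ∑ j, G ω i j * V ω i j|m]
      =ᵐ[P] fun ω => ∑ i, ∑ j, (P[fun ω' => G ω' i j|m]) ω * V ω i j := by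
  have h1 : (fun ω => ∑ i, ∑ j, G ω i j * V ω i j)
      = ∑ p : ι × κ, fun ω => G ω p.1 p.2 * V ω p.1 p.2 := by
    ext ω
    simp [Fintype.sum_prod_type]
  have h2 : ∀ᵐ ω ∂P, ∀ p : ι × κ, (P[fun ω => G ω p.1 p.2 * V ω p.1 p.2|m]) ω
      = (P[fun ω' => G ω' p.1 p.2|m]) ω * V ω p.1 p.2 :=
    ae_all_iff.2 fun p =>
      condExp_mul_of_stronglyMeasurable_right (hV p.1 p.2) (hGV p.1 p.2) (hG p.1 p.2)
  rw [h1]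
  filter_upwards [condExp_finsetSum (s := Finset.univ)
    (fun (p : ι × κ) _ => hGV p.1 p.2) m, h2] with ω h3 h4
  rw [h3]
  simp [h4, Fintype.sum_prod_type]

/-- The step size balances the two terms of the regret bound. -/
lemma average_regret_le {m L B T η R D : ℝ} (hm : 2 ≤ m) (hL : 0 ≤ L) (hB : 0 < B) (hT : 0 < T)
    (hη : η = √(m * Real.log m / (T * B ^ 2)))
    (hR : η * R ≤ m * Real.log m + η ^ 2 / 2 * (T * B ^ 2))
    (hD : D ≤ R + √(8 * T * m * B ^ 2 * L)) :
    D / T ≤ 2 * B * √(2 * (m * Real.log m) * (1 + 16 * L) / T) := by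
  have hlog : 1 / 2 ≤ Real.log m := by
    have := Real.log_two_gt_d9
    have := Real.log_le_log (by norm_num) hm
    linarith
  have hq : 0 < m * Real.log m := by nlinarith
  set q := m * Real.log m with hqdef
  set A := √q with hA
  set E := √(8 * m * L) with hE
  set s := √T with hs
  have hA0 : 0 < A := Real.sqrt_pos.2 hq
  have hs0 : 0 < s := Real.sqrt_pos.2 hT
  have hA2 : A ^ 2 = q := Real.sq_sqrt hq.le
  have hE2 : E ^ 2 = 8 * m * L := Real.sq_sqrt (by positivity)
  have hs2 : s ^ 2 = T := Real.sq_sqrt hT.le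
  have hη' : η = A / (s * B) := by
    rw [hη, Real.sqrt_div hq.le, Real.sqrt_mul hT.le, Real.sqrt_sq hB.le]
  have hε : √(8 * T * m * B ^ 2 * L) = s * B * E := by
    rw [show 8 * T * m * B ^ 2 * L = T * B ^ 2 * (8 * m * L) by ring,
      Real.sqrt_mul (by positivity), Real.sqrt_mul hT.le, Real.sqrt_sq hB.le]
  have hR' : R ≤ 3 / 2 * (A * (s * B)) := by
    have h1 : η * (3 / 2 * (A * (s * B))) = q + η ^ 2 / 2 * (T * B ^ 2) := by
      rw [hη', ← hA2, ← hs2]; field_simp; ring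
    exact le_of_mul_le_mul_left (hR.trans_eq h1.symm) (by rw [hη']; positivity)
  have hmain : 3 / 2 * A + E ≤ 2 * √(2 * q * (1 + 16 * L)) := by
    have : √(2 * q * (1 + 16 * L)) ^ 2 = 2 * q * (1 + 16 * L) := Real.sq_sqrt (by positivity)
    refine le_of_sq_le_sq ?_ (by positivity)
    have h1 : m * L ≤ 2 * (q * L) := by
      rw [hqdef]
      nlinarith [mul_nonneg (mul_nonneg (by linarith : 0 ≤ m) hL) (sub_nonneg.2 hlog)]
    have h2 : 0 ≤ q * L := by positivity
    rw [mul_pow, this]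
    nlinarith [sq_nonneg (3 / 2 * A - E)]
  rw [Real.sqrt_div (by positivity), ← hs, div_le_iff₀ hT]
  calc D ≤ s * B * (3 / 2 * A + E) := by rw [hε] at hD; linarith
    _ ≤ s * B * (2 * √(2 * q * (1 + 16 * L))) := by gcongr
    _ = 2 * B * (√(2 * q * (1 + 16 * L)) / s) * T := by rw [← hs2]; field_simp

/-- **Stochastic matrix multiplicative updates** (Corollary C.12).  Let `ℳ` be
the set of left-stochastic `m̃ × m̃` matrices and `f₁, …, f_T` concave on `ℳ`.
Starting from the matrix with all entries `1/m̃` and step size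
`η = √(m̃ ln m̃ / (T B_ĝ²))`, perform element-wise multiplicative updates with
column normalization, using stochastic supergradients `ĝ^(t)` (adapted random
matrices, bounded by `B_ĝ` in the `L_{∞,2}` norm almost surely, whose
conditional expectations given the past are supergradients of `f_t` at
`M^(t)`).  Then for every `M* ∈ ℳ`, with probability at least `1 − δ`,
`(1/T) ∑ₜ fₜ(M*) − (1/T) ∑ₜ fₜ(M^(t))
  ≤ 2 B_ĝ √(2 (m̃ ln m̃)(1 + 16 ln(1/δ)) / T)`. -/
theorem stochastic_matrix_multiplicative_updates
    {mt : ℕ}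
    {Ω : Type*} {m0 : MeasurableSpace Ω} (P : Measure Ω) [IsProbabilityMeasure P]
    (ℱ : Filtration ℕ m0)
    (MM : Set (Fin mt → Fin mt → ℝ))
    (hMM : MM = {M | ∀ j, (fun i => M i j) ∈ stdSimplex ℝ (Fin mt)})
    (f : ℕ → (Fin mt → Fin mt → ℝ) → ℝ)
    (hconc : ∀ t, ConcaveOn ℝ MM (f t))
    (Bg δ : ℝ) (hδ : 0 < δ)
    (T : ℕ) (hT : 0 < T)
    (η : ℝ) (hη : η = Real.sqrt ((mt : ℝ) * Real.log mt / (T * Bg ^ 2)))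
    (Ms : ℕ → Ω → Fin mt → Fin mt → ℝ)
    (gs : ℕ → Ω → Fin mt → Fin mt → ℝ)
    (hinit : ∀ ω i j, Ms 0 ω i j = 1 / (mt : ℝ))
    -- adaptedness
    (hMmeas : ∀ t, Measurable[ℱ t] (Ms t))
    (hgmeas : ∀ t, Measurable[ℱ (t + 1)] (gs t))
    -- the conditional expectation of `ĝ^(t)` is a supergradient of `f_t`
    -- at `M^(t)`
    (hsuper : ∀ t < T, ∀ᵐ ω ∂P, ∀ Y ∈ MM,
      f t Y ≤ f t (Ms t ω)
        + ∑ i, ∑ j, (P[fun ω' => gs t ω' i j|ℱ t]) ω * (Y i j - Ms t ω i j))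
    -- almost-sure `L_{∞,2}` norm bound
    (hgb : ∀ t < T, ∀ᵐ ω ∂P, Real.sqrt (∑ j, (⨆ i, |gs t ω i j|) ^ 2) ≤ Bg)
    -- element-wise multiplicative update followed by column normalization
    (hupdate : ∀ t < T, ∀ ω i j,
      Ms (t + 1) ω i j = (Ms t ω i j * Real.exp (η * gs t ω i j))
        / ∑ k, Ms t ω k j * Real.exp (η * gs t ω k j)) :
    ∀ M' ∈ MM,
      ENNReal.ofReal (1 - δ) ≤ P {ω |
        (1 / (T : ℝ)) * ∑ t ∈ Finset.range T, f t M'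
          - (1 / (T : ℝ)) * ∑ t ∈ Finset.range T, f t (Ms t ω)
        ≤ 2 * Bg * Real.sqrt (2 * ((mt : ℝ) * Real.log mt)
            * (1 + 16 * Real.log (1 / δ)) / T)} := by
  intro M' hM'
  subst hMM
  have hBg : 0 ≤ Bg := by
    obtain ⟨ω, hω⟩ := (hgb 0 hT).exists
    exact (Real.sqrt_nonneg _).trans hω
  have hT' : (0 : ℝ) < T := by exact_mod_cast hT
  have hrhs : 0 ≤ 2 * Bg * √(2 * ((mt : ℝ) * Real.log mt) * (1 + 16 * Real.log (1 / δ)) / T) := by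
    positivity
  have hsure (h : ∀ᵐ ω ∂P, ∀ t < T, f t M' ≤ f t (Ms t ω)) :
      ENNReal.ofReal (1 - δ) ≤ P {ω | (1 / (T : ℝ)) * ∑ t ∈ Finset.range T, f t M'
          - (1 / (T : ℝ)) * ∑ t ∈ Finset.range T, f t (Ms t ω)
        ≤ 2 * Bg * √(2 * ((mt : ℝ) * Real.log mt) * (1 + 16 * Real.log (1 / δ)) / T)} := by
    refine (ENNReal.ofReal_le_one.2 (by linarith)).trans ?_
    rw [← measure_univ (μ := P)]
    refine measure_mono_ae ?_
    filter_upwards [h] with ω hω _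
    refine le_trans ?_ hrhs
    rw [sub_nonpos]
    exact mul_le_mul_of_nonneg_left
      (Finset.sum_le_sum fun t ht => hω t (Finset.mem_range.1 ht)) (by positivity)
  rcases Nat.eq_zero_or_pos mt with rfl | hmt
  · exact hsure (.of_forall fun ω t _ => (congrArg (f t) (Subsingleton.elim _ _)).le)
  have hmem : ∀ t ≤ T, ∀ ω j, (fun i => Ms t ω i j) ∈ stdSimplex ℝ (Fin mt) ∧
      ∀ i, 0 < Ms t ω i j := by
    intro t
    induction t with
    | zero =>
      intro _ ω j
      simp only [hinit]
      refine ⟨⟨fun _ => by positivity, ?_⟩, fun _ => by positivity⟩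
      simp [hmt.ne']
    | succ t ih =>
      intro ht ω j
      obtain ⟨h1, h2⟩ := ih (by omega) ω j
      exact multiplicative_update_mem_stdSimplex h1 h2 fun i => hupdate t (by omega) ω i j
  rcases (Nat.succ_le_of_lt hmt).eq_or_lt with rfl | hmt2
  · refine hsure (.of_forall fun ω t ht => (congrArg (f t) ?_).le)
    ext i j
    have h1 := (hM' j).2
    have h2 := (hmem t ht.le ω j).1.2
    simp only [Finset.univ_unique, Finset.sum_singleton] at h1 h2
    rw [Subsingleton.elim i default, h1, h2]
  have hentry : ∀ t < T, ∀ᵐ ω ∂P, ∀ i j, |gs t ω i j| ≤ Bg := by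
    intro t ht
    filter_upwards [hgb t ht] with ω h i j
    refine (abs_le_iSup_abs _ i j).trans (le_trans ?_ h)
    refine Real.le_sqrt_of_sq_le ?_
    exact Finset.single_le_sum (f := fun j => (⨆ i, |gs t ω i j|) ^ 2)
      (fun _ _ => sq_nonneg _) (Finset.mem_univ j)
  rcases hBg.eq_or_lt with rfl | hBg
  · refine hsure (ae_all_iff.2 fun t => ?_)
    by_cases ht : t < T
    · have hz (i j : Fin mt) : P[fun ω => gs t ω i j|ℱ t] =ᵐ[P] 0 := by
        refine (condExp_congr_ae (g := 0) ?_).trans (by rw [condExp_zero])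
        filter_upwards [hentry t ht] with ω h using abs_nonpos_iff.1 (h i j)
      have hz' := ae_all_iff.2 fun i => ae_all_iff.2 fun j => hz i j
      filter_upwards [hsuper t ht, hz'] with ω h1 h2 _
      simpa [h2] using h1 M' hM'
    · exact .of_forall fun ω h => absurd h ht
  by_cases hδ1 : 1 ≤ δ
  · rw [ENNReal.ofReal_of_nonpos (by linarith)]
    exact zero_le
  push Not at hδ1
  set L := Real.log (1 / δ) with hL
  have hL0 : 0 < L := Real.log_pos (by rw [one_div]; exact (one_lt_inv₀ hδ).2 hδ1)
  have hgm (t : ℕ) (i j : Fin mt) : StronglyMeasurable[ℱ (t + 1)] fun ω => gs t ω i j :=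
    ((measurable_pi_apply j).comp ((measurable_pi_apply i).comp (hgmeas t))).stronglyMeasurable
  have hVm (t : ℕ) (i j : Fin mt) : StronglyMeasurable[ℱ t] fun ω => M' i j - Ms t ω i j :=
    stronglyMeasurable_const.sub
      ((measurable_pi_apply j).comp ((measurable_pi_apply i).comp (hMmeas t))).stronglyMeasurable
  set X : ℕ → Ω → ℝ := fun t ω => ∑ i, ∑ j, gs t ω i j * (M' i j - Ms t ω i j) with hX
  set c := 2 * √mt * Bg with hc
  have hm0 : (0 : ℝ) < mt := by exact_mod_cast hmt
  have hc0 : 0 < c := by positivity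
  have hXm : ∀ t < T, StronglyMeasurable[ℱ (t + 1)] (X t) := fun t _ =>
    Finset.stronglyMeasurable_fun_sum _ fun i _ => Finset.stronglyMeasurable_fun_sum _ fun j _ =>
      (hgm t i j).mul ((hVm t i j).mono (ℱ.mono t.le_succ))
  have hXb : ∀ t < T, ∀ᵐ ω ∂P, |X t ω| ≤ c := by
    intro t ht
    filter_upwards [hgb t ht] with ω h
    simpa [hc] using abs_sum_mul_sub_le hM' (fun j => (hmem t ht.le ω j).1) h
  have hcond : ∀ t < T, P[X t|ℱ t]
      =ᵐ[P] fun ω => ∑ i, ∑ j, (P[fun ω' => gs t ω' i j|ℱ t]) ω * (M' i j - Ms t ω i j) := by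
    intro t ht
    have hgi (i j : Fin mt) : Integrable (fun ω => gs t ω i j) P := by
      refine .of_bound ((hgm t i j).mono (ℱ.le _)).aestronglyMeasurable Bg ?_
      filter_upwards [hentry t ht] with ω h using h i j
    refine condExp_sum_mul hgi (fun i j => ?_) (hVm t)
    refine (hgi i j).mul_bdd (c := 1) ((hVm t i j).mono (ℱ.le _)).aestronglyMeasurable
      (.of_forall fun ω => ?_)
    have h1 := mem_Icc_of_mem_stdSimplex (hM' j) i
    have h2 := mem_Icc_of_mem_stdSimplex (hmem t ht.le ω j).1 i
    exact abs_le.2 ⟨by linarith [h1.1, h2.2], by linarith [h1.2, h2.1]⟩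
  set ε := √(8 * T * mt * Bg ^ 2 * L) with hε
  have htail := measureReal_le_sum_condExp_sub hc0 hT hXm hXb (Real.sqrt_nonneg _ : 0 ≤ ε)
  have hexp : Real.exp (-ε ^ 2 / (2 * T * c ^ 2)) = δ := by
    have h1 : -ε ^ 2 / (2 * T * c ^ 2) = -L := by
      rw [hε, Real.sq_sqrt (by positivity), hc, mul_pow, mul_pow, Real.sq_sqrt hm0.le]
      field_simp
      ring
    rw [h1, hL, one_div, Real.log_inv, neg_neg, Real.exp_log hδ]
  rw [hexp] at htail
  have hSmeas : Measurable fun ω => ∑ t ∈ Finset.range T, ((P[X t|ℱ t]) ω - X t ω) :=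
    Finset.measurable_fun_sum _ fun t ht =>
      (stronglyMeasurable_condExp.mono (ℱ.le t)).measurable.sub
        ((hXm t (Finset.mem_range.1 ht)).mono (ℱ.le _)).measurable
  have hEmeas := measurableSet_le (measurable_const (a := ε)) hSmeas
  calc ENNReal.ofReal (1 - δ)
      ≤ ENNReal.ofReal (P.real {ω | ε ≤ ∑ t ∈ Finset.range T, ((P[X t|ℱ t]) ω - X t ω)}ᶜ) := by
        rw [probReal_compl_eq_one_sub hEmeas]
        exact ENNReal.ofReal_le_ofReal (by linarith)
    _ = P {ω | ε ≤ ∑ t ∈ Finset.range T, ((P[X t|ℱ t]) ω - X t ω)}ᶜ := ofReal_measureReal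
    _ ≤ _ := by
        refine measure_mono_ae ?_
        have hall : ∀ᵐ ω ∂P, ∀ t < T, √(∑ j, (⨆ i, |gs t ω i j|) ^ 2) ≤ Bg ∧
            f t M' - f t (Ms t ω) ≤ (P[X t|ℱ t]) ω := by
          refine ae_all_iff.2 fun t => ?_
          by_cases ht : t < T
          · filter_upwards [hgb t ht, hsuper t ht, hcond t ht] with ω h1 h2 h3 _
            refine ⟨h1, ?_⟩
            rw [h3]
            linarith [h2 M' hM']
          · exact .of_forall fun ω h => absurd h ht
        filter_upwards [hall] with ω hω hlt
        have hlt : ∑ t ∈ Finset.range T, ((P[X t|ℱ t]) ω - X t ω) < ε := not_le.1 hlt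
        have hreg := matrix_multiplicative_weights_regret (w := fun t => Ms t ω)
          (g := fun t => gs t ω) hM' (fun t ht => hmem t ht ω)
          (by simpa using hinit ω) (fun t ht => (hω t ht).1)
          (fun t ht => hupdate t ht ω)
        rw [Fintype.card_fin] at hreg
        have hdiff : ∑ t ∈ Finset.range T, f t M' - ∑ t ∈ Finset.range T, f t (Ms t ω)
            ≤ ∑ t ∈ Finset.range T, X t ω + ε := by
          rw [← Finset.sum_sub_distrib]
          have := Finset.sum_le_sum fun t ht => (hω t (Finset.mem_range.1 ht)).2
          rw [Finset.sum_sub_distrib] at hlt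
          linarith
        have hfin := average_regret_le (by exact_mod_cast hmt2) hL0.le hBg hT' hη hreg hdiff
        change (1 / (T : ℝ)) * _ - (1 / (T : ℝ)) * _ ≤ _
        rwa [← mul_sub, one_div_mul_eq_div]
end
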